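/- Let S be a surface, 𝒞 a circle decomposition of S, and C₀ a connected component of the boundary ∂S which is homeomorphic to the circle. Then C₀ ∈ 𝒞, and there exists a topological embedding h : Circle × Set.Icc (0:ℝ) 1 → S with h '' {p | p.2 = 0} = C₀, whose image is a neighborhood of C₀ in S, and with h '' {p | p.2 = 1} ∈ 𝒞. -/

import Mathlib

open Topology Set

/-- A circle in a topological space `X`: a subset homeomorphic to the unit circle. -/
def IsCircle {X : Type*} [TopologicalSpace X] (C : Set X) : Prop :=
  Nonempty (C ≃ₜ Circle)

/-- A circle decomposition of `X`: a set of pairwise disjoint circles whose union is `X`. -/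
def IsCircleDecomposition {X : Type*} [TopologicalSpace X] (𝒞 : Set (Set X)) : Prop :=
  (∀ C ∈ 𝒞, IsCircle C) ∧
  (∀ C ∈ 𝒞, ∀ D ∈ 𝒞, C ≠ D → Disjoint C D) ∧
  ⋃₀ 𝒞 = Set.univ

/-- A point `x` of a surface is a manifold-interior point if it has an open neighborhood
homeomorphic to the plane `ℝ²`. -/
def IsManifoldInteriorPt {S : Type*} [TopologicalSpace S] (x : S) : Prop :=
  ∃ U : Set S, IsOpen U ∧ x ∈ U ∧ Nonempty (U ≃ₜ EuclideanSpace ℝ (Fin 2))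

namespace CircleDecomp

/-- `f` admits a continuous logarithm on `s`. -/
def HasLog {X : Type*} [TopologicalSpace X] (f : X → ℂ) (s : Set X) : Prop :=
  ∃ g : X → ℂ, ContinuousOn g s ∧ ∀ x ∈ s, Complex.exp (g x) = f x

section HasLog
variable {X : Type*} [TopologicalSpace X] {f g : X → ℂ} {s t : Set X}

lemma HasLog.mono (h : HasLog f t) (hst : s ⊆ t) : HasLog f s := by
  obtain ⟨g, hg, hgf⟩ := h
  exact ⟨g, hg.mono hst, fun x hx => hgf x (hst hx)⟩

lemma HasLog.congr (h : HasLog f s) (hfg : ∀ x ∈ s, f x = g x) : HasLog g s := by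
  obtain ⟨l, hl, hlf⟩ := h
  exact ⟨l, hl, fun x hx => (hlf x hx).trans (hfg x hx)⟩

lemma HasLog.mul (hf : HasLog f s) (hg : HasLog g s) : HasLog (fun x => f x * g x) s := by
  obtain ⟨l, hl, hlf⟩ := hf
  obtain ⟨m, hm, hmg⟩ := hg
  exact ⟨fun x => l x + m x, hl.add hm, fun x hx => by
    rw [Complex.exp_add, hlf x hx, hmg x hx]⟩

lemma HasLog.inv (hf : HasLog f s) : HasLog (fun x => (f x)⁻¹) s := by
  obtain ⟨l, hl, hlf⟩ := hf
  exact ⟨fun x => - l x, hl.neg, fun x hx => by rw [Complex.exp_neg, hlf x hx]⟩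

lemma HasLog.div (hf : HasLog f s) (hg : HasLog g s) : HasLog (fun x => f x / g x) s := by
  simpa only [div_eq_mul_inv] using hf.mul hg.inv

lemma HasLog.comp {Y : Type*} [TopologicalSpace Y] {φ : Y → X} {u : Set Y} (hf : HasLog f s)
    (hφ : ContinuousOn φ u) (hu : MapsTo φ u s) : HasLog (fun y => f (φ y)) u := by
  obtain ⟨l, hl, hlf⟩ := hf
  exact ⟨l ∘ φ, hl.comp hφ hu, fun y hy => hlf _ (hu hy)⟩

lemma HasLog.ne_zero (hf : HasLog f s) {x : X} (hx : x ∈ s) : f x ≠ 0 := by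
  obtain ⟨l, hl, hlf⟩ := hf
  rw [← hlf x hx]
  exact Complex.exp_ne_zero _

lemma HasLog.pow (hf : HasLog f s) (n : ℤ) : HasLog (fun x => f x ^ n) s := by
  obtain ⟨l, hl, hlf⟩ := hf
  exact ⟨fun x => n * l x, continuousOn_const.mul hl, fun x hx => by
    rw [Complex.exp_int_mul, hlf x hx]⟩

lemma hasLog_const {c : ℂ} (hc : c ≠ 0) (s : Set X) : HasLog (fun _ => c) s :=
  ⟨fun _ => Complex.log c, continuousOn_const, fun _ _ => Complex.exp_log hc⟩

lemma hasLog_of_slitPlane (hf : ContinuousOn f s) (h : ∀ x ∈ s, f x ∈ Complex.slitPlane) :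
    HasLog f s :=
  ⟨fun x => Complex.log (f x), hf.clog h,
    fun x hx => Complex.exp_log (Complex.slitPlane_ne_zero (h x hx))⟩

/-- Homotopy invariance of the existence of a continuous logarithm. -/
lemma HasLog.homotopy (H : ℝ → X → ℂ)
    (hH : ContinuousOn (fun p : ℝ × X => H p.1 p.2) (Icc 0 1 ×ˢ s))
    (h0 : ∀ t ∈ Icc (0:ℝ) 1, ∀ x ∈ s, H t x ≠ 0) (hL : HasLog (H 0) s) : HasLog (H 1) s := by
  obtain ⟨l, hl, hlf⟩ := hL
  have hc : Continuous fun p : unitInterval × s => H p.1 p.2 := by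
    have : Continuous fun p : unitInterval × s => ((p.1 : ℝ), (p.2 : X)) := by fun_prop
    exact hH.comp_continuous this (fun p => ⟨p.1.2, p.2.2⟩)
  let HH : C(unitInterval × s, {z : ℂ // z ≠ 0}) :=
    ⟨fun p => ⟨H p.1 p.2, h0 _ p.1.2 _ p.2.2⟩, hc.subtype_mk _⟩
  let ll : C(s, ℂ) := ⟨fun x => l x, hl.comp_continuous continuous_subtype_val (fun x => x.2)⟩
  have cov := Complex.isCoveringMap_exp
  have hst : ∀ a : s, HH (0, a) = ⟨Complex.exp (ll a), Complex.exp_ne_zero _⟩ := by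
    intro a
    apply Subtype.ext
    exact (hlf a a.2).symm
  have key := cov.liftHomotopy_lifts HH ll hst
  set L := cov.liftHomotopy HH ll hst
  classical
  refine ⟨fun x => if hx : x ∈ s then L (1, ⟨x, hx⟩) else 0, ?_, ?_⟩
  · rw [continuousOn_iff_continuous_domRestrict]
    have : Continuous fun x : s => L (1, x) := by fun_prop
    convert this using 2 with x
    simp [Set.domRestrict]
  · intro x hx
    have := congrFun key (1, ⟨x, hx⟩)
    have := congrArg Subtype.val this
    simpa [hx, HH] using this

/-- A logarithm of `1` on a preconnected set is constant. -/
lemma log_one_const (hs : IsPreconnected s) (hf : ContinuousOn f s)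
    (h1 : ∀ x ∈ s, Complex.exp (f x) = 1) : ∀ x ∈ s, ∀ y ∈ s, f x = f y := by
  have hpi : (2 * Real.pi * Complex.I) ≠ 0 := Complex.two_pi_I_ne_zero
  choose! n hn using fun x hx => Complex.exp_eq_one_iff.1 (h1 x hx)
  have hc : ContinuousOn (fun x => (f x / (2 * Real.pi * Complex.I)).re) s :=
    Complex.continuous_re.comp_continuousOn (hf.div_const _)
  have hval : ∀ x ∈ s, (f x / (2 * Real.pi * Complex.I)).re = n x := by
    intro x hx
    rw [hn x hx, mul_div_assoc, div_self hpi]; simp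
  have himg : (fun x => (f x / (2 * Real.pi * Complex.I)).re) '' s ⊆ range ((↑) : ℤ → ℝ) := by
    rintro _ ⟨x, hx, rfl⟩
    exact ⟨n x, (hval x hx).symm⟩
  have hsub := (hs.image _ hc)
  have hd : IsTotallyDisconnected (range ((↑) : ℤ → ℝ)) := by
    apply Set.Countable.isTotallyDisconnected
    exact countable_range _
  intro x hx y hy
  have := hd _ himg hsub ⟨x, hx, rfl⟩ ⟨y, hy, rfl⟩
  simp only at this
  rw [hval x hx, hval y hy] at this
  rw [hn x hx, hn y hy]
  have : n x = n y := by exact_mod_cast this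
  rw [this]

lemma log_sub_const {l m : X → ℂ} (hs : IsPreconnected s) (hl : ContinuousOn l s)
    (hm : ContinuousOn m s) (h : ∀ x ∈ s, Complex.exp (l x) = Complex.exp (m x)) :
    ∀ x ∈ s, ∀ y ∈ s, l x - m x = l y - m y := by
  refine log_one_const hs (hl.sub hm) fun x hx => ?_
  rw [Complex.exp_sub, h x hx, div_self (Complex.exp_ne_zero _)]

lemma HasLog.union_aux {l m : X → ℂ} (hlf : ∀ x ∈ s, Complex.exp (l x) = f x)
    (hmf : ∀ x ∈ t, Complex.exp (m x) = f x)
    (hl : ContinuousOn l s) (hm : ContinuousOn m t)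
    (hpre : IsPreconnected (s ∩ t)) :
    ∃ m' : X → ℂ, ContinuousOn m' t ∧ (∀ x ∈ t, Complex.exp (m' x) = f x) ∧
      EqOn l m' (s ∩ t) := by
  rcases (s ∩ t).eq_empty_or_nonempty with h | ⟨x0, hx0⟩
  · exact ⟨m, hm, hmf, by simp [h]⟩
  have hc := log_sub_const hpre (hl.mono inter_subset_left) (hm.mono inter_subset_right)
    (fun x hx => (hlf x hx.1).trans (hmf x hx.2).symm)
  refine ⟨fun x => m x + (l x0 - m x0), hm.add continuousOn_const, fun x hx => ?_, fun x hx => ?_⟩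
  · rw [Complex.exp_add, hmf x hx, Complex.exp_sub, hlf _ hx0.1, hmf _ hx0.2, div_self, mul_one]
    rw [← hmf _ hx0.2]; exact Complex.exp_ne_zero _
  · change l x = m x + (l x0 - m x0)
    rw [hc x0 hx0 x hx]; ring

lemma HasLog.union_closed (hs : HasLog f s) (ht : HasLog f t) (hsc : IsClosed s)
    (htc : IsClosed t) (hpre : IsPreconnected (s ∩ t)) : HasLog f (s ∪ t) := by
  classical
  obtain ⟨l, hl, hlf⟩ := hs
  obtain ⟨m₀, hm₀, hmf₀⟩ := ht
  obtain ⟨m, hm, hmf, hlm⟩ := HasLog.union_aux hlf hmf₀ hl hm₀ hpre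
  refine ⟨s.piecewise l m, ?_, ?_⟩
  · apply ContinuousOn.union_of_isClosed _ _ hsc htc
    · exact hl.congr fun x hx => by simp [hx]
    · refine hm.congr fun x hx => ?_
      by_cases hxs : x ∈ s
      · simp [hxs, hlm ⟨hxs, hx⟩]
      · simp [hxs]
  · intro x hx
    by_cases hxs : x ∈ s
    · simp [hxs, hlf]
    · simp [hxs, hmf x (hx.resolve_left hxs)]

lemma HasLog.union_open (hs : HasLog f s) (ht : HasLog f t) (hsc : IsOpen s)
    (htc : IsOpen t) (hpre : IsPreconnected (s ∩ t)) : HasLog f (s ∪ t) := by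
  classical
  obtain ⟨l, hl, hlf⟩ := hs
  obtain ⟨m₀, hm₀, hmf₀⟩ := ht
  obtain ⟨m, hm, hmf, hlm⟩ := HasLog.union_aux hlf hmf₀ hl hm₀ hpre
  refine ⟨s.piecewise l m, ?_, ?_⟩
  · apply ContinuousOn.union_of_isOpen _ _ hsc htc
    · exact hl.congr fun x hx => by simp [hx]
    · refine hm.congr fun x hx => ?_
      by_cases hxs : x ∈ s
      · simp [hxs, hlm ⟨hxs, hx⟩]
      · simp [hxs]
  · intro x hx
    by_cases hxs : x ∈ s
    · simp [hxs, hlf]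
    · simp [hxs, hmf x (hx.resolve_left hxs)]

end HasLog

section Plane

variable {s : Set ℂ}

lemma hasLog_of_starConvex {E : Type*} [AddCommGroup E] [Module ℝ E] [TopologicalSpace E]
    [IsTopologicalAddGroup E] [ContinuousSMul ℝ E] {s : Set E} {f : E → ℂ} {p : E} (hp : p ∈ s)
    (hs : StarConvex ℝ p s) (hf : ContinuousOn f s)
    (h0 : ∀ z ∈ s, f z ≠ 0) : HasLog f s := by
  have hmem : ∀ t ∈ Icc (0:ℝ) 1, ∀ x ∈ s, p + t • (x - p) ∈ s := by
    intro t ht x hx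
    exact hs.add_smul_sub_mem hx ht.1 ht.2
  have := HasLog.homotopy (s := s) (fun t x => f (p + t • (x - p))) ?_ ?_ ?_
  · exact this.congr fun x _ => by simp
  · apply hf.comp (by fun_prop)
    rintro ⟨t, x⟩ ⟨ht, hx⟩
    exact hmem t ht x hx
  · intro t ht x hx
    exact h0 _ (hmem t ht x hx)
  · exact (hasLog_const (h0 p hp) s).congr fun x _ => by simp

lemma hasLog_of_convex {E : Type*} [AddCommGroup E] [Module ℝ E] [TopologicalSpace E]
    [IsTopologicalAddGroup E] [ContinuousSMul ℝ E] {s : Set E} {f : E → ℂ} (hs : Convex ℝ s)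
    (hf : ContinuousOn f s) (h0 : ∀ z ∈ s, f z ≠ 0) : HasLog f s := by
  rcases s.eq_empty_or_nonempty with rfl | ⟨p, hp⟩
  · exact ⟨fun _ => 0, by simp, by simp⟩
  · exact hasLog_of_starConvex hp (hs hp) hf h0

/-- `z - p` has no continuous logarithm on a circle around `p`. -/
lemma not_hasLog_sphere (p : ℂ) {r : ℝ} (hr : 0 < r) :
    ¬ HasLog (fun z => z - p) (Metric.sphere p r) := by
  rintro ⟨l, hl, hlf⟩
  have hm : ∀ θ : ℝ, p + r * Complex.exp (θ * Complex.I) ∈ Metric.sphere p r := by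
    intro θ
    simp [Complex.norm_exp_ofReal_mul_I, abs_of_pos hr]
  have hcont : Continuous fun θ : ℝ => l (p + r * Complex.exp (θ * Complex.I)) :=
    hl.comp_continuous (by fun_prop) hm
  have hr' : (r : ℂ) ≠ 0 := by exact_mod_cast hr.ne'
  have := log_sub_const (s := (univ : Set ℝ))
    (l := fun θ : ℝ => l (p + r * Complex.exp (θ * Complex.I)))
    (m := fun θ : ℝ => Complex.log r + θ * Complex.I) isPreconnected_univ hcont.continuousOn
    (by fun_prop) (fun θ _ => by
      rw [hlf _ (hm θ), Complex.exp_add, Complex.exp_log hr']; ring) 0 trivial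
      (2 * Real.pi) trivial
  simp only [Complex.ofReal_zero, zero_mul, Complex.exp_zero, Complex.ofReal_mul,
    Complex.ofReal_ofNat, Complex.exp_two_pi_mul_I] at this
  have h2 : (2 * Real.pi * Complex.I) = 0 := by linear_combination this
  exact Complex.two_pi_I_ne_zero h2

/-- A path avoiding `s` gives a logarithm on `s`. -/
lemma hasLog_of_path (α : C(unitInterval, ℂ)) (hα : ∀ t, α t ∉ s) :
    HasLog (fun z => (z - α 1) / (z - α 0)) s := by
  have hne : ∀ t, ∀ z ∈ s, z - α t ≠ 0 := by
    intro t z hz h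
    rw [sub_eq_zero] at h
    exact hα t (h ▸ hz)
  have := HasLog.homotopy (s := s)
    (fun t z => (z - α (projIcc 0 1 zero_le_one t)) / (z - α 0)) ?_ ?_ ?_
  · exact this.congr fun x _ => by simp
  · have hc : Continuous fun t : ℝ => α (projIcc 0 1 zero_le_one t) :=
      α.continuous.comp continuous_projIcc
    apply ContinuousOn.div (by fun_prop) (by fun_prop)
    rintro ⟨t, x⟩ ⟨ht, hx⟩
    exact hne 0 x hx
  · intro t ht x hx
    exact div_ne_zero (hne _ x hx) (hne _ x hx)
  · refine (hasLog_const one_ne_zero s).congr fun x hx => ?_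
    simp [div_self (hne 0 x hx)]

lemma joinedIn_of_mem_component {K : Set ℂ} (hK : IsClosed K) {a b : ℂ}
    (h : b ∈ connectedComponentIn Kᶜ a) : JoinedIn Kᶜ a b := by
  have ha : a ∈ Kᶜ := by
    by_contra ha
    rw [connectedComponentIn_eq_empty ha] at h
    exact h
  have hU : IsOpen (connectedComponentIn Kᶜ a) := hK.isOpen_compl.connectedComponentIn
  have hc : IsConnected (connectedComponentIn Kᶜ a) :=
    isConnected_connectedComponentIn_iff.2 ha
  exact ((hU.isConnected_iff_isPathConnected.1 hc).joinedIn a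
    (mem_connectedComponentIn ha) b h).mono (connectedComponentIn_subset _ _)

lemma hasLog_of_mem_component {K : Set ℂ} (hK : IsClosed K) {a b : ℂ}
    (h : b ∈ connectedComponentIn Kᶜ a) : HasLog (fun z => (z - b) / (z - a)) K := by
  obtain ⟨γ, hγ⟩ := joinedIn_of_mem_component hK h
  have := hasLog_of_path (s := K) ⟨γ, γ.continuous⟩ (fun t => hγ t)
  simpa using this

lemma hasLog_sub_of_far {K : Set ℂ} {b : ℂ} (h : ∀ z ∈ K, ‖z‖ < ‖b‖) :
    HasLog (fun z => z - b) K := by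
  by_cases hb : b = 0
  · refine ⟨fun _ => 0, by fun_prop, fun z hz => ?_⟩
    have := h z hz
    simp only [hb, norm_zero] at this
    exact absurd this (norm_nonneg z).not_gt
  have h1 : HasLog (fun z => 1 - z / b) K := by
    apply hasLog_of_slitPlane (by fun_prop)
    intro z hz
    left
    have : ‖z / b‖ < 1 := by
      rw [norm_div, div_lt_one (norm_pos_iff.2 hb)]; exact h z hz
    have := (Complex.abs_re_le_norm (z / b)).trans_lt this
    rw [abs_lt] at this
    simp only [Complex.sub_re, Complex.one_re]
    linarith
  refine ((hasLog_const (neg_ne_zero.2 hb) K).mul h1).congr fun z _ => ?_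
  field_simp
  ring

/-- `z - a` has a logarithm on `K` as soon as the component of `a` is unbounded. -/
lemma hasLog_of_unbounded {K : Set ℂ} (hK : IsCompact K) {a : ℂ}
    (h : ¬ Bornology.IsBounded (connectedComponentIn Kᶜ a)) : HasLog (fun z => z - a) K := by
  obtain ⟨R, hR⟩ := hK.isBounded.exists_norm_le
  have : ∃ b ∈ connectedComponentIn Kᶜ a, R < ‖b‖ := by
    by_contra! hcon
    exact h (isBounded_iff_forall_norm_le.2 ⟨R, hcon⟩)
  obtain ⟨b, hb, hRb⟩ := this
  have h1 := hasLog_of_mem_component hK.isClosed hb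
  have h2 : HasLog (fun z => z - b) K :=
    hasLog_sub_of_far fun z hz => (hR z hz).trans_lt hRb
  refine (h2.div h1).congr fun z hz => ?_
  rw [div_div_cancel₀]
  exact h2.ne_zero hz

lemma isConnected_norm_mem {I : Set ℝ} (hI : IsConnected I) (h0 : ∀ r ∈ I, 0 ≤ r) :
    IsConnected {z : ℂ | ‖z‖ ∈ I} := by
  have : {z : ℂ | ‖z‖ ∈ I} =
      (fun p : ℝ × ℝ => (p.1 : ℂ) * Complex.exp (p.2 * Complex.I)) '' (I ×ˢ univ) := by
    ext z
    constructor
    · intro hz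
      exact ⟨(‖z‖, z.arg), ⟨hz, trivial⟩, Complex.norm_mul_exp_arg_mul_I z⟩
    · rintro ⟨⟨r, θ⟩, ⟨hr, -⟩, rfl⟩
      simpa [Complex.norm_exp_ofReal_mul_I, abs_of_nonneg (h0 r hr)] using hr
  rw [this]
  exact (hI.prod isConnected_univ).image _ (by fun_prop)

lemma isConnected_norm_gt (R : ℝ) : IsConnected {z : ℂ | R < ‖z‖} := by
  rcases lt_or_ge R 0 with h | h
  · have : {z : ℂ | R < ‖z‖} = univ := by ext z; simpa using h.trans_le (norm_nonneg z)
    rw [this]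
    exact isConnected_univ
  · exact isConnected_norm_mem (I := Ioi R) isConnected_Ioi fun r hr => h.trans (le_of_lt hr)

lemma component_eq_of_unbounded {K : Set ℂ} (hK : Bornology.IsBounded K) {a b : ℂ}
    (ha : ¬ Bornology.IsBounded (connectedComponentIn Kᶜ a))
    (hb : ¬ Bornology.IsBounded (connectedComponentIn Kᶜ b)) :
    connectedComponentIn Kᶜ a = connectedComponentIn Kᶜ b := by
  obtain ⟨R, hR⟩ := hK.exists_norm_le
  have hsub : {z : ℂ | R < ‖z‖} ⊆ Kᶜ := fun z hz hzK => (hR z hzK).not_gt hz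
  have key : ∀ c : ℂ, ¬ Bornology.IsBounded (connectedComponentIn Kᶜ c) →
      ∃ d, R < ‖d‖ ∧ connectedComponentIn Kᶜ c = connectedComponentIn Kᶜ d := by
    intro c hc
    by_contra! hcon
    refine hc (isBounded_iff_forall_norm_le.2 ⟨R, fun x hx => ?_⟩)
    by_contra! hx'
    exact hcon x hx' (connectedComponentIn_eq hx)
  obtain ⟨a', ha', hae⟩ := key a ha
  obtain ⟨b', hb', hbe⟩ := key b hb
  rw [hae, hbe]
  exact connectedComponentIn_eq
    ((isConnected_norm_gt R).isPreconnected.subset_connectedComponentIn ha' hsub hb')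

lemma closure_component_subset {K : Set ℂ} (hK : IsClosed K) (a : ℂ) :
    closure (connectedComponentIn Kᶜ a) ⊆ connectedComponentIn Kᶜ a ∪ K := by
  intro z hz
  by_cases hzK : z ∈ K
  · exact Or.inr hzK
  left
  have ho : IsOpen (connectedComponentIn Kᶜ z) := hK.isOpen_compl.connectedComponentIn
  obtain ⟨y, hy1, hy2⟩ := mem_closure_iff.1 hz _ ho (mem_connectedComponentIn hzK)
  rw [connectedComponentIn_eq hy2, ← connectedComponentIn_eq hy1]
  exact mem_connectedComponentIn hzK

lemma frontier_component_subset {K : Set ℂ} (hK : IsClosed K) (a : ℂ) :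
    frontier (connectedComponentIn Kᶜ a) ⊆ K := by
  intro z hz
  have ho : IsOpen (connectedComponentIn Kᶜ a) := hK.isOpen_compl.connectedComponentIn
  rw [ho.frontier_eq] at hz
  exact (closure_component_subset hK a hz.1).resolve_left hz.2

lemma eilenberg_aux {K : Set ℂ} (hK : IsCompact K) {a b : ℂ} (ha : a ∉ K) (hb : b ∉ K)
    (h : HasLog (fun z => (z - a) / (z - b)) K)
    (hbd : Bornology.IsBounded (connectedComponentIn Kᶜ a)) :
    b ∈ connectedComponentIn Kᶜ a := by
  classical
  by_contra hbU
  set U := connectedComponentIn Kᶜ a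
  have hU : IsOpen U := hK.isClosed.isOpen_compl.connectedComponentIn
  have haU : a ∈ U := mem_connectedComponentIn ha
  have hbU' : b ∉ closure U := fun hcl =>
    (closure_component_subset hK.isClosed a hcl).elim hbU hb
  obtain ⟨l, hl, hlf⟩ := h
  obtain ⟨L, hL⟩ := ContinuousMap.exists_restrict_eq hK.isClosed
    (⟨K.domRestrict l, continuousOn_iff_continuous_domRestrict.1 hl⟩ : C(K, ℂ))
  have hLl : ∀ z ∈ K, L z = l z := fun z hz => by
    have := congrArg (fun f : C(K, ℂ) => f ⟨z, hz⟩) hL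
    simpa using this
  let G : ℂ → ℂ := U.piecewise (fun z => Complex.exp (L z) * (z - b)) (fun z => z - a)
  have hG : Continuous G := by
    apply Continuous.piecewise
    · intro z hz
      have hzK := frontier_component_subset hK.isClosed a hz
      rw [hLl z hzK, hlf z hzK]
      have : z - b ≠ 0 := by
        rw [sub_ne_zero]; rintro rfl; exact hb hzK
      field_simp
    · have := L.continuous
      fun_prop
    · fun_prop
  have hG0 : ∀ z, G z ≠ 0 := by
    intro z
    by_cases hz : z ∈ U
    · simp only [G, hz, piecewise_eq_of_mem, ne_eq, mul_eq_zero, Complex.exp_ne_zero, false_or,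
        sub_eq_zero]
      rintro rfl
      exact hbU hz
    · simp only [G, hz, not_false_eq_true, piecewise_eq_of_notMem, ne_eq, sub_eq_zero]
      rintro rfl
      exact hz haU
  have hlog : HasLog G univ := hasLog_of_convex convex_univ hG.continuousOn fun z _ => hG0 z
  obtain ⟨R, hR⟩ := hbd.subset_ball a
  have hR0 : 0 < R := by
    have := hR haU
    simpa using this
  refine not_hasLog_sphere a hR0 ((hlog.mono (subset_univ _)).congr fun z hz => ?_)
  have : z ∉ U := fun hzU => by
    have h1 := hR hzU
    rw [Metric.mem_ball] at h1
    rw [Metric.mem_sphere] at hz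
    exact h1.ne hz
  simp [G, this]

/-- Eilenberg's criterion. -/
lemma mem_component_of_hasLog {K : Set ℂ} (hK : IsCompact K) {a b : ℂ} (ha : a ∉ K) (hb : b ∉ K)
    (h : HasLog (fun z => (z - a) / (z - b)) K) :
    b ∈ connectedComponentIn Kᶜ a := by
  by_cases hbd : Bornology.IsBounded (connectedComponentIn Kᶜ a)
  · exact eilenberg_aux hK ha hb h hbd
  by_cases hbd' : Bornology.IsBounded (connectedComponentIn Kᶜ b)
  · have := eilenberg_aux hK hb ha (h.inv.congr fun z _ => by rw [inv_div]) hbd'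
    rw [← connectedComponentIn_eq this]
    exact mem_connectedComponentIn hb
  · rw [component_eq_of_unbounded hK.isBounded hbd hbd']
    exact mem_connectedComponentIn hb

/-- Janiszewski's theorem. -/
lemma janiszewski {K L : Set ℂ} (hK : IsCompact K) (hL : IsCompact L)
    (hKL : IsPreconnected (K ∩ L)) {a b : ℂ} (h1 : b ∈ connectedComponentIn Kᶜ a)
    (h2 : b ∈ connectedComponentIn Lᶜ a) : b ∈ connectedComponentIn (K ∪ L)ᶜ a := by
  have haK : a ∉ K := fun ha => by
    rw [connectedComponentIn_eq_empty (by simpa using ha)] at h1; exact h1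
  have haL : a ∉ L := fun ha => by
    rw [connectedComponentIn_eq_empty (by simpa using ha)] at h2; exact h2
  have hbK : b ∉ K := connectedComponentIn_subset _ _ h1
  have hbL : b ∉ L := connectedComponentIn_subset _ _ h2
  apply mem_component_of_hasLog (hK.union hL) (by simp [haK, haL]) (by simp [hbK, hbL])
  refine ((hasLog_of_mem_component hK.isClosed h1).union_closed
    (hasLog_of_mem_component hL.isClosed h2) hK.isClosed hL.isClosed hKL).inv.congr fun z _ => ?_
  rw [inv_div]

lemma not_isPreconnected_compl_of_paths (α β : C(unitInterval, ℂ)) (h0 : α 0 = β 0)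
    (h1 : α 1 = β 1) (hne : α 0 ≠ α 1) (hαβ : range α ∩ range β ⊆ {α 0, α 1}) :
    ¬ IsPreconnected (range α ∪ range β)ᶜ := by
  intro hpre
  have hA := hasLog_of_path (s := (range α)ᶜ) α (by simp)
  have hB := hasLog_of_path (s := (range β)ᶜ) β (by simp)
  rw [← h0, ← h1] at hB
  have hAB := hA.union_open hB (isCompact_range α.continuous).isClosed.isOpen_compl
    (isCompact_range β.continuous).isClosed.isOpen_compl (by rwa [← compl_union])
  rw [← compl_inter] at hAB
  have hd : 0 < dist (α 0) (α 1) := dist_pos.2 hne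
  set r := dist (α 0) (α 1) / 2 with hr
  have hr0 : 0 < r := by positivity
  have hsub : Metric.sphere (α 0) r ⊆ (range α ∩ range β)ᶜ := by
    intro z hz hz'
    rw [Metric.mem_sphere] at hz
    rcases hαβ hz' with h | h
    · rw [h, dist_self] at hz; exact hr0.ne hz
    · rw [mem_singleton_iff.1 h, dist_comm] at hz; linarith
  have hlog1 := hAB.mono hsub
  have hlog2 : HasLog (fun z => z - α 1) (Metric.closedBall (α 0) r) := by
    apply hasLog_of_convex (convex_closedBall _ _) (by fun_prop)
    intro z hz h
    rw [sub_eq_zero] at h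
    rw [Metric.mem_closedBall, h, dist_comm] at hz
    linarith
  refine not_hasLog_sphere (α 0) hr0
    (((hlog2.mono Metric.sphere_subset_closedBall).div hlog1).congr fun z hz => ?_)
  rw [div_div_cancel₀]
  exact hlog2.ne_zero (Metric.sphere_subset_closedBall hz)

end Plane

section Continua
variable {X : Type*} [TopologicalSpace X]

lemma isClosed_connectedComponentIn' {D : Set X} (hD : IsClosed D) (x : X) :
    IsClosed (connectedComponentIn D x) := by
  by_cases hx : x ∈ D
  · rw [connectedComponentIn_eq_image hx]
    exact hD.isClosedMap_subtype_val _ isClosed_connectedComponent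
  · rw [connectedComponentIn_eq_empty hx]
    exact isClosed_empty

lemma exists_clopen_of_component_subset [T2Space X] {D U : Set X} (hD : IsCompact D) {x : X}
    (hx : x ∈ D) (hU : IsOpen U) (h : connectedComponentIn D x ⊆ U) :
    ∃ E V : Set X, IsClosed E ∧ x ∈ E ∧ E ⊆ U ∧ IsOpen V ∧ E = D ∩ V := by
  have : CompactSpace D := isCompact_iff_compactSpace.1 hD
  have hcc := connectedComponent_eq_iInter_isClopen (⟨x, hx⟩ : D)
  rw [connectedComponentIn_eq_image hx, image_subset_iff, hcc] at h
  have hne : Nonempty {s : Set D // IsClopen s ∧ (⟨x, hx⟩ : D) ∈ s} :=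
    ⟨⟨univ, isClopen_univ, trivial⟩⟩
  obtain ⟨⟨s, hs, hxs⟩, hsU⟩ := exists_subset_nhds_of_compactSpace
    (V := fun s : {s : Set D // IsClopen s ∧ (⟨x, hx⟩ : D) ∈ s} => (s : Set D)) (by
      rintro ⟨s, hs, hxs⟩ ⟨t, ht, hxt⟩
      exact ⟨⟨s ∩ t, hs.inter ht, hxs, hxt⟩, inter_subset_left, inter_subset_right⟩)
    (fun s => s.2.1.1) (U := Subtype.val ⁻¹' U)
    (fun y hy => (hU.preimage continuous_subtype_val).mem_nhds (h hy))
  obtain ⟨V, hV, hVs⟩ := isOpen_induced_iff.1 hs.2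
  refine ⟨Subtype.val '' s, V, hD.isClosed.isClosedMap_subtype_val _ hs.1, ⟨_, hxs, rfl⟩,
    image_subset_iff.2 hsU, hV, ?_⟩
  rw [← hVs, Subtype.image_preimage_coe]

/-- Boundary bumping. -/
lemma boundary_bumping [T2Space X] {K U : Set X} (hK : IsCompact K) (hKc : IsPreconnected K)
    (hU : IsOpen U) {x : X} (hxK : x ∈ K) (hxU : x ∈ U) (hKU : ¬ K ⊆ U) :
    (connectedComponentIn (K ∩ closure U) x \ U).Nonempty := by
  by_contra hne
  rw [not_nonempty_iff_eq_empty, sdiff_eq_empty] at hne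
  obtain ⟨E, V, hE, hxE, hEU, hV, hEV⟩ := exists_clopen_of_component_subset
    (hK.inter_right isClosed_closure) ⟨hxK, subset_closure hxU⟩ hU hne
  have hEK : E ⊆ K := by rw [hEV]; exact fun y hy => hy.1.1
  have := isPreconnected_iff_subset_of_disjoint.1 hKc (U ∩ V) Eᶜ (hU.inter hV) hE.isOpen_compl
    (fun y hy => by
      by_cases hyE : y ∈ E
      · left
        refine ⟨hEU hyE, ?_⟩
        rw [hEV] at hyE
        exact hyE.2
      · exact Or.inr hyE)
    (by
      apply eq_empty_of_forall_notMem
      rintro y ⟨hyK, ⟨hyU, hyV⟩, hyE⟩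
      apply hyE
      rw [hEV]
      exact ⟨⟨hyK, subset_closure hyU⟩, hyV⟩)
  rcases this with h | h
  · exact hKU (h.trans inter_subset_left)
  · exact h hxK hxE

lemma sierpinski_step [T2Space X] {F : ℕ → Set X} (hF : ∀ n, IsClosed (F n))
    (hd : ∀ m n, m ≠ n → Disjoint (F m) (F n)) {K : Set X} (hK : IsCompact K)
    (hKc : IsConnected K) (hKF : K ⊆ ⋃ n, F n) (hno : ∀ n, ¬ K ⊆ F n) (n : ℕ) :
    ∃ K' ⊆ K, IsCompact K' ∧ IsConnected K' ∧ (∀ m, ¬ K' ⊆ F m) ∧ Disjoint K' (F n) := by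
  obtain ⟨x, hxK, hxn⟩ := not_subset.1 (hno n)
  obtain ⟨m, hxm⟩ := mem_iUnion.1 (hKF hxK)
  have hmn : m ≠ n := by rintro rfl; exact hxn hxm
  obtain ⟨U, V, hU, hV, hmU, hnV, hUV⟩ := (hd m n hmn |>.mono
    (inter_subset_right (s := K) (t := F m)) (inter_subset_right (s := K) (t := F n)) |>
    SeparatedNhds.of_isCompact_isCompact (hK.inter_right (hF m)) (hK.inter_right (hF n)))
  have hcl : Disjoint (closure U) V := hUV.closure_left hV
  have hxU : x ∈ U := hmU ⟨hxK, hxm⟩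
  by_cases hKU : K ⊆ U
  · refine ⟨K, subset_rfl, hK, hKc, hno, ?_⟩
    rw [disjoint_left]
    intro y hy hyn
    exact disjoint_left.1 hUV (hKU hy) (hnV ⟨hy, hyn⟩)
  obtain ⟨y, hy, hyU⟩ := boundary_bumping hK hKc.isPreconnected hU hxK hxU hKU
  have hxmem : x ∈ K ∩ closure U := ⟨hxK, subset_closure hxU⟩
  have hsub := connectedComponentIn_subset (K ∩ closure U) x
  refine ⟨connectedComponentIn (K ∩ closure U) x, hsub.trans inter_subset_left, ?_,
    isConnected_connectedComponentIn_iff.2 hxmem, ?_, ?_⟩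
  · have hcl : IsClosed (K ∩ closure U) := hK.isClosed.inter isClosed_closure
    exact (hK.inter_right isClosed_closure).of_isClosed_subset (isClosed_connectedComponentIn' hcl x) hsub
  · intro k hk
    have hxk := hk (mem_connectedComponentIn hxmem)
    have : k = m := by
      by_contra hkm
      exact disjoint_left.1 (hd k m hkm) hxk hxm
    subst this
    exact hyU (hmU ⟨(hsub hy).1, hk hy⟩)
  · rw [disjoint_left]
    intro z hz hzn
    have hz' := hsub hz
    exact disjoint_left.1 hcl hz'.2 (hnV ⟨hz'.1, hzn⟩)

/-- Sierpiński's theorem on countable decompositions of continua. -/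
lemma sierpinski [T2Space X] {F : ℕ → Set X} (hF : ∀ n, IsClosed (F n))
    (hd : ∀ m n, m ≠ n → Disjoint (F m) (F n)) {K : Set X} (hK : IsCompact K)
    (hKc : IsConnected K) (hKF : K ⊆ ⋃ n, F n) : ∃ n, K ⊆ F n := by
  by_contra! hno
  let T := {L : Set X // L ⊆ K ∧ IsCompact L ∧ IsConnected L ∧ ∀ m, ¬ L ⊆ F m}
  have hstep : ∀ (n : ℕ) (L : T), ∃ L' : T, L'.1 ⊆ L.1 ∧ Disjoint L'.1 (F n) := by
    rintro n ⟨L, hLK, hLc, hLn, hL⟩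
    obtain ⟨L', h1, h2, h3, h4, h5⟩ := sierpinski_step hF hd hLc hLn (hLK.trans hKF) hL n
    exact ⟨⟨L', h1.trans hLK, h2, h3, h4⟩, h1, h5⟩
  choose next hnext hdisj using hstep
  let S : ℕ → T := fun n => Nat.rec ⟨K, subset_rfl, hK, hKc, hno⟩ next n
  have hne := IsCompact.nonempty_iInter_of_sequence_nonempty_isCompact_isClosed
    (fun n => (S n).1) (fun n => hnext n (S n)) (fun n => (S n).2.2.2.1.nonempty)
    (S 0).2.2.1 (fun n => (S n).2.2.1.isClosed)
  obtain ⟨x, hx⟩ := hne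
  rw [mem_iInter] at hx
  obtain ⟨n, hn⟩ := mem_iUnion.1 (hKF (hx 0))
  exact disjoint_left.1 (hdisj n (S n)) (hx (n + 1)) hn

/-- A version of Sierpiński's theorem for countable sets of closed sets. -/
lemma sierpinski_sUnion [T2Space X] {𝒦 : Set (Set X)} (hc : 𝒦.Countable)
    (hF : ∀ K ∈ 𝒦, IsClosed K) (hd : 𝒦.PairwiseDisjoint id) {K : Set X} (hK : IsCompact K)
    (hKc : IsConnected K) (hKF : K ⊆ ⋃₀ 𝒦) : ∃ L ∈ 𝒦, K ⊆ L := by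
  classical
  obtain ⟨f, hf⟩ := Set.countable_iff_exists_injOn.1 hc
  let F : ℕ → Set X := fun n => if h : ∃ L ∈ 𝒦, f L = n then h.choose else ∅
  have hFv : ∀ L ∈ 𝒦, F (f L) = L := by
    intro L hL
    have h : ∃ L' ∈ 𝒦, f L' = f L := ⟨L, hL, rfl⟩
    simp only [F, h, dif_pos]
    exact hf h.choose_spec.1 hL h.choose_spec.2
  have hFm : ∀ n, F n = ∅ ∨ (F n ∈ 𝒦 ∧ f (F n) = n) := by
    intro n
    by_cases h : ∃ L ∈ 𝒦, f L = n
    · right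
      simp only [F, h, dif_pos]
      exact h.choose_spec
    · left
      simp only [F, h, dif_neg, not_false_eq_true]
  have hFc : ∀ n, IsClosed (F n) := fun n => by
    rcases hFm n with h | h
    · rw [h]; exact isClosed_empty
    · exact hF _ h.1
  have hFd : ∀ m n, m ≠ n → Disjoint (F m) (F n) := fun m n hmn => by
    rcases hFm m with h | h
    · rw [h]; exact empty_disjoint _
    rcases hFm n with h' | h'
    · rw [h']; exact disjoint_empty _
    refine hd h.1 h'.1 fun he => hmn ?_
    exact h.2.symm.trans ((congrArg f he).trans h'.2)
  obtain ⟨n, hn⟩ := sierpinski hFc hFd hK hKc fun x hx => by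
    obtain ⟨L, hL, hxL⟩ := hKF hx
    exact mem_iUnion.2 ⟨f L, by rwa [hFv L hL]⟩
  rcases hFm n with h | h
  · rw [h] at hn
    exact absurd (hn hKc.nonempty.some_mem) (by simp)
  · exact ⟨_, h.1, hn⟩

lemma isPreconnected_union_of_separated [PreconnectedSpace X] {B P Q : Set X}
    (hB : IsPreconnected B) (hU : B ∪ P ∪ Q = univ) (h1 : Disjoint (closure P) Q)
    (h2 : Disjoint P (closure Q)) : IsPreconnected (B ∪ P) := by
  have main : ∀ u v : Set X, IsOpen u → IsOpen v → B ∪ P ⊆ u ∪ v → (B ∪ P) ∩ (u ∩ v) = ∅ →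
      B ⊆ u → B ∪ P ⊆ u ∨ B ∪ P ⊆ v := by
    intro u v hu hv huv hd hBu
    have hcov : ∀ y, y ∈ closure Q ∨ y ∈ B ∪ P := fun y => by
      have : y ∈ B ∪ P ∪ Q := hU ▸ mem_univ y
      exact this.elim Or.inr (fun h => Or.inl (subset_closure h))
    have hNP : (B ∪ P) ∩ v ⊆ P := by
      rintro y ⟨hy | hy, hyv⟩
      · exact absurd (show y ∈ (B ∪ P) ∩ (u ∩ v) from ⟨Or.inl hy, hBu hy, hyv⟩) (by simp [hd])
      · exact hy
    have hopen : IsOpen ((B ∪ P) ∩ v) := by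
      have : (B ∪ P) ∩ v = v ∩ (closure Q)ᶜ := by
        ext y
        constructor
        · intro hy
          exact ⟨hy.2, disjoint_left.1 h2 (hNP hy)⟩
        · rintro ⟨hyv, hyQ⟩
          exact ⟨(hcov y).resolve_left hyQ, hyv⟩
      rw [this]
      exact hv.inter isClosed_closure.isOpen_compl
    have hclosed : IsClosed ((B ∪ P) ∩ v) := by
      rw [← closure_subset_iff_isClosed]
      intro y hy
      have hyQ : y ∉ Q := disjoint_left.1 h1 (closure_mono hNP hy)
      have hyBP : y ∈ B ∪ P := by
        have : y ∈ B ∪ P ∪ Q := hU ▸ mem_univ y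
        exact this.resolve_right hyQ
      refine ⟨hyBP, ?_⟩
      by_contra hyv
      obtain ⟨z, hzu, hz⟩ := mem_closure_iff.1 hy u hu ((huv hyBP).resolve_right hyv)
      exact absurd (show z ∈ (B ∪ P) ∩ (u ∩ v) from ⟨hz.1, hzu, hz.2⟩) (by simp [hd])
    rcases isClopen_iff.1 ⟨hclosed, hopen⟩ with h | h
    · left
      intro y hy
      refine (huv hy).resolve_right fun hyv => ?_
      exact absurd (show y ∈ (B ∪ P) ∩ v from ⟨hy, hyv⟩) (by simp [h])
    · right
      intro y _
      exact (h ▸ mem_univ y : y ∈ (B ∪ P) ∩ v).2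
  rw [isPreconnected_iff_subset_of_disjoint]
  intro u v hu hv huv hd
  have hBd : B ∩ (u ∩ v) = ∅ :=
    subset_empty_iff.1 (hd ▸ inter_subset_inter_left _ subset_union_left)
  rcases isPreconnected_iff_subset_of_disjoint.1 hB u v hu hv (subset_union_left.trans huv) hBd
    with h | h
  · exact main u v hu hv huv hd h
  · exact (main v u hv hu (by rwa [union_comm v u]) (by rwa [inter_comm v u]) h).symm

lemma isPreconnected_compl_component [PreconnectedSpace X] {C : Set X} (hC : IsPreconnected C)
    (a : X) : IsPreconnected (connectedComponentIn Cᶜ a)ᶜ := by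
  set B := connectedComponentIn Cᶜ a with hB
  have hCB : C ⊆ Bᶜ := fun y hy hyB => connectedComponentIn_subset _ _ hyB hy
  by_cases ha : a ∈ Cᶜ
  swap
  · rw [hB, connectedComponentIn_eq_empty ha, compl_empty]
    exact isPreconnected_univ
  have main : ∀ u v : Set X, IsOpen u → IsOpen v → Bᶜ ⊆ u ∪ v → Bᶜ ∩ (u ∩ v) = ∅ →
      C ⊆ u → Bᶜ ⊆ u := by
    intro u v hu hv huv hd hCu
    have hdis : ∀ z, z ∈ Bᶜ → z ∈ u → z ∈ v → False := fun z h1 h2 h3 => by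
      have : z ∈ Bᶜ ∩ (u ∩ v) := ⟨h1, h2, h3⟩
      rw [hd] at this
      exact this
    have hpre : IsPreconnected (B ∪ (Bᶜ ∩ v)) := by
      apply isPreconnected_union_of_separated (Q := Bᶜ ∩ u) isPreconnected_connectedComponentIn
      · ext z
        simp only [mem_union, mem_inter_iff, mem_univ, iff_true]
        by_cases hz : z ∈ B
        · exact Or.inl (Or.inl hz)
        · rcases huv hz with h | h
          · exact Or.inr ⟨hz, h⟩
          · exact Or.inl (Or.inr ⟨hz, h⟩)
      · rw [disjoint_right]
        rintro z ⟨hzB, hzu⟩ hz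
        obtain ⟨w, hwu, hw⟩ := mem_closure_iff.1 hz u hu hzu
        exact hdis w hw.1 hwu hw.2
      · rw [disjoint_left]
        rintro z ⟨hzB, hzu⟩ hz
        obtain ⟨w, hwv, hw⟩ := mem_closure_iff.1 hz v hv hzu
        exact hdis w hw.1 hw.2 hwv
    have hsub : B ∪ (Bᶜ ∩ v) ⊆ Cᶜ := by
      rintro z (hz | hz) hzC
      · exact hCB hzC hz
      · exact hdis z hz.1 (hCu hzC) hz.2
    have := hpre.subset_connectedComponentIn (Or.inl (mem_connectedComponentIn ha)) hsub
    intro z hz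
    refine (huv hz).resolve_right fun hzv => hz (this (Or.inr ⟨hz, hzv⟩))
  rw [isPreconnected_iff_subset_of_disjoint]
  intro u v hu hv huv hd
  have hCd : C ∩ (u ∩ v) = ∅ :=
    subset_empty_iff.1 (hd ▸ inter_subset_inter_left _ hCB)
  rcases isPreconnected_iff_subset_of_disjoint.1 hC u v hu hv (hCB.trans huv) hCd with h | h
  · exact Or.inl (main u v hu hv huv hd h)
  · exact Or.inr (main v u hv hu (by rwa [union_comm v u]) (by rwa [inter_comm v u]) h)

end Continua

section CircleMaps

lemma not_injective_circle_real {f : Circle → ℝ} (hf : Continuous f) :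
    ¬ Function.Injective f := by
  intro hinj
  have hc : Continuous fun z : Circle => f z - f (-z) := by fun_prop
  obtain ⟨z, hz⟩ : ∃ z : Circle, f z - f (-z) = 0 := by
    rcases le_total (f 1 - f (-1)) 0 with h | h
    · exact mem_range_of_exists_le_of_exists_ge hc ⟨1, h⟩ ⟨-1, by simp; linarith⟩
    · exact mem_range_of_exists_le_of_exists_ge hc ⟨-1, by simp; linarith⟩ ⟨1, h⟩
  have := hinj (sub_eq_zero.1 hz)
  have h2 : (z : ℂ) = -z := congrArg (fun w : Circle => (w : ℂ)) this
  have h3 : (z : ℂ) = 0 := by linear_combination h2 / 2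
  exact z.coe_ne_zero h3

lemma surjective_circle_of_injective {f : Circle → Circle} (hf : Continuous f)
    (hinj : Function.Injective f) : Function.Surjective f := by
  intro w
  by_contra! hw
  have hmem : ∀ z, ((-(f z / w) : Circle) : ℂ) ∈ Complex.slitPlane := by
    intro z
    rw [Complex.mem_slitPlane_iff_arg]
    refine ⟨fun harg => hw z ?_, Circle.coe_ne_zero _⟩
    have h1 : ((-(f z / w) : Circle) : ℂ) = -1 := by
      rw [← Complex.norm_mul_exp_arg_mul_I ((-(f z / w) : Circle) : ℂ), harg, Circle.norm_coe]
      simp [Complex.exp_pi_mul_I]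
    have h2 : -(f z / w) = -(1 : Circle) := by
      ext
      simpa using h1
    have h3 : f z / w = 1 := by simpa using h2
    exact div_eq_one.1 h3
  refine not_injective_circle_real (f := fun z => Complex.arg ((-(f z / w) : Circle) : ℂ)) ?_ ?_
  · rw [continuous_iff_continuousAt]
    intro z
    exact (Complex.continuousAt_arg (hmem z)).comp (f := fun z => ((-(f z / w) : Circle) : ℂ))
      (by fun_prop)
  · intro z z' h
    have h1 : -(f z / w) = -(f z' / w) := Circle.injective_arg h
    apply hinj
    simpa using h1

end CircleMaps

lemma isPreconnected_iInter_of_directed {X ι : Type*} [TopologicalSpace X] [T2Space X]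
    [CompactSpace X] [Nonempty ι] (Y : ι → Set X) (hd : Directed (· ⊇ ·) Y)
    (hcl : ∀ i, IsClosed (Y i)) (hc : ∀ i, IsPreconnected (Y i)) :
    IsPreconnected (⋂ i, Y i) := by
  rw [isPreconnected_iff_subset_of_disjoint_closed]
  intro u v hu hv huv hd'
  have hYc : IsClosed (⋂ i, Y i) := isClosed_iInter hcl
  have hdis : Disjoint ((⋂ i, Y i) ∩ u) ((⋂ i, Y i) ∩ v) := by
    rw [disjoint_left]
    rintro z ⟨hz, hzu⟩ ⟨-, hzv⟩
    exact (hd' ▸ (⟨hz, hzu, hzv⟩ : z ∈ (⋂ i, Y i) ∩ (u ∩ v)) : z ∈ (∅ : Set X))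
  obtain ⟨U, W, hU, hW, huU, hvW, hUW⟩ := SeparatedNhds.of_isCompact_isCompact
    (hYc.inter hu).isCompact (hYc.inter hv).isCompact hdis
  have hsub : ⋂ i, Y i ⊆ U ∪ W := fun z hz =>
    (huv hz).imp (fun h => huU ⟨hz, h⟩) (fun h => hvW ⟨hz, h⟩)
  obtain ⟨i, hi⟩ := (hU.union hW).isClosed_compl.isCompact.elim_directed_family_closed Y hcl
    (by
      apply eq_empty_of_forall_notMem
      rintro z ⟨hz, hz'⟩
      exact hz (hsub hz')) hd
  have hiUW : Y i ⊆ U ∪ W := by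
    intro z hz
    by_contra hzn
    exact (hi ▸ (⟨hzn, hz⟩ : z ∈ (U ∪ W)ᶜ ∩ Y i) : z ∈ (∅ : Set X))
  rcases isPreconnected_iff_subset_of_disjoint.1 (hc i) U W hU hW hiUW
    (by rw [hUW.inter_eq, inter_empty]) with h | h
  · left
    intro z hz
    refine (huv hz).resolve_right fun hzv => ?_
    exact disjoint_left.1 hUW (h (mem_iInter.1 hz i)) (hvW ⟨hz, hzv⟩)
  · right
    intro z hz
    refine (huv hz).resolve_left fun hzu => ?_
    exact disjoint_left.1 hUW (huU ⟨hz, hzu⟩) (h (mem_iInter.1 hz i))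

section Tree
variable {X : Type*} [TopologicalSpace X]

/-- The part of the space hidden from `o` by `K`. -/
def hidden (o : X) (K : Set X) : Set X := (connectedComponentIn Kᶜ o ∪ K)ᶜ

variable [LocallyConnectedSpace X] [ConnectedSpace X] {o : X} {K L : Set X}

omit [ConnectedSpace X] in
lemma isOpen_hidden (hK : IsClosed K) : IsOpen (hidden o K) := by
  rw [isOpen_iff_mem_nhds]
  intro x hx
  simp only [hidden, mem_compl_iff, mem_union, not_or] at hx
  have ho : IsOpen (connectedComponentIn Kᶜ x) := hK.isOpen_compl.connectedComponentIn
  refine Filter.mem_of_superset (ho.mem_nhds (mem_connectedComponentIn hx.2)) ?_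
  intro y hy
  simp only [hidden, mem_compl_iff, mem_union, not_or]
  refine ⟨fun hyo => hx.1 ?_, connectedComponentIn_subset _ _ hy⟩
  rw [connectedComponentIn_eq hyo, ← connectedComponentIn_eq hy]
  exact mem_connectedComponentIn hx.2

omit [LocallyConnectedSpace X] [ConnectedSpace X] in
lemma notMem_hidden (ho : o ∉ K) : o ∉ hidden o K := by
  simp only [hidden, mem_compl_iff, mem_union, not_or, not_and, not_not]
  exact fun h => absurd (mem_connectedComponentIn ho) h

omit [LocallyConnectedSpace X] [ConnectedSpace X] in
lemma disjoint_hidden : Disjoint K (hidden o K) :=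
  disjoint_left.2 fun _ hx h => h (Or.inr hx)

omit [LocallyConnectedSpace X] in
lemma isPreconnected_hidden_union (hKc : IsPreconnected K) :
    IsPreconnected (hidden o K ∪ K) := by
  have : hidden o K ∪ K = (connectedComponentIn Kᶜ o)ᶜ := by
    ext x
    simp only [hidden, mem_union, mem_compl_iff, not_or]
    constructor
    · rintro (h | h)
      · exact h.1
      · exact fun h' => connectedComponentIn_subset _ _ h' h
    · intro h
      by_cases hx : x ∈ K
      · exact Or.inr hx
      · exact Or.inl ⟨h, hx⟩
  rw [this]
  exact isPreconnected_compl_component hKc o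

omit [ConnectedSpace X] in
lemma isClosed_hidden_union (hK : IsClosed K) : IsClosed (hidden o K ∪ K) := by
  have : hidden o K ∪ K = (connectedComponentIn Kᶜ o)ᶜ := by
    ext x
    simp only [hidden, mem_union, mem_compl_iff, not_or]
    constructor
    · rintro (h | h)
      · exact h.1
      · exact fun h' => connectedComponentIn_subset _ _ h' h
    · intro h
      by_cases hx : x ∈ K
      · exact Or.inr hx
      · exact Or.inl ⟨h, hx⟩
  rw [this]
  exact (hK.isOpen_compl.connectedComponentIn).isClosed_compl

lemma isPreconnected_visible_union (hK : IsClosed K) (hKc : IsPreconnected K) :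
    IsPreconnected (hidden o K)ᶜ := by
  rw [hidden, compl_compl, union_comm]
  have hV : IsOpen (connectedComponentIn Kᶜ o) := hK.isOpen_compl.connectedComponentIn
  have hH : IsOpen (hidden o K) := isOpen_hidden hK
  have hd : Disjoint (connectedComponentIn Kᶜ o) (hidden o K) :=
    disjoint_left.2 fun _ hx h => h (Or.inl hx)
  apply isPreconnected_union_of_separated (Q := hidden o K) hKc
  · rw [union_comm K, hidden, union_compl_self]
  · exact hd.closure_left hH
  · exact hd.closure_right hV

omit [ConnectedSpace X] in
lemma subset_or_subset_hidden (hK : IsClosed K) (hLc : IsPreconnected L)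
    (hd : Disjoint K L) : L ⊆ connectedComponentIn Kᶜ o ∨ L ⊆ hidden o K := by
  have hV : IsOpen (connectedComponentIn Kᶜ o) := hK.isOpen_compl.connectedComponentIn
  have hH : IsOpen (hidden o K) := isOpen_hidden hK
  apply isPreconnected_iff_subset_of_disjoint.1 hLc _ _ hV hH
  · intro x hx
    by_cases hxV : x ∈ connectedComponentIn Kᶜ o
    · exact Or.inl hxV
    · exact Or.inr fun h => h.elim hxV (disjoint_right.1 hd hx)
  · apply eq_empty_of_forall_notMem
    rintro x ⟨-, hx1, hx2⟩
    exact hx2 (Or.inl hx1)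

lemma hidden_subset_of_subset (hK : IsClosed K) (hKc : IsPreconnected K) (hoK : o ∉ K)
    (h : L ⊆ hidden o K) : hidden o L ∪ L ⊆ hidden o K := by
  have hsub : (hidden o K)ᶜ ⊆ connectedComponentIn Lᶜ o :=
    (isPreconnected_visible_union hK hKc).subset_connectedComponentIn (notMem_hidden hoK)
      (compl_subset_compl.2 h)
  rintro x (hx | hx)
  · by_contra hx'
    exact hx (Or.inl (hsub hx'))
  · exact h hx

omit [LocallyConnectedSpace X] in
lemma hidden_disjoint_of_subset (hKc : IsPreconnected K) (hKne : K.Nonempty)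
    (h : L ⊆ connectedComponentIn Kᶜ o) (h' : K ⊆ connectedComponentIn Lᶜ o) :
    Disjoint (hidden o K ∪ K) (hidden o L ∪ L) := by
  obtain ⟨k, hk⟩ := hKne
  have h1 : hidden o K ∪ K ⊆ Lᶜ := by
    rintro x (hx | hx) hxL
    · exact hx (Or.inl (h hxL))
    · exact connectedComponentIn_subset _ _ (h' hx) hxL
  have h2 := (isPreconnected_hidden_union (o := o) hKc).subset_connectedComponentIn
    (Or.inr hk) h1
  rw [← connectedComponentIn_eq (h' hk)] at h2
  rw [disjoint_left]
  rintro x hx (hx' | hx')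
  · exact hx' (Or.inl (h2 hx))
  · exact h1 hx hx'

omit [LocallyConnectedSpace X] [ConnectedSpace X] in
/-- Removing an open set from a connected set keeps it connected, if the open set is attached
to the rest along a connected set. -/
lemma isPreconnected_diff {F H : Set X} (hF : IsPreconnected F) (hK : IsPreconnected K)
    (hKne : K.Nonempty) (hKH : Disjoint K H) (hH : IsOpen H) (hHK : IsClosed (H ∪ K))
    (hKF : H ∪ K ⊆ F) : IsPreconnected (F \ H) := by
  have hKF' : K ⊆ F \ H := fun x hx => ⟨hKF (Or.inr hx), disjoint_left.1 hKH hx⟩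
  have main : ∀ u v : Set X, IsOpen u → IsOpen v → F \ H ⊆ u ∪ v → F \ H ∩ (u ∩ v) = ∅ →
      K ⊆ u → F \ H ⊆ u := by
    intro u v hu hv huv hd hKu
    have := isPreconnected_iff_subset_of_disjoint.1 hF (u ∪ H) (v ∩ (H ∪ K)ᶜ) (hu.union hH)
      (hv.inter hHK.isOpen_compl) (fun x hx => by
        by_cases hxH : x ∈ H
        · exact Or.inl (Or.inr hxH)
        by_cases hxK : x ∈ K
        · exact Or.inl (Or.inl (hKu hxK))
        rcases huv ⟨hx, hxH⟩ with h | h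
        · exact Or.inl (Or.inl h)
        · exact Or.inr ⟨h, by simp [hxH, hxK]⟩) (by
        apply eq_empty_of_forall_notMem
        rintro x ⟨hxF, hxu, hxv, hxn⟩
        simp only [mem_compl_iff, mem_union, not_or] at hxn
        have : x ∈ F \ H ∩ (u ∩ v) := ⟨⟨hxF, hxn.1⟩, hxu.resolve_right hxn.1, hxv⟩
        rw [hd] at this
        exact this)
    rcases this with h | h
    · exact fun x hx => (h hx.1).resolve_right hx.2
    · obtain ⟨k, hk⟩ := hKne
      exact absurd (Or.inr hk) (h (hKF (Or.inr hk))).2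
  rw [isPreconnected_iff_subset_of_disjoint]
  intro u v hu hv huv hd
  have hKd : K ∩ (u ∩ v) = ∅ :=
    subset_empty_iff.1 (hd ▸ inter_subset_inter_left _ hKF')
  rcases isPreconnected_iff_subset_of_disjoint.1 hK u v hu hv (hKF'.trans huv) hKd with h | h
  · exact Or.inl (main u v hu hv huv hd h)
  · exact Or.inr (main v u hv hu (by rwa [union_comm v u]) (by rwa [inter_comm v u]) h)

variable {𝒦 : Set (Set X)}

lemma hidden_trichotomy (hcl : ∀ K ∈ 𝒦, IsClosed K) (hcon : ∀ K ∈ 𝒦, IsConnected K)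
    (ho : ∀ K ∈ 𝒦, o ∉ K) (hd : 𝒦.PairwiseDisjoint id) (hK : K ∈ 𝒦) (hL : L ∈ 𝒦)
    (hne : K ≠ L) : hidden o L ∪ L ⊆ hidden o K ∨ hidden o K ∪ K ⊆ hidden o L ∨
      Disjoint (hidden o K ∪ K) (hidden o L ∪ L) := by
  have hKL : Disjoint K L := hd hK hL hne
  rcases subset_or_subset_hidden (o := o) (hcl K hK) (hcon L hL).isPreconnected hKL with h | h
  · rcases subset_or_subset_hidden (o := o) (hcl L hL) (hcon K hK).isPreconnected hKL.symm
      with h' | h'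
    · right; right
      exact hidden_disjoint_of_subset (hcon K hK).isPreconnected (hcon K hK).nonempty
        h h'
    · right; left
      exact hidden_subset_of_subset (hcl L hL) (hcon L hL).isPreconnected (ho L hL) h'
  · left
    exact hidden_subset_of_subset (hcl K hK) (hcon K hK).isPreconnected (ho K hK) h

lemma isPreconnected_finset_visible (hcl : ∀ K ∈ 𝒦, IsClosed K)
    (hcon : ∀ K ∈ 𝒦, IsConnected K)
    (ho : ∀ K ∈ 𝒦, o ∉ K) (hd : 𝒦.PairwiseDisjoint id) (s : Finset (Set X)) :
    (∀ K ∈ s, K ∈ 𝒦) → IsPreconnected (⋂ K ∈ s, (hidden o K)ᶜ) := by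
  classical
  induction s using Finset.strongInduction with
  | H s ih =>
    intro hs
    rcases s.eq_empty_or_nonempty with rfl | ⟨K, hK⟩
    · simpa using isPreconnected_univ
    have hst : s.erase K ⊂ s := Finset.erase_ssubset hK
    by_cases hex : ∃ L ∈ s.erase K, hidden o K ∪ K ⊆ hidden o L
    · obtain ⟨L, hL, hKL⟩ := hex
      have hpre := ih _ hst fun M hM => hs M (Finset.mem_of_mem_erase hM)
      convert hpre using 1
      apply subset_antisymm
      · exact biInter_subset_biInter_left (Finset.erase_subset K s)
      · intro x hx
        rw [mem_iInter₂] at hx ⊢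
        intro M hM
        by_cases hMK : M = K
        · subst hMK
          exact fun hxM => hx L hL (hKL (Or.inl hxM))
        · exact hx M (Finset.mem_erase.2 ⟨hMK, hM⟩)
    · push Not at hex
      set t := (s.erase K).filter fun L => Disjoint (hidden o K ∪ K) (hidden o L ∪ L) with ht
      have htK : K ∉ t := by simp [ht]
      have hts : t ⊂ s := (Finset.filter_subset _ _).trans_ssubset hst
      have hpre := ih t hts fun M hM => hs M (hts.1 hM)
      have hK𝒦 := hs K hK
      have key := isPreconnected_diff (K := K) (H := hidden o K) hpre
        (hcon K hK𝒦).isPreconnected (hcon K hK𝒦).nonempty disjoint_hidden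
        (isOpen_hidden (hcl K hK𝒦)) (isClosed_hidden_union (hcl K hK𝒦)) (by
          intro x hx
          rw [mem_iInter₂]
          intro L hL hxL
          exact disjoint_left.1 (Finset.mem_filter.1 hL).2 hx (Or.inl hxL))
      convert key using 1
      apply subset_antisymm
      · intro x hx
        rw [mem_iInter₂] at hx
        exact ⟨mem_iInter₂.2 fun L hL => hx L (hts.1 hL), hx K hK⟩
      · rintro x ⟨hx, hxK⟩
        rw [mem_iInter₂] at hx ⊢
        intro L hL
        by_cases hLK : L = K
        · subst hLK; exact hxK
        by_cases hLt : L ∈ t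
        · exact hx L hLt
        have hLe : L ∈ s.erase K := Finset.mem_erase.2 ⟨hLK, hL⟩
        rcases hidden_trichotomy hcl hcon ho hd hK𝒦 (hs L hL) (Ne.symm hLK) with h | h | h
        · exact fun hxL => hxK (h (Or.inl hxL))
        · exact absurd h (hex L hLe)
        · exact absurd (Finset.mem_filter.2 ⟨hLe, h⟩) hLt

/-- The core of a family of barriers. -/
def core (o : X) (𝒦 : Set (Set X)) : Set X := ⋂ K ∈ 𝒦, (hidden o K)ᶜ

omit [ConnectedSpace X] in
lemma isClosed_core (hcl : ∀ K ∈ 𝒦, IsClosed K) : IsClosed (core o 𝒦) :=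
  isClosed_biInter fun K hK => (isOpen_hidden (hcl K hK)).isClosed_compl

omit [LocallyConnectedSpace X] [ConnectedSpace X] in
lemma mem_core (ho : ∀ K ∈ 𝒦, o ∉ K) : o ∈ core o 𝒦 :=
  mem_iInter₂.2 fun K hK => notMem_hidden (ho K hK)

lemma isConnected_core [CompactSpace X] [T2Space X] (hcl : ∀ K ∈ 𝒦, IsClosed K)
    (hcon : ∀ K ∈ 𝒦, IsConnected K)
    (ho : ∀ K ∈ 𝒦, o ∉ K) (hd : 𝒦.PairwiseDisjoint id) : IsConnected (core o 𝒦) := by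
  classical
  refine ⟨⟨o, mem_core ho⟩, ?_⟩
  have : Nonempty {s : Finset (Set X) // ∀ K ∈ s, K ∈ 𝒦} := ⟨⟨∅, by simp⟩⟩
  have := isPreconnected_iInter_of_directed (ι := {s : Finset (Set X) // ∀ K ∈ s, K ∈ 𝒦}) (fun s => ⋂ K ∈ s.1, (hidden o K)ᶜ) ?_ ?_ ?_
  · convert this using 1
    ext x
    simp only [core, mem_iInter, Subtype.forall]
    constructor
    · intro h s hs K hK
      exact h K (hs K hK)
    · intro h K hK
      exact h {K} (by simpa using hK) K (by simp)
  · rintro ⟨s, hs⟩ ⟨t, ht⟩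
    refine ⟨⟨s ∪ t, fun K hK => (Finset.mem_union.1 hK).elim (hs K) (ht K)⟩, ?_, ?_⟩
    · exact biInter_subset_biInter_left fun x hx => Finset.mem_union_left _ hx
    · exact biInter_subset_biInter_left fun x hx => Finset.mem_union_right _ hx
  · rintro ⟨s, hs⟩
    exact isClosed_biInter fun K hK => (isOpen_hidden (hcl K (hs K hK))).isClosed_compl
  · rintro ⟨s, hs⟩
    exact isPreconnected_finset_visible hcl hcon ho hd s hs

lemma countable_meeting_core [SecondCountableTopology X] (hcl : ∀ K ∈ 𝒦, IsClosed K)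
    (hcon : ∀ K ∈ 𝒦, IsConnected K)
    (ho : ∀ K ∈ 𝒦, o ∉ K) (hd : 𝒦.PairwiseDisjoint id) (hH : ∀ K ∈ 𝒦, (hidden o K).Nonempty) :
    {K ∈ 𝒦 | (K ∩ core o 𝒦).Nonempty}.Countable := by
  refine Set.PairwiseDisjoint.countable_of_isOpen (s := fun K => hidden o K) ?_
    (fun K hK => isOpen_hidden (hcl K hK.1)) (fun K hK => hH K hK.1)
  rintro K ⟨hK, x, hxK, hx⟩ L ⟨hL, y, hyL, hy⟩ hne
  rcases hidden_trichotomy hcl hcon ho hd hK hL hne with h | h | h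
  · exact absurd (h (Or.inr hyL)) (mem_iInter₂.1 hy K hK)
  · exact absurd (h (Or.inr hxK)) (mem_iInter₂.1 hx L hL)
  · exact h.mono subset_union_left subset_union_left

lemma core_inter_nonempty (hcl : ∀ K ∈ 𝒦, IsClosed K)
    (hcon : ∀ K ∈ 𝒦, IsConnected K)
    (ho : ∀ K ∈ 𝒦, o ∉ K) (hd : 𝒦.PairwiseDisjoint id) {J : Set X} (hJ : IsCompact J)
    (hJne : J.Nonempty) (hJK : ∀ K ∈ 𝒦, (K ∩ J).Nonempty) : (core o 𝒦 ∩ J).Nonempty := by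
  by_contra hno
  have hcov : J ⊆ ⋃ K : 𝒦, hidden o K.1 := by
    intro x hx
    by_contra hxn
    refine hno ⟨x, mem_iInter₂.2 fun K hK hxK => hxn (mem_iUnion.2 ⟨⟨K, hK⟩, hxK⟩), hx⟩
  obtain ⟨s, hs⟩ := hJ.elim_finite_subcover _ (fun K : 𝒦 => isOpen_hidden (hcl K.1 K.2)) hcov
  have hsne : s.Nonempty := by
    obtain ⟨x, hx⟩ := hJne
    obtain ⟨K, hK, -⟩ := mem_iUnion₂.1 (hs hx)
    exact ⟨K, hK⟩
  obtain ⟨K, hKs, hKmax⟩ := s.exists_maximalFor (fun K => hidden o K.1) hsne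
  obtain ⟨j, hjK, hjJ⟩ := hJK K.1 K.2
  obtain ⟨L, hLs, hjL⟩ := mem_iUnion₂.1 (hs hjJ)
  have hne : K.1 ≠ L.1 := by
    intro h
    rw [← h] at hjL
    exact disjoint_left.1 disjoint_hidden hjK hjL
  have hdk : Disjoint (hidden o L.1) L.1 := disjoint_hidden.symm
  have hcase : hidden o K.1 ∪ K.1 ⊆ hidden o L.1 := by
    rcases hidden_trichotomy hcl hcon ho hd K.2 L.2 hne with h | h | h
    · exact absurd (h (Or.inl hjL)) (disjoint_left.1 disjoint_hidden hjK)
    · exact h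
    · exact absurd (Or.inl hjL) (disjoint_left.1 h (Or.inr hjK))
  have := hKmax hLs (subset_union_left.trans hcase)
  exact disjoint_left.1 disjoint_hidden hjK (this hjL)

end Tree

section CircleParam
variable {X : Type*} [TopologicalSpace X]

lemma exists_param_of_isCircle {C : Set X} (hC : IsCircle C) :
    ∃ f : Circle → X, Continuous f ∧ Function.Injective f ∧ range f = C := by
  obtain ⟨e⟩ := hC
  refine ⟨fun z => e.symm z, by fun_prop, fun z w h => e.symm.injective (Subtype.ext h), ?_⟩
  ext x
  constructor
  · rintro ⟨z, rfl⟩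
    exact (e.symm z).2
  · intro hx
    exact ⟨e ⟨x, hx⟩, by simp⟩

lemma isCircle_range [T2Space X] {f : Circle → X} (hf : Continuous f)
    (hi : Function.Injective f) : IsCircle (range f) :=
  ⟨(hf.isClosedEmbedding hi).isEmbedding.toHomeomorph.symm⟩

lemma isCircle_isCompact {C : Set X} (hC : IsCircle C) : IsCompact C := by
  obtain ⟨f, hf, -, rfl⟩ := exists_param_of_isCircle hC
  exact isCompact_range hf

lemma isCircle_isConnected {C : Set X} (hC : IsCircle C) : IsConnected C := by
  obtain ⟨f, hf, -, rfl⟩ := exists_param_of_isCircle hC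
  exact isConnected_range hf

lemma isCircle_image {Y : Type*} [TopologicalSpace Y] [T2Space Y] {C : Set X} (hC : IsCircle C)
    {g : X → Y} (hg : ContinuousOn g C) (hi : InjOn g C) : IsCircle (g '' C) := by
  obtain ⟨f, hf, hfi, rfl⟩ := exists_param_of_isCircle hC
  rw [← range_comp]
  refine isCircle_range (hg.comp_continuous hf fun z => ⟨z, rfl⟩) fun z w h => ?_
  exact hfi (hi ⟨z, rfl⟩ ⟨w, rfl⟩ h)

/-- A continuous injection of the circle into a set homeomorphic to the circle is onto. -/
lemma range_eq_of_isCircle {D : Set X} (hD : IsCircle D) {f : Circle → X} (hf : Continuous f)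
    (hi : Function.Injective f) (h : ∀ z, f z ∈ D) : range f = D := by
  obtain ⟨e⟩ := hD
  have hs := surjective_circle_of_injective (f := fun z => e ⟨f z, h z⟩)
    (e.continuous.comp (hf.subtype_mk h)) (fun z w hzw => hi (by simpa using hzw))
  apply subset_antisymm
  · rintro _ ⟨z, rfl⟩; exact h z
  · intro x hx
    obtain ⟨z, hz⟩ := hs (e ⟨x, hx⟩)
    exact ⟨z, by simpa using hz⟩

lemma isCircle_eq_of_subset {C D : Set X} (hC : IsCircle C) (hD : IsCircle D) (h : C ⊆ D) :
    C = D := by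
  obtain ⟨f, hf, hfi, rfl⟩ := exists_param_of_isCircle hC
  exact range_eq_of_isCircle hD hf hfi fun z => h ⟨z, rfl⟩

end CircleParam

lemma not_isPreconnected_compl_circle {C : Set ℂ} (hC : IsCircle C) : ¬ IsPreconnected Cᶜ := by
  obtain ⟨f, hf, hfi, rfl⟩ := exists_param_of_isCircle hC
  let α : C(unitInterval, ℂ) := ⟨fun t => f (Circle.exp (Real.pi * t)), by fun_prop⟩
  let β : C(unitInterval, ℂ) := ⟨fun t => f (Circle.exp (-(Real.pi * t))), by fun_prop⟩
  have hpi := Real.pi_pos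
  have hexp : Circle.exp Real.pi = Circle.exp (-Real.pi) := by
    ext
    simp
  have hU : range α ∪ range β = range f := by
    apply subset_antisymm
    · rintro _ (⟨t, rfl⟩ | ⟨t, rfl⟩) <;> exact ⟨_, rfl⟩
    · rintro _ ⟨z, rfl⟩
      have hle := Complex.arg_le_pi (z : ℂ)
      have hgt := Complex.neg_pi_lt_arg (z : ℂ)
      rcases le_total 0 (Complex.arg z) with h | h
      · left
        refine ⟨⟨Complex.arg z / Real.pi, by positivity, by rw [div_le_one hpi]; exact hle⟩, ?_⟩
        change f (Circle.exp (Real.pi * (Complex.arg z / Real.pi))) = f z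
        rw [mul_div_cancel₀ _ hpi.ne', Circle.exp_arg]
      · right
        refine ⟨⟨-Complex.arg z / Real.pi, by
          apply div_nonneg <;> linarith, by rw [div_le_one hpi]; linarith⟩, ?_⟩
        change f (Circle.exp (-(Real.pi * (-Complex.arg z / Real.pi)))) = f z
        rw [mul_div_cancel₀ _ hpi.ne', neg_neg, Circle.exp_arg]
  rw [← hU]
  apply not_isPreconnected_compl_of_paths
  · simp [α, β]
  · change f (Circle.exp (Real.pi * ((1 : unitInterval) : ℝ))) =
      f (Circle.exp (-(Real.pi * ((1 : unitInterval) : ℝ))))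
    rw [Icc.coe_one, mul_one, hexp]
  · intro h
    have h2 := hfi h
    have := congrArg (fun z : Circle => (z : ℂ)) h2
    simp only [Icc.coe_zero, mul_zero, Circle.exp_zero, Circle.coe_one, Icc.coe_one, mul_one,
      Circle.coe_exp, Complex.exp_pi_mul_I] at this
    norm_num at this
  · rintro _ ⟨⟨t, rfl⟩, s, hs⟩
    have h1 : Circle.exp (-(Real.pi * s)) = Circle.exp (Real.pi * t) := hfi hs
    have h2 := congrArg (fun z : Circle => (z : ℂ).im) h1
    simp only [Circle.coe_exp, Complex.exp_ofReal_mul_I_im, Real.sin_neg] at h2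
    have ht0 := t.2.1
    have ht1 := t.2.2
    have hs0 := s.2.1
    have hs1 := s.2.2
    have h3 : 0 ≤ Real.sin (Real.pi * s) :=
      Real.sin_nonneg_of_nonneg_of_le_pi (by positivity) (by nlinarith)
    have h4 : 0 ≤ Real.sin (Real.pi * t) :=
      Real.sin_nonneg_of_nonneg_of_le_pi (by positivity) (by nlinarith)
    have h5 : Real.sin (Real.pi * t) = 0 := by linarith
    rcases eq_or_lt_of_le ht0 with h | h
    · left; congr 1; exact Subtype.ext h.symm
    rcases eq_or_lt_of_le ht1 with h' | h'
    · right; congr 1; exact Subtype.ext h'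
    · exact absurd h5 (Real.sin_pos_of_pos_of_lt_pi (by positivity) (by nlinarith)).ne'

/-- The points which `K` separates from infinity, together with `K`. -/
def hull (K : Set ℂ) : Set ℂ := {z | Bornology.IsBounded (connectedComponentIn Kᶜ z)}

section Hull
variable {K L : Set ℂ}

lemma mem_hull {z : ℂ} :
    z ∈ hull K ↔ Bornology.IsBounded (connectedComponentIn Kᶜ z) := Iff.rfl

lemma subset_hull (K : Set ℂ) : K ⊆ hull K := fun z hz => by
  rw [hull, mem_ofPred_eq, connectedComponentIn_eq_empty (by simpa using hz)]
  exact Bornology.isBounded_empty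

lemma component_eq_compl_hull (hK : Bornology.IsBounded K) {z : ℂ} (hz : z ∉ hull K) :
    connectedComponentIn Kᶜ z = (hull K)ᶜ := by
  apply subset_antisymm
  · intro w hw hw'
    rw [hull, mem_ofPred_eq, ← connectedComponentIn_eq hw] at hw'
    exact hz hw'
  · intro w hw
    rw [component_eq_of_unbounded hK hz hw]
    exact mem_connectedComponentIn fun h => hw (subset_hull K h)

lemma norm_le_of_mem_hull {R : ℝ} (hR : ∀ z ∈ K, ‖z‖ ≤ R) {z : ℂ} (hz' : z ∈ hull K) :
    ‖z‖ ≤ R := by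
  by_contra! hz
  have hsub : {z : ℂ | R < ‖z‖} ⊆ connectedComponentIn Kᶜ z :=
    (isConnected_norm_gt R).isPreconnected.subset_connectedComponentIn hz
      (fun w hw hwK => (hR w hwK).not_gt hw)
  obtain ⟨M, hM⟩ := ((mem_hull.1 hz').subset hsub).exists_norm_le
  have hpos : 0 ≤ |R| + |M| + 1 := by positivity
  have hn : ‖((|R| + |M| + 1 : ℝ) : ℂ)‖ = |R| + |M| + 1 := by
    rw [Complex.norm_real, Real.norm_of_nonneg hpos]
  have := hM ((|R| + |M| + 1 : ℝ) : ℂ) (by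
    rw [mem_ofPred_eq, hn]
    linarith [le_abs_self R, abs_nonneg M])
  rw [hn] at this
  linarith [le_abs_self M, abs_nonneg R]

lemma exists_notMem_hull (hK : Bornology.IsBounded K) :
    ∃ R, ∀ z : ℂ, R < ‖z‖ → z ∉ hull K := by
  obtain ⟨R, hR⟩ := hK.exists_norm_le
  exact ⟨R, fun z hz hz' => hz.not_ge (norm_le_of_mem_hull hR hz')⟩

lemma isConnected_compl_hull (hK : Bornology.IsBounded K) : IsConnected (hull K)ᶜ := by
  obtain ⟨R, hR⟩ := exists_notMem_hull hK
  have hz : ((|R| + 1 : ℝ) : ℂ) ∉ hull K := hR _ (by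
    rw [Complex.norm_real, Real.norm_of_nonneg (by positivity)]
    linarith [le_abs_self R])
  rw [← component_eq_compl_hull hK hz]
  exact isConnected_connectedComponentIn_iff.2 fun h => hz (subset_hull K h)

lemma isCompact_hull (hK : IsCompact K) : IsCompact (hull K) := by
  obtain ⟨R, hR⟩ := exists_notMem_hull hK.isBounded
  obtain ⟨z, hz⟩ := (isConnected_compl_hull hK.isBounded).nonempty
  have : IsOpen (hull K)ᶜ := by
    rw [← component_eq_compl_hull hK.isBounded hz]
    exact hK.isClosed.isOpen_compl.connectedComponentIn
  refine Metric.isCompact_of_isClosed_isBounded (isOpen_compl_iff.1 this) ?_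
  refine isBounded_iff_forall_norm_le.2 ⟨R, fun z hz => ?_⟩
  by_contra! h
  exact hR z h hz

lemma hull_subset_hull (hL : Bornology.IsBounded L) (h : K ⊆ hull L) : hull K ⊆ hull L := by
  intro z hz
  by_contra hz'
  have : (hull L)ᶜ ⊆ connectedComponentIn Kᶜ z :=
    (isConnected_compl_hull hL).isPreconnected.subset_connectedComponentIn hz'
      (compl_subset_compl.2 h)
  have hb := Bornology.IsBounded.subset (mem_hull.1 hz) this
  rw [← component_eq_compl_hull hL hz'] at hb
  exact hz' hb

lemma frontier_compl_hull_subset (hK : IsCompact K) : frontier (hull K)ᶜ ⊆ K := by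
  obtain ⟨z, hz⟩ := (isConnected_compl_hull hK.isBounded).nonempty
  rw [← component_eq_compl_hull hK.isBounded hz]
  exact frontier_component_subset hK.isClosed z

lemma subset_hull_of_disjoint (hLc : IsPreconnected L) (hd : Disjoint K L)
    (h : (L ∩ hull K).Nonempty) : L ⊆ hull K := by
  obtain ⟨z, hzL, hz⟩ := h
  intro w hw
  have : L ⊆ connectedComponentIn Kᶜ z :=
    hLc.subset_connectedComponentIn hzL fun x hx hxK => disjoint_left.1 hd hxK hx
  rw [hull, mem_ofPred_eq, ← connectedComponentIn_eq (this hw)]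
  exact hz

lemma not_mutually_in_hull (hK : IsCompact K) (hL : IsCompact L) (hne : K.Nonempty)
    (hd : Disjoint K L) (h1 : K ⊆ hull L) (h2 : L ⊆ hull K) : False := by
  have heq : hull K = hull L := subset_antisymm (hull_subset_hull hL.isBounded h1)
    (hull_subset_hull hK.isBounded h2)
  have hfr : (frontier (hull K)ᶜ).Nonempty := by
    rw [nonempty_frontier_iff]
    refine ⟨(isConnected_compl_hull hK.isBounded).nonempty, fun h => ?_⟩
    obtain ⟨k, hk⟩ := hne
    exact (h ▸ mem_univ k : k ∈ (hull K)ᶜ) (subset_hull K hk)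
  obtain ⟨z, hz⟩ := hfr
  exact disjoint_left.1 hd (frontier_compl_hull_subset hK hz)
    (frontier_compl_hull_subset hL (heq ▸ hz))

lemma hull_diff_nonempty (hK : IsCircle K) : (hull K \ K).Nonempty := by
  by_contra hne
  rw [not_nonempty_iff_eq_empty, sdiff_eq_empty] at hne
  apply not_isPreconnected_compl_circle hK
  rw [subset_antisymm (subset_hull K) hne]
  exact (isConnected_compl_hull (isCircle_isCompact hK).isBounded).isPreconnected

lemma hull_not_subset_sUnion {𝒟 : Set (Set ℂ)} (hcirc : ∀ C ∈ 𝒟, IsCircle C)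
    (hd : 𝒟.PairwiseDisjoint id) {C : Set ℂ} (hC : C ∈ 𝒟) : ¬ hull C ⊆ ⋃₀ 𝒟 := by
  intro hsub
  have habs : ∀ D ∈ 𝒟, ∀ D' ∈ 𝒟, ∀ x ∈ D', x ∈ hull D → hull D' ⊆ hull D := by
    intro D hD D' hD' x hx hxD
    by_cases h : D = D'
    · rw [h]
    · exact hull_subset_hull (isCircle_isCompact (hcirc D hD)).isBounded
        (subset_hull_of_disjoint (isCircle_isConnected (hcirc D' hD')).isPreconnected
          (hd hD hD' h) ⟨x, hx, hxD⟩)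
  obtain ⟨M, ⟨⟨D, ⟨hD, hDC⟩, rfl⟩, hmin⟩⟩ :=
    zorn_superset (hull '' {D ∈ 𝒟 | hull D ⊆ hull C}) (by
      intro c hc hchain
      rcases c.eq_empty_or_nonempty with rfl | hne
      · exact ⟨hull C, ⟨C, ⟨hC, subset_rfl⟩, rfl⟩, by simp⟩
      have : Nonempty c := hne.to_subtype
      have hcomp : ∀ s ∈ c, IsCompact s := by
        intro s hs
        obtain ⟨D, hD, rfl⟩ := hc hs
        exact isCompact_hull (isCircle_isCompact (hcirc D hD.1))
      obtain ⟨x, hx⟩ := IsCompact.nonempty_sInter_of_directed_nonempty_isCompact_isClosed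
        (S := c) (by
          intro a ha b hb
          rcases hchain.total ha hb with h | h
          · exact ⟨a, ha, subset_rfl, h⟩
          · exact ⟨b, hb, h, subset_rfl⟩) (by
          intro s hs
          obtain ⟨D, hD, rfl⟩ := hc hs
          exact (isCircle_isConnected (hcirc D hD.1)).nonempty.mono (subset_hull D)) hcomp
        (fun s hs => (hcomp s hs).isClosed)
      rw [mem_sInter] at hx
      obtain ⟨s₀, hs₀⟩ := hne
      obtain ⟨D₀, hD₀, hDs⟩ := hc hs₀
      obtain ⟨D', hD', hxD'⟩ := hsub (hD₀.2 (hDs.symm ▸ hx s₀ hs₀))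
      have key : ∀ s ∈ c, hull D' ⊆ s := by
        intro s hs
        obtain ⟨D, hD, rfl⟩ := hc hs
        exact habs D hD.1 D' hD' x hxD' (hx _ hs)
      refine ⟨hull D', ⟨D', ⟨hD', ?_⟩, rfl⟩, key⟩
      exact (key s₀ hs₀).trans (hDs ▸ hD₀.2))
  obtain ⟨x, hxD, hxn⟩ := hull_diff_nonempty (hcirc D hD)
  obtain ⟨D', hD', hxD'⟩ := hsub (hDC hxD)
  have hne : D ≠ D' := by rintro rfl; exact hxn hxD'
  have h1 := habs D hD D' hD' x hxD' hxD
  have h2 : hull D ⊆ hull D' := hmin ⟨D', ⟨hD', h1.trans hDC⟩, rfl⟩ h1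
  exact not_mutually_in_hull (isCircle_isCompact (hcirc D hD))
    (isCircle_isCompact (hcirc D' hD')) (isCircle_isConnected (hcirc D hD)).nonempty
    (hd hD hD' hne) ((subset_hull D).trans h2) ((subset_hull D').trans h1)

end Hull

/-- A chart of a surface with boundary, with values in the closed right half plane of `ℂ`. -/
structure IsHalfChart {S : Type*} [TopologicalSpace S] (e : PartialEquiv S ℂ) (T : Set ℂ) :
    Prop where
  isOpen_source : IsOpen e.source
  isOpen : IsOpen T
  target_eq : e.target = T ∩ {z | 0 ≤ z.re}
  continuousOn : ContinuousOn e e.source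
  continuousOn_symm : ContinuousOn e.symm e.target

section Boundary
variable {S : Type*} [TopologicalSpace S]

lemma exists_isHalfChart [ChartedSpace (EuclideanHalfSpace 2) S] (x : S) :
    ∃ (e : PartialEquiv S ℂ) (T : Set ℂ), IsHalfChart e T ∧ x ∈ e.source := by
  let φ := chartAt (EuclideanHalfSpace 2) x
  obtain ⟨V, hV, hVt⟩ := isOpen_induced_iff.1 φ.open_target
  let i : ℂ → EuclideanHalfSpace 2 := fun z => ⟨!₂[max z.re 0, z.im], by simp⟩
  let j : EuclideanHalfSpace 2 → ℂ := fun y => ⟨y.1 0, y.1 1⟩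
  have hi : Continuous i := by
    apply Continuous.subtype_mk
    refine (PiLp.continuous_toLp 2 _).comp (continuous_pi fun k => ?_)
    fin_cases k
    · exact Complex.continuous_re.max continuous_const
    · exact Complex.continuous_im
  have hj : Continuous j := by
    have : j = fun y => (y.1 0 : ℂ) + (y.1 1 : ℂ) * Complex.I := by
      ext y; exact (Complex.mk_eq_add_mul_I _ _)
    rw [this]
    have h : ∀ k : Fin 2, Continuous fun y : EuclideanHalfSpace 2 => y.1 k := fun k =>
      (continuous_apply k).comp ((PiLp.continuous_ofLp 2 _).comp continuous_subtype_val)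
    have h0 := h 0
    have h1 := h 1
    fun_prop
  have hij : ∀ y, i (j y) = y := by
    intro y
    apply Subtype.ext
    ext k
    fin_cases k
    · exact max_eq_left y.2
    · rfl
  have hji : ∀ z : ℂ, 0 ≤ z.re → j (i z) = z := by
    intro z hz
    apply Complex.ext
    · exact max_eq_left hz
    · rfl
  refine ⟨{ toFun := fun m => j (φ m), invFun := fun z => φ.symm (i z), source := φ.source,
            target := i ⁻¹' φ.target ∩ {z | 0 ≤ z.re}, map_source' := ?_, map_target' := ?_,
            left_inv' := ?_, right_inv' := ?_ }, i ⁻¹' φ.target, ⟨φ.open_source,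
            φ.open_target.preimage hi, rfl, ?_, ?_⟩, mem_chart_source _ x⟩
  · intro m hm
    refine ⟨?_, (φ m).2⟩
    rw [mem_preimage, hij]
    exact φ.map_source hm
  · rintro z ⟨hz, -⟩
    exact φ.map_target hz
  · intro m hm
    rw [hij, φ.left_inv hm]
  · rintro z ⟨hz, hz0⟩
    rw [φ.right_inv hz, hji z hz0]
  · exact hj.comp_continuousOn φ.continuousOn
  · exact φ.continuousOn_symm.comp hi.continuousOn fun z hz => hz.1

lemma IsHalfChart.re_nonneg {e : PartialEquiv S ℂ} {T : Set ℂ} (h : IsHalfChart e T) {x : S}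
    (hx : x ∈ e.source) : 0 ≤ (e x).re := by
  have := e.map_source hx
  rw [h.target_eq] at this
  exact this.2

lemma IsHalfChart.mem {e : PartialEquiv S ℂ} {T : Set ℂ} (h : IsHalfChart e T) {x : S}
    (hx : x ∈ e.source) : e x ∈ T := by
  have := e.map_source hx
  rw [h.target_eq] at this
  exact this.1

lemma IsHalfChart.interior_of_re_pos {e : PartialEquiv S ℂ} {T : Set ℂ} (h : IsHalfChart e T)
    {x : S} (hx : x ∈ e.source) (hpos : 0 < (e x).re) : IsManifoldInteriorPt x := by
  have hopen : IsOpen (T ∩ {z : ℂ | 0 < z.re}) :=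
    h.isOpen.inter (isOpen_lt continuous_const Complex.continuous_re)
  obtain ⟨r, hr, hball⟩ := Metric.isOpen_iff.1 hopen _ ⟨h.mem hx, hpos⟩
  have hbt : Metric.ball (e x) r ⊆ e.target := by
    intro z hz
    rw [h.target_eq]
    exact ⟨(hball hz).1, le_of_lt (show 0 < z.re from (hball hz).2)⟩
  let b := OpenPartialHomeomorph.univBall (e x) r
  have hb : b.target = Metric.ball (e x) r := OpenPartialHomeomorph.univBall_target _ hr
  have hbs : b.source = univ := OpenPartialHomeomorph.univBall_source _ _
  let L := Complex.orthonormalBasisOneI.repr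
  have hmem : ∀ y, b y ∈ Metric.ball (e x) r := fun y => by
    rw [← hb]; exact b.map_source (by rw [hbs]; trivial)
  refine ⟨e.source ∩ e ⁻¹' Metric.ball (e x) r,
    h.continuousOn.isOpen_inter_preimage h.isOpen_source Metric.isOpen_ball,
    ⟨hx, Metric.mem_ball_self hr⟩, ⟨{
      toFun := fun u => L (b.symm (e u.1))
      invFun := fun y => ⟨e.symm (b (L.symm y)), e.map_target (hbt (hmem _)), by
        rw [mem_preimage, e.right_inv (hbt (hmem _))]; exact hmem _⟩
      left_inv := ?_
      right_inv := ?_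
      continuous_toFun := ?_
      continuous_invFun := ?_ }⟩⟩
  · rintro ⟨u, hu, hu'⟩
    apply Subtype.ext
    change e.symm (b (L.symm (L (b.symm (e u))))) = u
    rw [L.symm_apply_apply, b.right_inv (by rw [hb]; exact hu'), e.left_inv hu]
  · intro y
    change L (b.symm (e (e.symm (b (L.symm y))))) = y
    rw [e.right_inv (hbt (hmem _)), b.left_inv (by rw [hbs]; trivial), L.apply_symm_apply]
  · refine L.continuous.comp (ContinuousOn.comp_continuous (s := b.target) b.continuousOn_symm ?_
      fun u => by rw [hb]; exact u.2.2)
    exact h.continuousOn.comp_continuous continuous_subtype_val fun u => u.2.1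
  · refine Continuous.subtype_mk ?_ _
    refine h.continuousOn_symm.comp_continuous ?_ fun y => hbt (hmem _)
    exact (OpenPartialHomeomorph.continuous_univBall _ _).comp L.symm.continuous

open Classical in
lemma IsHalfChart.not_interior_of_re_eq_zero {e : PartialEquiv S ℂ} {T : Set ℂ}
    (h : IsHalfChart e T) {x : S} (hx : x ∈ e.source) (h0 : (e x).re = 0) :
    ¬ IsManifoldInteriorPt x := by
  rintro ⟨U, hU, hxU, ⟨θ⟩⟩
  let L := Complex.orthonormalBasisOneI.repr
  let k : ℂ → S := fun z => (θ.symm (L z) : S)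
  have hk : Continuous k := continuous_subtype_val.comp (θ.symm.continuous.comp L.continuous)
  let q : ℂ := L.symm (θ ⟨x, hxU⟩)
  have hkq : k q = x := by simp [k, q]
  have hkU : ∀ z, k z ∈ U := fun z => (θ.symm (L z)).2
  have hkinj : Function.Injective k := fun a b hab =>
    L.injective (θ.symm.injective (Subtype.ext hab))
  -- a half disc whose image under the chart lies in `U`
  have hWo : IsOpen (e.source ∩ U) := h.isOpen_source.inter hU
  have hpre : ∃ O : Set ℂ, IsOpen O ∧ e x ∈ O ∧ ∀ z ∈ O ∩ {z | 0 ≤ z.re},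
      z ∈ e.target ∧ e.symm z ∈ U := by
    obtain ⟨O, hO, hOe⟩ := continuousOn_iff'.1 h.continuousOn_symm U hU
    refine ⟨O ∩ T, hO.inter h.isOpen, ⟨?_, h.mem hx⟩, ?_⟩
    · have : e x ∈ e.symm ⁻¹' U ∩ e.target :=
        ⟨by rw [mem_preimage, e.left_inv hx]; exact hxU, e.map_source hx⟩
      rw [hOe] at this
      exact this.1
    · rintro z ⟨⟨hzO, hzT⟩, hz⟩
      have hzt : z ∈ e.target := by rw [h.target_eq]; exact ⟨hzT, hz⟩
      have : z ∈ e.symm ⁻¹' U ∩ e.target := by rw [hOe]; exact ⟨hzO, hzt⟩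
      exact ⟨hzt, this.1⟩
  obtain ⟨O, hO, hxO, hOU⟩ := hpre
  obtain ⟨r, hr, hball⟩ := Metric.isOpen_iff.1 hO _ hxO
  let D : Set ℂ := (Metric.ball (e x) r ∩ {z | 0 ≤ z.re}) \ {e x}
  have hD : ∀ z ∈ D, z ∈ e.target ∧ e.symm z ∈ U := fun z hz => hOU z ⟨hball hz.1.1, hz.1.2⟩
  let g : ℂ → ℂ := fun z => if hz : e.symm z ∈ U then L.symm (θ ⟨e.symm z, hz⟩) - q else 1
  have hgD : ContinuousOn g D := by
    rw [continuousOn_iff_continuous_domRestrict]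
    have : D.domRestrict g = fun z : D => L.symm (θ ⟨e.symm z, (hD z z.2).2⟩) - q := by
      ext z
      simp only [Set.domRestrict_apply, g]
      rw [dif_pos (hD z z.2).2]
    rw [this]
    refine (L.symm.continuous.comp (θ.continuous.comp (Continuous.subtype_mk ?_ _))).sub
      continuous_const
    exact h.continuousOn_symm.comp_continuous continuous_subtype_val fun z => (hD z z.2).1
  have hg0 : ∀ z ∈ D, g z ≠ 0 := by
    intro z hz
    simp only [g]
    rw [dif_pos (hD z hz).2, sub_ne_zero]
    intro heq
    have h1 : e.symm z = x := congrArg Subtype.val (θ.injective (L.symm.injective heq))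
    exact hz.2 (by rw [mem_singleton_iff, ← h1, e.right_inv (hD z hz).1])
  have hc : e x + (r / 2 : ℝ) ∈ D := by
    refine ⟨⟨?_, ?_⟩, ?_⟩
    · rw [Metric.mem_ball, dist_self_add_left, Complex.norm_real, Real.norm_of_nonneg (by positivity)]
      linarith
    · simp [h0]; positivity
    · simp [hr.ne']
  have hstar : StarConvex ℝ (e x + (r / 2 : ℝ)) D := by
    intro z hz a b ha hb hab
    refine ⟨⟨(convex_ball _ _) hc.1.1 hz.1.1 ha hb hab,
      (convex_halfSpace_re_ge 0) hc.1.2 hz.1.2 ha hb hab⟩, ?_⟩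
    rcases eq_or_lt_of_le ha with rfl | ha
    · have : b = 1 := by linarith
      subst this
      simpa using hz.2
    · intro heq
      have h1 := congrArg Complex.re (mem_singleton_iff.1 heq)
      simp only [Complex.add_re, Complex.smul_re, Complex.ofReal_re, h0, smul_eq_mul] at h1
      have h2 : 0 ≤ z.re := hz.1.2
      have : 0 < a * (0 + r / 2) := by positivity
      have : 0 ≤ b * z.re := by positivity
      linarith
  have hlog : HasLog g D := hasLog_of_starConvex hc hstar hgD hg0
  -- transport to a small circle around `q`
  have hnb : ∃ ε > 0, ∀ z ∈ Metric.ball q ε, k z ∈ e.source ∧ e (k z) ∈ Metric.ball (e x) r := by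
    have hopen : IsOpen (k ⁻¹' (e.source ∩ e ⁻¹' Metric.ball (e x) r)) :=
      (h.continuousOn.isOpen_inter_preimage h.isOpen_source Metric.isOpen_ball).preimage hk
    exact Metric.isOpen_iff.1 hopen q ⟨by rw [hkq]; exact hx, by
      rw [mem_preimage, hkq]; exact Metric.mem_ball_self hr⟩
  obtain ⟨ε, hε, hball'⟩ := hnb
  have hsub : Metric.sphere q (ε / 2) ⊆ Metric.ball q ε :=
    Metric.sphere_subset_ball (by linarith)
  have hmaps : MapsTo (fun z => e (k z)) (Metric.sphere q (ε / 2)) D := by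
    intro z hz
    have hz' := hball' z (hsub hz)
    refine ⟨⟨hz'.2, h.re_nonneg hz'.1⟩, fun heq => ?_⟩
    have h1 : k z = k q := by rw [hkq]; exact e.injOn hz'.1 hx heq
    rw [hkinj h1, Metric.mem_sphere, dist_self] at hz
    linarith
  refine not_hasLog_sphere q (half_pos hε) ((hlog.comp ?_ hmaps).congr ?_)
  · exact h.continuousOn.comp hk.continuousOn fun z hz => (hball' z (hsub hz)).1
  · intro z hz
    have hz' := hball' z (hsub hz)
    have h2 : e.symm (e (k z)) = k z := e.left_inv hz'.1
    have h3 : e.symm (e (k z)) ∈ U := by rw [h2]; exact hkU z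
    simp only [g]
    rw [dif_pos h3]
    simp [h2, k]

lemma IsHalfChart.not_interior_iff {e : PartialEquiv S ℂ} {T : Set ℂ} (h : IsHalfChart e T)
    {x : S} (hx : x ∈ e.source) : ¬ IsManifoldInteriorPt x ↔ (e x).re = 0 := by
  refine ⟨fun hn => ?_, h.not_interior_of_re_eq_zero hx⟩
  by_contra h0
  exact hn (h.interior_of_re_pos hx (lt_of_le_of_ne (h.re_nonneg hx) (Ne.symm h0)))

end Boundary

/-- A chart of a surface onto a half-open box, in which `C₀` is the edge of the box. -/
structure IsBoxChart {S : Type*} [TopologicalSpace S] (C₀ : Set S) (e : PartialEquiv S ℂ) :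
    Prop where
  isOpen_source : IsOpen e.source
  target_eq : e.target = {z | 0 ≤ z.re ∧ z.re < 1 ∧ |z.im| < 1}
  continuousOn : ContinuousOn e e.source
  continuousOn_symm : ContinuousOn e.symm e.target
  mem_iff : ∀ x ∈ e.source, x ∈ C₀ ↔ (e x).re = 0

section Collar
variable {S : Type*} [TopologicalSpace S]

lemma exists_isBoxChart [ChartedSpace (EuclideanHalfSpace 2) S] {x₀ x : S}
    (hx : x ∈ connectedComponentIn {y : S | ¬ IsManifoldInteriorPt y} x₀) :
    ∃ e, IsBoxChart (connectedComponentIn {y : S | ¬ IsManifoldInteriorPt y} x₀) e ∧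
      x ∈ e.source ∧ e x = 0 := by
  obtain ⟨φ, T, h, hxφ⟩ := exists_isHalfChart x
  have hx0 : (φ x).re = 0 := (h.not_interior_iff hxφ).1 (connectedComponentIn_subset _ _ hx)
  obtain ⟨R, hR, hball⟩ := Metric.isOpen_iff.1 h.isOpen _ (h.mem hxφ)
  obtain ⟨r, hr, hrR⟩ : ∃ r : ℝ, 0 < r ∧ 2 * r < R := ⟨R / 3, by positivity, by linarith⟩
  have hrc : (r : ℂ) ≠ 0 := by exact_mod_cast hr.ne'
  let B : Set ℂ := {z | 0 ≤ z.re ∧ z.re < 1 ∧ |z.im| < 1}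
  have hB : ∀ z ∈ B, φ x + r * z ∈ φ.target := by
    rintro z ⟨h1, h2, h3⟩
    rw [h.target_eq]
    refine ⟨hball ?_, ?_⟩
    · rw [Metric.mem_ball, dist_self_add_left, norm_mul, Complex.norm_real,
        Real.norm_of_nonneg hr.le]
      have := Complex.norm_le_abs_re_add_abs_im z
      rw [abs_of_nonneg h1] at this
      nlinarith
    · change 0 ≤ (φ x + r * z).re
      simp only [Complex.add_re, hx0, Complex.re_ofReal_mul, zero_add]
      positivity
  let c : S → ℂ := fun m => (φ m - φ x) / r
  let d : ℂ → S := fun z => φ.symm (φ x + r * z)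
  have hc : ContinuousOn c φ.source := (h.continuousOn.sub continuousOn_const).div_const _
  have hd : ContinuousOn d B :=
    h.continuousOn_symm.comp (by fun_prop) hB
  have hre : ∀ m, (c m).re = (φ m).re / r := fun m => by
    simp only [c, Complex.div_ofReal_re, Complex.sub_re, hx0, sub_zero]
  have hdc : ∀ m ∈ φ.source, d (c m) = m := by
    intro m hm
    simp only [c, d]
    rw [mul_div_cancel₀ _ hrc, add_sub_cancel, φ.left_inv hm]
  have hcd : ∀ z ∈ B, c (d z) = z := by
    intro z hz
    simp only [c, d]
    rw [φ.right_inv (hB z hz), add_sub_cancel_left, mul_div_cancel_left₀ _ hrc]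
  have hds : ∀ z ∈ B, d z ∈ φ.source := fun z hz => φ.map_target (hB z hz)
  let V : Set ℂ := {z | z.re < 1 ∧ |z.im| < 1}
  have hopen : IsOpen V :=
    (isOpen_lt Complex.continuous_re continuous_const).inter
      (isOpen_lt Complex.continuous_im.abs continuous_const)
  have hcx : c x = 0 := by simp [c]
  have hedge : d '' {z : ℂ | z.re = 0 ∧ |z.im| < 1} ⊆
      connectedComponentIn {y : S | ¬ IsManifoldInteriorPt y} x₀ := by
    have hEB : {z : ℂ | z.re = 0 ∧ |z.im| < 1} ⊆ B := by
      rintro z ⟨h1, h2⟩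
      exact ⟨h1.ge, by rw [h1]; norm_num, h2⟩
    have hconv : Convex ℝ {z : ℂ | z.re = 0 ∧ |z.im| < 1} := by
      have : {z : ℂ | z.re = 0 ∧ |z.im| < 1} =
          Complex.reLm ⁻¹' {0} ∩ Complex.imLm ⁻¹' Ioo (-1) 1 := by
        ext z
        simp [abs_lt]
      rw [this]
      exact ((convex_singleton 0).linear_preimage _).inter ((convex_Ioo _ _).linear_preimage _)
    rw [connectedComponentIn_eq hx]
    refine (hconv.isPreconnected.image d (hd.mono hEB)).subset_connectedComponentIn ?_ ?_
    · exact ⟨c x, by rw [hcx]; simp, hdc x hxφ⟩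
    · rintro _ ⟨z, hz, rfl⟩
      refine (h.not_interior_iff (hds z (hEB hz))).2 ?_
      have := hre (d z)
      rw [hcd z (hEB hz), hz.1, eq_comm, div_eq_zero_iff] at this
      exact this.resolve_right hr.ne'
  refine ⟨{ toFun := c
            invFun := d
            source := φ.source ∩ c ⁻¹' V
            target := B
            map_source' := ?_
            map_target' := ?_
            left_inv' := fun m hm => hdc m hm.1
            right_inv' := hcd }, ⟨hc.isOpen_inter_preimage h.isOpen_source hopen, rfl,
      hc.mono inter_subset_left, hd, ?_⟩, ⟨hxφ, ?_⟩, hcx⟩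
  · rintro m ⟨hm, h1, h2⟩
    refine ⟨?_, h1, h2⟩
    rw [hre]
    exact div_nonneg (h.re_nonneg hm) hr.le
  · intro z hz
    refine ⟨hds z hz, ?_⟩
    rw [mem_preimage, hcd z hz]
    exact hz.2
  · intro m hm
    change m ∈ _ ↔ (c m).re = 0
    constructor
    · intro hmC
      rw [hre, (h.not_interior_iff hm.1).1 (connectedComponentIn_subset _ _ hmC), zero_div]
    · intro h0
      exact hedge ⟨c m, ⟨h0, hm.2.2⟩, hdc m hm.1⟩
  · rw [mem_preimage, hcx]
    simp [V]

/-- The space obtained from `S` by attaching an open outer collar along `C₀`. -/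
abbrev Ext (C₀ : Set S) : Type _ := {p : S × ℝ // p.2 = 0 ∨ (p.1 ∈ C₀ ∧ p.2 ≤ 0)}

/-- `g` is the depth of a homeomorphism pushing `S` into its outer collar. -/
def IsPushDepth (C₀ : Set S) (g : S → ℝ) : Prop :=
  ContinuousOn g C₀ ∧ (∀ x ∈ C₀, 0 ≤ g x) ∧ ∃ Φ : Ext C₀ ≃ₜ Ext C₀, ∀ p : Ext C₀,
    p.1.1 ∈ C₀ → (Φ p).1 = (p.1.1, p.1.2 - g p.1.1)

lemma isPushDepth_zero (C₀ : Set S) : IsPushDepth C₀ (fun _ => 0) :=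
  ⟨continuousOn_const, fun _ _ => le_rfl, Homeomorph.refl _, fun p _ => by simp⟩

lemma IsPushDepth.add {C₀ : Set S} {f g : S → ℝ} (hf : IsPushDepth C₀ f)
    (hg : IsPushDepth C₀ g) : IsPushDepth C₀ (fun x => f x + g x) := by
  obtain ⟨hfc, hf0, Φ, hΦ⟩ := hf
  obtain ⟨hgc, hg0, Ψ, hΨ⟩ := hg
  refine ⟨hfc.add hgc, fun x hx => add_nonneg (hf0 x hx) (hg0 x hx), Φ.trans Ψ, fun p hp => ?_⟩
  rw [Homeomorph.trans_apply, hΨ _ (by rw [hΦ p hp]; exact hp), hΦ p hp, sub_sub]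

open Classical in
/-- Move the points of `Ext C₀` along the vertical lines of a box chart, by `k`. -/
noncomputable def push (e : PartialEquiv S ℂ) (k : ℝ → ℝ → ℝ) (p : S × ℝ) : S × ℝ :=
  if p.1 ∈ e.source then
    (e.symm ⟨max (k (max 0 (1 / 2 - |(e p.1).im|)) ((e p.1).re + p.2)) 0, (e p.1).im⟩,
      min (k (max 0 (1 / 2 - |(e p.1).im|)) ((e p.1).re + p.2)) 0)
  else p

/-- Families of maps of the line, which fix `[1 / 2, ∞)` and preserve `(-∞, 1 / 2)`. -/
structure IsStretch (k : ℝ → ℝ → ℝ) : Prop where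
  continuous : Continuous fun p : ℝ × ℝ => k p.1 p.2
  zero : ∀ s, k 0 s = s
  eq_self : ∀ a, 0 ≤ a → ∀ s, 1 / 2 ≤ s → k a s = s
  lt : ∀ a, 0 ≤ a → ∀ s, s < 1 / 2 → k a s < 1 / 2

lemma IsStretch.lt_one {k : ℝ → ℝ → ℝ} (hk : IsStretch k) {a s : ℝ} (ha : 0 ≤ a) (hs : s < 1) :
    k a s < 1 := by
  rcases le_or_gt (1 / 2) s with h | h
  · rw [hk.eq_self a ha s h]; exact hs
  · linarith [hk.lt a ha s h]

variable {C₀ : Set S} {e : PartialEquiv S ℂ} {k l : ℝ → ℝ → ℝ}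

lemma IsBoxChart.re_add_lt (he : IsBoxChart C₀ e) {p : S × ℝ}
    (hp : p.2 = 0 ∨ (p.1 ∈ C₀ ∧ p.2 ≤ 0)) (hpe : p.1 ∈ e.source) : (e p.1).re + p.2 < 1 := by
  have h1 := e.map_source hpe
  rw [he.target_eq] at h1
  have h2 : p.2 ≤ 0 := by
    rcases hp with h | h
    · exact h.le
    · exact h.2
  linarith [h1.2.1]

lemma IsBoxChart.mem_target (he : IsBoxChart C₀ e) {x : S} (hx : x ∈ e.source) {s : ℝ}
    (hs : s < 1) : (⟨max s 0, (e x).im⟩ : ℂ) ∈ e.target := by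
  have h1 := e.map_source hx
  rw [he.target_eq] at h1 ⊢
  exact ⟨le_max_right _ _, max_lt hs one_pos, h1.2.2⟩

lemma push_mem (he : IsBoxChart C₀ e) (hk : IsStretch k) {p : S × ℝ}
    (hp : p.2 = 0 ∨ (p.1 ∈ C₀ ∧ p.2 ≤ 0)) :
    (push e k p).2 = 0 ∨ ((push e k p).1 ∈ C₀ ∧ (push e k p).2 ≤ 0) := by
  by_cases hpe : p.1 ∈ e.source
  · rw [push, if_pos hpe]
    have hs := hk.lt_one (le_max_left 0 (1 / 2 - |(e p.1).im|)) (he.re_add_lt hp hpe)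
    rcases le_total 0 (k (max 0 (1 / 2 - |(e p.1).im|)) ((e p.1).re + p.2)) with h | h
    · left
      exact min_eq_right h
    · right
      refine ⟨?_, min_le_right _ _⟩
      have ht := he.mem_target hpe hs
      rw [he.mem_iff _ (e.map_target ht), e.right_inv ht]
      exact max_eq_right h
  · rw [push, if_neg hpe]
    exact hp

lemma push_push (he : IsBoxChart C₀ e) (hk : IsStretch k)
    (hlk : ∀ a, 0 ≤ a → ∀ s, l a (k a s) = s) {p : S × ℝ}
    (hp : p.2 = 0 ∨ (p.1 ∈ C₀ ∧ p.2 ≤ 0)) : push e l (push e k p) = p := by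
  by_cases hpe : p.1 ∈ e.source
  · have hs := hk.lt_one (le_max_left 0 (1 / 2 - |(e p.1).im|)) (he.re_add_lt hp hpe)
    have ht := he.mem_target hpe hs
    have h1 : push e k p = _ := if_pos hpe
    have h2 : (push e k p).1 ∈ e.source := by rw [h1]; exact e.map_target ht
    have h3 : e (push e k p).1 = ⟨max (k (max 0 (1 / 2 - |(e p.1).im|)) ((e p.1).re + p.2)) 0,
        (e p.1).im⟩ := by rw [h1]; exact e.right_inv ht
    rw [push, if_pos h2, h3, h1]
    simp only [max_add_min, add_zero]
    rw [hlk _ (le_max_left _ _)]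
    have h0 := e.map_source hpe
    rw [he.target_eq] at h0
    obtain ⟨hmax, hmin⟩ : max ((e p.1).re + p.2) 0 = (e p.1).re ∧
        min ((e p.1).re + p.2) 0 = p.2 := by
      rcases hp with h | ⟨h, h'⟩
      · rw [h, add_zero]
        exact ⟨max_eq_left h0.1, min_eq_right h0.1⟩
      · rw [(he.mem_iff _ hpe).1 h, zero_add]
        exact ⟨max_eq_right h', min_eq_left h'⟩
    rw [hmax, hmin]
    exact Prod.ext (e.left_inv hpe) rfl
  · have h1 : push e k p = p := if_neg hpe
    rw [h1, push, if_neg hpe]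

lemma push_apply_of_mem (he : IsBoxChart C₀ e) (hk : ∀ a, 0 ≤ a → ∀ s, s ≤ 0 → k a s = s - a)
    {p : S × ℝ} (hp : p.2 = 0 ∨ (p.1 ∈ C₀ ∧ p.2 ≤ 0)) (hpC : p.1 ∈ C₀) (hpe : p.1 ∈ e.source) :
    push e k p = (p.1, p.2 - max 0 (1 / 2 - |(e p.1).im|)) := by
  have h2 : p.2 ≤ 0 := by
    rcases hp with h | h
    · exact h.le
    · exact h.2
  have h0 := (he.mem_iff _ hpe).1 hpC
  have ha := le_max_left 0 (1 / 2 - |(e p.1).im|)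
  rw [push, if_pos hpe, h0, zero_add, hk _ ha _ h2, max_eq_right (by linarith),
    min_eq_left (by linarith)]
  congr 1
  have : (⟨0, (e p.1).im⟩ : ℂ) = e p.1 := Complex.ext h0.symm rfl
  rw [this, e.left_inv hpe]

lemma continuous_push [T2Space S] (he : IsBoxChart C₀ e) (hk : IsStretch k) :
    Continuous fun p : Ext C₀ => push e k p.1 := by
  let Q : Set ℂ := {z | z.re ∈ Icc 0 (1 / 2) ∧ z.im ∈ Icc (-(1 / 2)) (1 / 2)}
  have hQt : Q ⊆ e.target := by
    rintro z ⟨h1, h2⟩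
    rw [he.target_eq]
    exact ⟨h1.1, by linarith [h1.2], by rw [abs_lt]; constructor <;> linarith [h2.1, h2.2]⟩
  have hQ : IsCompact Q := (isCompact_Icc.reProdIm isCompact_Icc : IsCompact (Icc (0:ℝ) (1 / 2) ×ℂ Icc (-(1 / 2) : ℝ) (1 / 2)))
  have hZ : IsClosed (e.symm '' Q) := (hQ.image_of_continuousOn (he.continuousOn_symm.mono hQt)).isClosed
  have hfst : Continuous fun p : Ext C₀ => p.1.1 := continuous_fst.comp continuous_subtype_val
  rw [continuous_iff_continuousAt]
  intro p
  by_cases hp : p.1.1 ∈ e.source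
  · have hev : (fun p : Ext C₀ => p.1.1) ⁻¹' e.source ∈ 𝓝 p :=
      (he.isOpen_source.preimage hfst).mem_nhds hp
    have hc : ContinuousOn (fun p : Ext C₀ => e p.1.1) ((fun p : Ext C₀ => p.1.1) ⁻¹' e.source) :=
      he.continuousOn.comp hfst.continuousOn fun p hp => hp
    have hre := Complex.continuous_re.comp_continuousOn hc
    have him := Complex.continuous_im.comp_continuousOn hc
    have hK : ContinuousOn (fun p : Ext C₀ => k (max 0 (1 / 2 - |(e p.1.1).im|))
        ((e p.1.1).re + p.1.2)) ((fun p : Ext C₀ => p.1.1) ⁻¹' e.source) := by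
      refine hk.continuous.comp_continuousOn (ContinuousOn.prodMk ?_ ?_)
      · exact continuousOn_const.sup (continuousOn_const.sub him.abs)
      · exact hre.add (continuous_snd.comp continuous_subtype_val).continuousOn
    refine ContinuousOn.continuousAt ?_ hev
    have hcont : ContinuousOn (fun p : Ext C₀ =>
        (e.symm (((max (k (max 0 (1 / 2 - |(e p.1.1).im|)) ((e p.1.1).re + p.1.2)) 0 : ℝ) : ℂ) +
          ((e p.1.1).im : ℂ) * Complex.I),
        min (k (max 0 (1 / 2 - |(e p.1.1).im|)) ((e p.1.1).re + p.1.2)) 0))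
        ((fun p : Ext C₀ => p.1.1) ⁻¹' e.source) := by
      refine ContinuousOn.prodMk ?_ (hK.inf continuousOn_const)
      refine he.continuousOn_symm.comp ?_ ?_
      · exact (Complex.continuous_ofReal.comp_continuousOn (hK.sup continuousOn_const)).add
          ((Complex.continuous_ofReal.comp_continuousOn him).mul continuousOn_const)
      · intro p hp
        change ((_ : ℝ) : ℂ) + _ ∈ _
        rw [← Complex.mk_eq_add_mul_I]
        exact he.mem_target hp (hk.lt_one (le_max_left _ _) (he.re_add_lt p.2 hp))
    refine hcont.congr fun p hp => ?_
    have hp' : p.1.1 ∈ e.source := hp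
    rw [push, if_pos hp', Complex.mk_eq_add_mul_I]
  · have hpZ : p.1.1 ∉ e.symm '' Q := by
      rintro ⟨z, hz, hzp⟩
      exact hp (hzp ▸ e.map_target (hQt hz))
    have hev : ∀ᶠ p : Ext C₀ in 𝓝 p, push e k p.1 = p.1 := by
      filter_upwards [(hZ.isOpen_compl.preimage hfst).mem_nhds hpZ] with q hq
      by_cases hqe : q.1.1 ∈ e.source
      · have h0 := e.map_source hqe
        rw [he.target_eq] at h0
        have hkey : k (max 0 (1 / 2 - |(e q.1.1).im|)) ((e q.1.1).re + q.1.2) =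
            (e q.1.1).re + q.1.2 := by
          by_cases him : |(e q.1.1).im| ≤ 1 / 2
          · have hre : 1 / 2 < (e q.1.1).re := by
              by_contra! hre
              exact hq ⟨e q.1.1, ⟨⟨h0.1, hre⟩, abs_le.1 him⟩, e.left_inv hqe⟩
            have : q.1.2 = 0 := by
              rcases q.2 with h | h
              · exact h
              · rw [(he.mem_iff _ hqe).1 h.1] at hre
                norm_num at hre
            rw [this, add_zero]
            exact hk.eq_self _ (le_max_left _ _) _ hre.le
          · rw [max_eq_left (by linarith), hk.zero]
        obtain ⟨hmax, hmin⟩ : max ((e q.1.1).re + q.1.2) 0 = (e q.1.1).re ∧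
            min ((e q.1.1).re + q.1.2) 0 = q.1.2 := by
          rcases q.2 with h | ⟨h, h'⟩
          · rw [h, add_zero]
            exact ⟨max_eq_left h0.1, min_eq_right h0.1⟩
          · rw [(he.mem_iff _ hqe).1 h, zero_add]
            exact ⟨max_eq_right h', min_eq_left h'⟩
        rw [push, if_pos hqe, hkey, hmax, hmin]
        exact Prod.ext (e.left_inv hqe) rfl
      · rw [push, if_neg hqe]
    exact continuous_subtype_val.continuousAt.congr (hev.mono fun q hq => hq.symm)

end Collar

section CollarExists

/-- The family of homeomorphisms of the line which push `0` down to `-a`. -/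
noncomputable def pushDown (a s : ℝ) : ℝ := s - a * max 0 (min 1 (1 - 2 * s))

/-- The inverse of `pushDown`. -/
noncomputable def pullUp (a s : ℝ) : ℝ := s + a * max 0 (min 1 ((1 - 2 * s) / (1 + 2 * |a|)))

lemma isStretch_pushDown : IsStretch pushDown where
  continuous := by unfold pushDown; fun_prop
  zero s := by simp [pushDown]
  eq_self a ha s hs := by
    rw [pushDown, max_eq_left ((min_le_right _ _).trans (by linarith))]
    ring
  lt a ha s hs := by
    unfold pushDown
    have : 0 ≤ a * max 0 (min 1 (1 - 2 * s)) := mul_nonneg ha (le_max_left _ _)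
    linarith

lemma isStretch_pullUp : IsStretch pullUp where
  continuous := by
    unfold pullUp
    have h : ∀ p : ℝ × ℝ, 1 + 2 * |p.1| ≠ 0 := fun p => by positivity
    fun_prop (disch := exact h _)
  zero s := by simp [pullUp]
  eq_self a ha s hs := by
    have h : 0 < 1 + 2 * |a| := by positivity
    rw [pullUp, max_eq_left ((min_le_right _ _).trans
      (div_nonpos_of_nonpos_of_nonneg (by linarith) h.le))]
    ring
  lt a ha s hs := by
    rw [pullUp, abs_of_nonneg ha]
    have h : 0 < 1 + 2 * a := by positivity
    have h1 : max 0 (min 1 ((1 - 2 * s) / (1 + 2 * a))) ≤ (1 - 2 * s) / (1 + 2 * a) :=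
      max_le (div_nonneg (by linarith) h.le) (min_le_right _ _)
    have h2 : a * ((1 - 2 * s) / (1 + 2 * a)) < (1 - 2 * s) / 2 := by
      rw [mul_div_assoc', div_lt_div_iff₀ h two_pos]
      nlinarith
    nlinarith [mul_le_mul_of_nonneg_left h1 ha]

lemma pullUp_pushDown (a : ℝ) (ha : 0 ≤ a) (s : ℝ) : pullUp a (pushDown a s) = s := by
  simp only [pullUp, pushDown, abs_of_nonneg ha]
  have h : 0 < 1 + 2 * a := by positivity
  rcases le_total s 0 with h0 | h0
  · rw [min_eq_left (by linarith : (1:ℝ) ≤ 1 - 2 * s), max_eq_right zero_le_one,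
      min_eq_left (by rw [le_div_iff₀ h]; linarith), max_eq_right zero_le_one]
    ring
  rcases le_total s (1 / 2) with h1 | h1
  · have : (1 - 2 * (s - a * (1 - 2 * s))) / (1 + 2 * a) = 1 - 2 * s := by
      field_simp
      ring
    rw [min_eq_right (by linarith : 1 - 2 * s ≤ 1), max_eq_right (by linarith), this,
      min_eq_right (by linarith : 1 - 2 * s ≤ 1), max_eq_right (by linarith)]
    ring
  · rw [max_eq_left ((min_le_right _ _).trans (by linarith : 1 - 2 * s ≤ 0)), mul_zero, sub_zero,
      max_eq_left ((min_le_right _ _).trans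
        (div_nonpos_of_nonpos_of_nonneg (by linarith) h.le))]
    ring

lemma pushDown_pullUp (a : ℝ) (ha : 0 ≤ a) (s : ℝ) : pushDown a (pullUp a s) = s := by
  simp only [pullUp, pushDown, abs_of_nonneg ha]
  have h : 0 < 1 + 2 * a := by positivity
  rcases le_total s (-a) with h0 | h0
  · rw [min_eq_left (by rw [le_div_iff₀ h]; linarith), max_eq_right zero_le_one,
      min_eq_left (by linarith), max_eq_right zero_le_one]
    ring
  rcases le_total s (1 / 2) with h1 | h1
  · have h2 : (1 - 2 * s) / (1 + 2 * a) ≤ 1 := by rw [div_le_one h]; linarith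
    have h3 : 0 ≤ (1 - 2 * s) / (1 + 2 * a) := div_nonneg (by linarith) h.le
    have : 1 - 2 * (s + a * ((1 - 2 * s) / (1 + 2 * a))) = (1 - 2 * s) / (1 + 2 * a) := by
      field_simp
      ring
    rw [min_eq_right h2, max_eq_right h3, this, min_eq_right h2, max_eq_right h3]
    ring
  · rw [max_eq_left (a := (0:ℝ)) (b := min 1 ((1 - 2 * s) / (1 + 2 * a)))
        ((min_le_right _ _).trans (div_nonpos_of_nonpos_of_nonneg (by linarith) h.le)), mul_zero,
      add_zero, max_eq_left ((min_le_right _ _).trans (by linarith : 1 - 2 * s ≤ 0))]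
    ring

variable {S : Type*} [TopologicalSpace S] {C₀ : Set S} {e : PartialEquiv S ℂ}

open Classical in
lemma IsBoxChart.isPushDepth [T2Space S] (he : IsBoxChart C₀ e) :
    IsPushDepth C₀ fun x => if x ∈ e.source then max 0 (1 / 2 - |(e x).im|) else 0 := by
  let Φ : Ext C₀ ≃ₜ Ext C₀ := {
    toFun := fun p => ⟨push e _ p.1, push_mem he isStretch_pushDown p.2⟩
    invFun := fun p => ⟨push e _ p.1, push_mem he isStretch_pullUp p.2⟩
    left_inv := fun p => Subtype.ext (push_push he isStretch_pushDown pullUp_pushDown p.2)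
    right_inv := fun p => Subtype.ext (push_push he isStretch_pullUp pushDown_pullUp p.2)
    continuous_toFun := (continuous_push he isStretch_pushDown).subtype_mk _
    continuous_invFun := (continuous_push he isStretch_pullUp).subtype_mk _ }
  have hΦ : ∀ p : Ext C₀, p.1.1 ∈ C₀ → (Φ p).1 =
      (p.1.1, p.1.2 - if p.1.1 ∈ e.source then max 0 (1 / 2 - |(e p.1.1).im|) else 0) := by
    intro p hp
    by_cases hpe : p.1.1 ∈ e.source
    · rw [if_pos hpe]
      refine push_apply_of_mem he (fun a _ s hs => ?_) p.2 hp hpe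
      rw [pushDown, min_eq_left (by linarith), max_eq_right zero_le_one, mul_one]
    · rw [if_neg hpe, sub_zero]
      exact if_neg hpe
  refine ⟨?_, ?_, Φ, hΦ⟩
  · rw [continuousOn_iff_continuous_domRestrict]
    have : Continuous fun x : C₀ => -(Φ ⟨(x, 0), Or.inl rfl⟩).1.2 := by fun_prop
    refine this.congr fun x => ?_
    rw [hΦ _ x.2]
    simp
  · intro x _
    dsimp only
    split_ifs
    · exact le_max_left _ _
    · exact le_rfl

lemma exists_isPushDepth_pos [T2Space S] (hC : IsCompact C₀)
    (hbox : ∀ x ∈ C₀, ∃ e, IsBoxChart C₀ e ∧ x ∈ e.source ∧ e x = 0) :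
    ∃ g, IsPushDepth C₀ g ∧ ∀ x ∈ C₀, 0 < g x := by
  suffices h : ∃ g, IsPushDepth C₀ g ∧ ∀ x ∈ C₀, x ∈ C₀ → 0 < g x by
    obtain ⟨g, hg, hg0⟩ := h
    exact ⟨g, hg, fun x hx => hg0 x hx hx⟩
  refine hC.induction_on (p := fun s => ∃ g, IsPushDepth C₀ g ∧ ∀ x ∈ s, x ∈ C₀ → 0 < g x)
    ⟨_, isPushDepth_zero C₀, by simp⟩ ?_ ?_ ?_
  · rintro s t hst ⟨g, hg, hg0⟩
    exact ⟨g, hg, fun x hx => hg0 x (hst hx)⟩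
  · rintro s t ⟨f, hf, hf0⟩ ⟨g, hg, hg0⟩
    refine ⟨_, hf.add hg, ?_⟩
    rintro x (hx | hx) hxC
    · exact add_pos_of_pos_of_nonneg (hf0 x hx hxC) (hg.2.1 x hxC)
    · exact add_pos_of_nonneg_of_pos (hf.2.1 x hxC) (hg0 x hx hxC)
  · intro x hx
    classical
    obtain ⟨e, he, hxe, hex⟩ := hbox x hx
    refine ⟨_, (he.isPushDepth.1 x hx).eventually (lt_mem_nhds ?_), _, he.isPushDepth,
      fun y hy _ => hy⟩
    simp [hxe, hex]

/-- The half-open annulus on which collars of boundary circles are modelled. -/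
abbrev Annulus : Type := {z : ℂ // 1 ≤ ‖z‖ ∧ ‖z‖ < 2}

/-- The radial projection to the unit circle. -/
noncomputable def radial (z : ℂ) (hz : z ≠ 0) : Circle :=
  ⟨z / ‖z‖, mem_sphere_zero_iff_norm.2 (by
    rw [norm_div, Complex.norm_real, norm_norm, div_self (norm_ne_zero_iff.2 hz)])⟩

lemma norm_mul_radial (z : ℂ) (hz : z ≠ 0) : (‖z‖ : ℂ) * (radial z hz : ℂ) = z :=
  mul_div_cancel₀ _ (by simpa using hz)

lemma radial_mul (w : Circle) {r : ℝ} (hr : 0 < r) (h : (r : ℂ) * (w : ℂ) ≠ 0) :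
    radial ((r : ℂ) * (w : ℂ)) h = w := by
  ext
  change (r : ℂ) * (w : ℂ) / (‖(r : ℂ) * (w : ℂ)‖ : ℝ) = w
  rw [norm_mul, Circle.norm_coe, mul_one, Complex.norm_real, Real.norm_of_nonneg hr.le,
    mul_div_cancel_left₀]
  exact_mod_cast hr.ne'

lemma exists_collar_of_isPushDepth (θ : C₀ ≃ₜ Circle) {g : S → ℝ}
    (hg : IsPushDepth C₀ g) (hpos : ∀ x ∈ C₀, 0 < g x) :
    ∃ ψ : Annulus → S, IsOpenEmbedding ψ ∧ ψ '' {z | ‖z.1‖ = 1} = C₀ := by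
  obtain ⟨hgc, -, Φ, hΦ⟩ := hg
  have hz0 : ∀ z : Annulus, z.1 ≠ 0 := fun z => norm_pos_iff.1 (by linarith [z.2.1])
  let x : Annulus → C₀ := fun z => θ.symm (radial z.1 (hz0 z))
  have hx : Continuous x := by
    refine θ.symm.continuous.comp (Continuous.subtype_mk ?_ _)
    exact continuous_subtype_val.div (by fun_prop) fun z => by simpa using hz0 z
  have hgx : Continuous fun z : Annulus => g (x z) := hgc.comp_continuous
    (continuous_subtype_val.comp hx) fun z => (x z).2
  let P : Annulus → Ext C₀ := fun z => ⟨((x z : S), -(g (x z) * (2 - ‖z.1‖))), Or.inr ⟨(x z).2, by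
    have := hpos _ (x z).2
    have := z.2.2
    exact neg_nonpos.2 (mul_nonneg (by linarith) (by linarith))⟩⟩
  have hP : Continuous P := by
    refine Continuous.subtype_mk ?_ _
    exact (continuous_subtype_val.comp hx).prodMk
      (hgx.mul (continuous_const.sub continuous_subtype_val.norm)).neg
  let ψ : Annulus → S := fun z => (Φ.symm (P z)).1.1
  have hψ : Continuous ψ :=
    continuous_fst.comp (continuous_subtype_val.comp (Φ.symm.continuous.comp hP))
  have hzero : ∀ q : Ext C₀, q.1.1 ∈ C₀ → -g q.1.1 ≤ q.1.2 → (Φ.symm q).1.2 = 0 := by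
    intro q hq hle
    rcases (Φ.symm q).2 with h | ⟨h1, h2⟩
    · exact h
    · have h3 := hΦ _ h1
      rw [Φ.apply_symm_apply] at h3
      have h4 : q.1.1 = (Φ.symm q).1.1 := by rw [h3]
      have h5 : q.1.2 = (Φ.symm q).1.2 - g (Φ.symm q).1.1 := by rw [h3]
      rw [← h4] at h5
      linarith
  let j : S → Ext C₀ := fun m => ⟨(m, 0), Or.inl rfl⟩
  have hj : Continuous j := Continuous.subtype_mk (by fun_prop) _
  have hjψ : ∀ z, Φ (j (ψ z)) = P z := by
    intro z
    have h1 : (Φ.symm (P z)).1.2 = 0 := by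
      refine hzero _ (x z).2 (neg_le_neg ?_)
      have := hpos _ (x z).2
      have := z.2.1
      change g (x z) * (2 - ‖z.1‖) ≤ g (x z)
      nlinarith
    have h2 : j (ψ z) = Φ.symm (P z) := Subtype.ext (Prod.ext rfl h1.symm)
    rw [h2, Φ.apply_symm_apply]
  let V : Set S := {m | (Φ (j m)).1.2 < 0}
  have hV : IsOpen V := isOpen_lt
    (continuous_snd.comp (continuous_subtype_val.comp (Φ.continuous.comp hj))) continuous_const
  have hVC : ∀ m ∈ V, (Φ (j m)).1.1 ∈ C₀ := by
    intro m hm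
    rcases (Φ (j m)).2 with h | h
    · exact absurd h (ne_of_lt hm)
    · exact h.1
  have hVle : ∀ m ∈ V, -g (Φ (j m)).1.1 ≤ (Φ (j m)).1.2 := by
    intro m hm
    by_contra! hlt
    let p : Ext C₀ := ⟨((Φ (j m)).1.1, (Φ (j m)).1.2 + g (Φ (j m)).1.1),
      Or.inr ⟨hVC m hm, by linarith⟩⟩
    have h1 : Φ p = Φ (j m) := by
      apply Subtype.ext
      rw [hΦ p (hVC m hm)]
      exact Prod.ext rfl (add_sub_cancel_right _ _)
    have h2 : p.1.2 = 0 := congrArg (fun q : Ext C₀ => q.1.2) (Φ.injective h1)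
    have h3 : (Φ (j m)).1.2 + g (Φ (j m)).1.1 = 0 := h2
    linarith
  let ρ : V → ℝ := fun m => 2 + (Φ (j m)).1.2 / g (Φ (j m)).1.1
  have hρ : ∀ m : V, 1 ≤ ρ m ∧ ρ m < 2 := by
    intro m
    have h1 := hpos _ (hVC m m.2)
    have h2 := hVle m m.2
    have h3 : (Φ (j m)).1.2 < 0 := m.2
    have h4 : -1 ≤ (Φ (j m)).1.2 / g (Φ (j m)).1.1 := by
      rw [le_div_iff₀ h1]; linarith
    have h5 := div_neg_of_neg_of_pos h3 h1
    constructor <;> simp only [ρ] <;> linarith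
  have hnorm : ∀ m : V, ‖(ρ m : ℂ) * (θ ⟨_, hVC m m.2⟩ : ℂ)‖ = ρ m := by
    intro m
    rw [norm_mul, Circle.norm_coe, mul_one, Complex.norm_real,
      Real.norm_of_nonneg (by linarith [(hρ m).1])]
  have hcV : Continuous fun m : V => Φ (j m) := Φ.continuous.comp (hj.comp continuous_subtype_val)
  have hVψ : ∀ z, ψ z ∈ V := by
    intro z
    change (Φ (j (ψ z))).1.2 < 0
    rw [hjψ z]
    have h1 := hpos _ (x z).2
    have h2 := z.2.2
    exact neg_lt_zero.2 (mul_pos h1 (by linarith))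
  let E : Annulus ≃ₜ V := {
    toFun := fun z => ⟨ψ z, hVψ z⟩
    invFun := fun m => ⟨(ρ m : ℂ) * (θ ⟨_, hVC m m.2⟩ : ℂ), by rw [hnorm]; exact hρ m⟩
    left_inv := by
      intro z
      apply Subtype.ext
      have h1 := hpos _ (x z).2
      have h2 : (2 + (Φ (j (ψ z))).1.2 / g (Φ (j (ψ z))).1.1) = ‖z.1‖ := by
        rw [hjψ z]
        change 2 + -(g (x z) * (2 - ‖z.1‖)) / g (x z) = _
        field_simp
        ring
      have h3 : ∀ h, θ ⟨(Φ (j (ψ z))).1.1, h⟩ = radial z.1 (hz0 z) := by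
        rw [hjψ z]
        intro h
        exact θ.apply_symm_apply _
      change ((2 + (Φ (j (ψ z))).1.2 / g (Φ (j (ψ z))).1.1 : ℝ) : ℂ) *
        (θ ⟨(Φ (j (ψ z))).1.1, _⟩ : ℂ) = z.1
      rw [h3, h2, norm_mul_radial]
    right_inv := by
      intro m
      apply Subtype.ext
      change (Φ.symm (P _)).1.1 = m
      suffices h : P ⟨(ρ m : ℂ) * (θ ⟨_, hVC m m.2⟩ : ℂ), by rw [hnorm]; exact hρ m⟩ = Φ (j m) by
        rw [h, Φ.symm_apply_apply]
      have h1 : x ⟨(ρ m : ℂ) * (θ ⟨_, hVC m m.2⟩ : ℂ), by rw [hnorm]; exact hρ m⟩ =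
          ⟨_, hVC m m.2⟩ := by
        change θ.symm (radial _ _) = _
        rw [radial_mul _ (by linarith [(hρ m).1]), θ.symm_apply_apply]
      apply Subtype.ext
      simp only [P]
      rw [h1, hnorm]
      refine Prod.ext rfl ?_
      change -(g (Φ (j m)).1.1 * (2 - ρ m)) = (Φ (j m)).1.2
      have := (hpos _ (hVC m m.2)).ne'
      simp only [ρ]
      field_simp
      ring
    continuous_toFun := hψ.subtype_mk hVψ
    continuous_invFun := by
      refine Continuous.subtype_mk ?_ _
      refine (Complex.continuous_ofReal.comp ?_).mul ?_
      · refine continuous_const.add (Continuous.div ?_ ?_ fun m => (hpos _ (hVC m m.2)).ne')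
        · exact continuous_snd.comp (continuous_subtype_val.comp hcV)
        · exact hgc.comp_continuous (continuous_fst.comp (continuous_subtype_val.comp hcV))
            fun m => hVC m m.2
      · refine continuous_subtype_val.comp (θ.continuous.comp (Continuous.subtype_mk ?_ _))
        exact continuous_fst.comp (continuous_subtype_val.comp hcV) }
  refine ⟨ψ, hV.isOpenEmbedding_subtypeVal.comp E.isOpenEmbedding, ?_⟩
  have hψ1 : ∀ z : Annulus, ‖z.1‖ = 1 → ψ z = x z := by
    intro z hz
    have h1 : Φ (j (x z)) = P z := by
      apply Subtype.ext
      rw [hΦ _ (x z).2]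
      refine Prod.ext rfl ?_
      change 0 - g (x z) = -(g (x z) * (2 - ‖z.1‖))
      rw [hz]
      ring
    change (Φ.symm (P z)).1.1 = _
    rw [← h1, Φ.symm_apply_apply]
  apply subset_antisymm
  · rintro _ ⟨z, hz, rfl⟩
    rw [hψ1 z hz]
    exact (x z).2
  · intro c hc
    have h1 : ‖(θ ⟨c, hc⟩ : ℂ)‖ = 1 := Circle.norm_coe _
    refine ⟨⟨θ ⟨c, hc⟩, h1.ge, by rw [h1]; norm_num⟩, h1, ?_⟩
    rw [hψ1 _ h1]
    have h2 : radial (θ ⟨c, hc⟩ : ℂ) (Circle.coe_ne_zero _) = θ ⟨c, hc⟩ := by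
      ext
      change (θ ⟨c, hc⟩ : ℂ) / ‖(θ ⟨c, hc⟩ : ℂ)‖ = _
      rw [h1, Complex.ofReal_one, div_one]
    change ((θ.symm (radial (θ ⟨c, hc⟩ : ℂ) _) : C₀) : S) = c
    rw [h2, θ.symm_apply_apply]

/-- A boundary circle of a surface has a collar. -/
theorem exists_collar [T2Space S] [ChartedSpace (EuclideanHalfSpace 2) S] {x₀ : S}
    (hcirc : IsCircle (connectedComponentIn {y : S | ¬ IsManifoldInteriorPt y} x₀)) :
    ∃ ψ : Annulus → S, IsOpenEmbedding ψ ∧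
      ψ '' {z | ‖z.1‖ = 1} = connectedComponentIn {y : S | ¬ IsManifoldInteriorPt y} x₀ := by
  obtain ⟨g, hg, hpos⟩ := exists_isPushDepth_pos (isCircle_isCompact hcirc)
    fun x hx => exists_isBoxChart hx
  obtain ⟨θ⟩ := hcirc
  exact exists_collar_of_isPushDepth θ hg hpos

end CollarExists

section Crosscut

/-- The Möbius transformation sending the disc of radius `‖x‖` to the upper half plane, `y` to `0`
and `x` to infinity. -/
noncomputable def mobius (x y z : ℂ) : ℂ :=
  Complex.I * (x * (starRingEnd ℂ) y - (‖x‖ : ℂ) ^ 2) * ((z - y) / (z - x))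

variable {x y : ℂ} {R : ℝ}

lemma mobius_const_im_neg (hx : ‖x‖ = R) (hy : ‖y‖ = R) (hxy : x ≠ y) :
    (Complex.I * (x * (starRingEnd ℂ) y - (‖x‖ : ℂ) ^ 2)).im < 0 := by
  have h : 0 < ‖x - y‖ ^ 2 := by
    have := norm_pos_iff.2 (sub_ne_zero.2 hxy)
    positivity
  have h1 : ‖x‖ ^ 2 = x.re ^ 2 + x.im ^ 2 := by
    rw [Complex.sq_norm, Complex.normSq_apply]; ring
  have h2 : ‖y‖ ^ 2 = y.re ^ 2 + y.im ^ 2 := by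
    rw [Complex.sq_norm, Complex.normSq_apply]; ring
  have h3 : ‖x‖ ^ 2 = ‖y‖ ^ 2 := by rw [hx, hy]
  rw [Complex.sq_norm, Complex.normSq_apply] at h
  simp only [Complex.sub_re, Complex.sub_im] at h
  rw [← Complex.ofReal_pow]
  simp only [Complex.mul_im, Complex.I_re, Complex.I_im, Complex.sub_re, Complex.sub_im,
    Complex.mul_re, Complex.conj_re, Complex.conj_im, Complex.ofReal_re, Complex.ofReal_im]
  nlinarith

lemma mobius_im (hx : ‖x‖ = R) (hy : ‖y‖ = R) {z : ℂ} (hz : z ≠ x) :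
    (mobius x y z).im = -(Complex.I * (x * (starRingEnd ℂ) y - (‖x‖ : ℂ) ^ 2)).im *
      (R ^ 2 - ‖z‖ ^ 2) / ‖z - x‖ ^ 2 := by
  have h0 : ‖z - x‖ ^ 2 ≠ 0 := by
    have := norm_pos_iff.2 (sub_ne_zero.2 hz)
    positivity
  have h1 : R ^ 2 = x.re ^ 2 + x.im ^ 2 := by
    rw [← hx, Complex.sq_norm, Complex.normSq_apply]; ring
  have h2 : R ^ 2 = y.re ^ 2 + y.im ^ 2 := by
    rw [← hy, Complex.sq_norm, Complex.normSq_apply]; ring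
  have h3 : ‖z‖ ^ 2 = z.re ^ 2 + z.im ^ 2 := by
    rw [Complex.sq_norm, Complex.normSq_apply]; ring
  rw [mobius, div_eq_mul_inv (z - y), Complex.inv_def, eq_div_iff h0, ← Complex.sq_norm, ← mul_assoc,
    ← mul_assoc, Complex.im_mul_ofReal, mul_assoc, inv_mul_cancel₀ h0, mul_one, h3, hx,
    ← Complex.ofReal_pow, mul_assoc]
  simp only [Complex.mul_im, Complex.I_re, Complex.I_im, Complex.sub_re, Complex.sub_im,
    Complex.mul_re, Complex.conj_re, Complex.conj_im, Complex.ofReal_re, Complex.ofReal_im,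
    map_sub]
  generalize x.re = a at *
  generalize x.im = b at *
  generalize y.re = c at *
  generalize y.im = d at *
  generalize z.re = e at *
  generalize z.im = f at *
  rw [h1] at h2 ⊢
  have hd : d ^ 2 = a ^ 2 + b ^ 2 - c ^ 2 := by linarith
  linear_combination (a ^ 2 + b ^ 2 - a * e - b * f) * hd

lemma mobius_ne_zero (hx : ‖x‖ = R) (hy : ‖y‖ = R) (hxy : x ≠ y) {z : ℂ} (hz : z ≠ x)
    (hz' : z ≠ y) : mobius x y z ≠ 0 := by
  refine mul_ne_zero (fun h => ?_) (div_ne_zero (sub_ne_zero.2 hz') (sub_ne_zero.2 hz))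
  have := mobius_const_im_neg hx hy hxy
  rw [h] at this
  simp at this

lemma continuousOn_mobius (x y : ℂ) : ContinuousOn (mobius x y) {x}ᶜ := by
  unfold mobius
  refine continuousOn_const.mul (ContinuousOn.div (by fun_prop) (by fun_prop) fun z hz => ?_)
  exact sub_ne_zero.2 hz

/-- Points of the circle on each side of a crosscut. -/
lemma exists_mobius_eq (β : C(unitInterval, ℂ)) (hβ : Function.Injective β)
    (h0 : ‖β 0‖ = R) (h1 : ‖β 1‖ = R) (hin : ∃ t, ‖β t‖ < R) {ε : ℝ} (hε : ε ≠ 0) :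
    ∃ z, ‖z‖ = R ∧ z ∉ range β ∧ ∃ s : ℝ, 0 < s ∧ mobius (β 0) (β 1) z = (ε * s : ℝ) := by
  have hxy : β 0 ≠ β 1 := fun h => zero_ne_one (hβ h)
  by_contra! hcon
  set x := β 0 with hxdef
  set y := β 1 with hydef
  have him := mobius_const_im_neg h0 h1 hxy
  set c := Complex.I * (x * (starRingEnd ℂ) y - (‖x‖ : ℂ) ^ 2) with hc
  let φ : ℝ → ℂ := fun s => x + c * (x - y) / ((ε * s : ℝ) - c)
  have hne : ∀ s : ℝ, ((s : ℝ) : ℂ) - c ≠ 0 := fun s h => by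
    have := congrArg Complex.im h
    simp only [Complex.sub_im, Complex.ofReal_im, Complex.zero_im] at this
    linarith
  have hc0 : c ≠ 0 := fun h => by rw [h] at him; simp at him
  have hφc : Continuous φ := by
    refine continuous_const.add (Continuous.div (by fun_prop) (by fun_prop) fun s => hne _)
  have hφx : ∀ s, φ s ≠ x := fun s h => by
    have : c * (x - y) / ((ε * s : ℝ) - c) = 0 := by simpa [φ] using h
    exact div_ne_zero (mul_ne_zero hc0 (sub_ne_zero.2 hxy)) (hne _) this
  have hφm : ∀ s, mobius x y (φ s) = (ε * s : ℝ) := fun s => by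
    have h1 := hne (ε * s)
    have h2 := sub_ne_zero.2 hxy
    have h3 : φ s - x = c * (x - y) / ((ε * s : ℝ) - c) := by simp [φ]
    have h4 : φ s - y = (ε * s : ℝ) * (x - y) / ((ε * s : ℝ) - c) := by
      simp only [φ]
      field_simp
      ring
    rw [mobius, ← hc, h3, h4]
    field_simp
  have hφR : ∀ s, ‖φ s‖ = R := fun s => by
    have h := mobius_im h0 h1 (hφx s)
    rw [hφm, Complex.ofReal_im, eq_comm, div_eq_zero_iff, ← hc] at h
    have h2 : ‖φ s - x‖ ^ 2 ≠ 0 := by simpa [sub_eq_zero] using hφx s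
    have h3 : R ^ 2 - ‖φ s‖ ^ 2 = 0 := by
      rcases mul_eq_zero.1 (h.resolve_right h2) with h | h
      · linarith
      · exact h
    have hR : 0 ≤ R := h0 ▸ norm_nonneg _
    exact (pow_left_inj₀ (norm_nonneg _) hR two_ne_zero).1 (by linarith)
  have hφ0 : φ 0 = y := by
    simp only [φ, mul_zero, Complex.ofReal_zero, zero_sub, div_neg]
    field_simp
    ring
  have hφK : φ '' Ici 0 ⊆ Metric.sphere 0 R ∩ range β := by
    rintro _ ⟨s, hs, rfl⟩
    refine ⟨by simpa using hφR s, ?_⟩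
    rcases (mem_Ici.1 hs).eq_or_lt with rfl | hs
    · exact ⟨1, hφ0.symm⟩
    · by_contra hn
      exact hcon _ (hφR s) hn s hs (hφm s)
  have hcl : closure (φ '' Ici 0) ⊆ Metric.sphere 0 R ∩ range β :=
    closure_minimal hφK (Metric.isClosed_sphere.inter (isCompact_range β.continuous).isClosed)
  have hpre : IsPreconnected (β ⁻¹' closure (φ '' Ici 0)) :=
    (isPreconnected_Ici.image _ hφc.continuousOn).closure.preimage_of_isClosedMap hβ
      β.continuous.isClosedMap fun z hz => (hcl hz).2
  have hx : x ∈ closure (φ '' Ici 0) := by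
    have ht : Filter.Tendsto φ Filter.atTop (𝓝 x) := by
      have : Filter.Tendsto (fun s : ℝ => ((ε * s : ℝ) : ℂ) - c) Filter.atTop
          (Bornology.cobounded ℂ) := by
        rw [← tendsto_norm_atTop_iff_cobounded]
        refine Filter.tendsto_atTop_mono (f := fun s : ℝ => |ε| * s - ‖c‖) (fun s => ?_) ?_
        · have := norm_sub_norm_le (((ε * s : ℝ)) : ℂ) c
          rw [Complex.norm_real, Real.norm_eq_abs, abs_mul] at this
          have h2 := mul_le_mul_of_nonneg_left (le_abs_self s) (abs_nonneg ε)
          linarith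
        · exact Filter.tendsto_atTop_add_const_right _ _
            (Filter.tendsto_id.const_mul_atTop (abs_pos.2 hε))
      have h2 := (Filter.tendsto_inv₀_cobounded.comp this).const_mul (c * (x - y))
      have h3 := h2.const_add x
      simpa [φ, div_eq_mul_inv] using h3
    exact mem_closure_of_tendsto ht (Filter.eventually_atTop.2 ⟨0, fun s hs => ⟨s, hs, rfl⟩⟩)
  obtain ⟨t, ht⟩ := hin
  have htm : t ∈ β ⁻¹' closure (φ '' Ici 0) :=
    hpre.ordConnected.out (x := 0) (y := 1) hx
      (subset_closure ⟨0, mem_Ici.2 le_rfl, hφ0⟩) ⟨t.2.1, t.2.2⟩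
  have := (hcl htm).1
  rw [mem_sphere_zero_iff_norm] at this
  linarith

/-- A crosscut separates a disc. -/
lemma crosscut_separates (β : C(unitInterval, ℂ)) (hβ : Function.Injective β)
    (hR : ∀ t, ‖β t‖ ≤ R) (h0 : ‖β 0‖ = R) (h1 : ‖β 1‖ = R) (hin : ∃ t, ‖β t‖ < R) :
    ¬ IsPreconnected (Metric.closedBall (0:ℂ) R \ range β) := by
  intro hpre
  have hR0 : 0 < R := hin.elim fun t ht => (norm_nonneg _).trans_lt ht
  obtain ⟨z₁, hz₁, hz₁K, s₁, hs₁, hm₁⟩ := exists_mobius_eq β hβ h0 h1 hin (one_ne_zero)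
  obtain ⟨z₂, hz₂, hz₂K, s₂, hs₂, hm₂⟩ := exists_mobius_eq β hβ h0 h1 hin
    (neg_ne_zero.2 one_ne_zero)
  have hxy : β 0 ≠ β 1 := fun h => zero_ne_one (hβ h)
  have hx : β 0 ∈ range β := ⟨0, rfl⟩
  have hy : β 1 ∈ range β := ⟨1, rfl⟩
  set K := range β with hK
  have him := mobius_const_im_neg h0 h1 hxy
  obtain ⟨l, hl, hlf⟩ := (hasLog_const (X := ℂ) (s := Kᶜ) (c := Complex.I *
    (β 0 * (starRingEnd ℂ) (β 1) - (‖β 0‖ : ℂ) ^ 2)) (fun h => by rw [h] at him; simp at him)).mul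
    (hasLog_of_path (s := Kᶜ) β (by simp [hK]))
  replace hlf : ∀ z ∈ Kᶜ, Complex.exp (l z) = mobius (β 0) (β 1) z := hlf
  have hne : ∀ z ∈ Kᶜ, z ≠ β 0 ∧ z ≠ β 1 := fun z hz =>
    ⟨fun h => hz (h ▸ hx), fun h => hz (h ▸ hy)⟩
  set q := mobius (β 0) (β 1) with hq
  have hq0 : ∀ z ∈ Kᶜ, q z ≠ 0 := fun z hz => mobius_ne_zero h0 h1 hxy (hne z hz).1 (hne z hz).2
  have hqc : ContinuousOn q Kᶜ := (continuousOn_mobius _ _).mono fun z hz => (hne z hz).1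
  have hq1 : ∀ z ∈ Kᶜ, ‖z‖ ≤ R → 0 ≤ (q z).im := fun z hz hzR => by
    rw [hq, mobius_im h0 h1 (hne z hz).1]
    have : 0 ≤ R ^ 2 - ‖z‖ ^ 2 := by nlinarith [norm_nonneg z]
    exact div_nonneg (mul_nonneg (by linarith) this) (by positivity)
  have hq2 : ∀ z ∈ Kᶜ, R ≤ ‖z‖ → (q z).im ≤ 0 := fun z hz hzR => by
    rw [hq, mobius_im h0 h1 (hne z hz).1]
    have : R ^ 2 - ‖z‖ ^ 2 ≤ 0 := by nlinarith [norm_nonneg z]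
    exact div_nonpos_of_nonpos_of_nonneg (mul_nonpos_of_nonneg_of_nonpos (by linarith) this)
      (by positivity)
  let M : ℂ → ℂ := fun z => Complex.log (-Complex.I * q z) + Real.pi / 2 * Complex.I
  let M' : ℂ → ℂ := fun z => Complex.log (Complex.I * q z) + (-Real.pi / 2) * Complex.I
  have hM : ∀ z ∈ Kᶜ, Complex.exp (M z) = q z := fun z hz => by
    simp only [M]
    rw [Complex.exp_add, Complex.exp_log (mul_ne_zero (by simp) (hq0 z hz)),
      Complex.exp_pi_div_two_mul_I]
    linear_combination (-q z) * Complex.I_sq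
  have hM' : ∀ z ∈ Kᶜ, Complex.exp (M' z) = q z := fun z hz => by
    simp only [M']
    rw [Complex.exp_add, Complex.exp_log (mul_ne_zero (by simp) (hq0 z hz)),
      Complex.exp_neg_pi_div_two_mul_I]
    linear_combination (-q z) * Complex.I_sq
  have hslit : ∀ w : ℂ, w ≠ 0 → 0 ≤ w.im → -Complex.I * w ∈ Complex.slitPlane := by
    intro w hw hi
    rw [Complex.mem_slitPlane_iff]
    simp only [neg_mul, Complex.neg_re, Complex.neg_im, Complex.mul_re, Complex.mul_im,
      Complex.I_re, Complex.I_im, zero_mul, one_mul, zero_sub, neg_neg, zero_add, neg_ne_zero]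
    rcases hi.lt_or_eq with h | h
    · exact Or.inl h
    · exact Or.inr fun h' => hw (Complex.ext h' h.symm)
  have hMc : ContinuousOn M (Metric.closedBall 0 R \ K) := by
    refine ContinuousOn.add (ContinuousOn.clog (continuousOn_const.mul (hqc.mono ?_)) ?_)
      continuousOn_const
    · exact fun z hz => hz.2
    · exact fun z hz => hslit _ (hq0 z hz.2) (hq1 z hz.2 (by simpa using hz.1))
  have hMc' : ContinuousOn M' ({z | R ≤ ‖z‖} \ K) := by
    refine ContinuousOn.add (ContinuousOn.clog (continuousOn_const.mul (hqc.mono ?_)) ?_)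
      continuousOn_const
    · exact fun z hz => hz.2
    · intro z hz
      have := hslit (-q z) (neg_ne_zero.2 (hq0 z hz.2)) (by simpa using hq2 z hz.2 hz.1)
      simpa using this
  have hpre' : IsPreconnected ({z : ℂ | R ≤ ‖z‖} \ K) := by
    refine (isConnected_norm_gt R).isPreconnected.subset_closure ?_ ?_
    · rintro z hz
      refine ⟨(show R < ‖z‖ from hz).le, ?_⟩
      rintro ⟨t, rfl⟩
      exact (hR t).not_gt hz
    · have : {z : ℂ | R < ‖z‖} = (Metric.closedBall 0 R)ᶜ := by ext z; simp
      rw [this, closure_compl, interior_closedBall _ hR0.ne']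
      rintro z ⟨hz, -⟩
      simpa using hz
  have e1 := log_sub_const hpre (hl.mono fun z hz => hz.2) hMc
    (fun z hz => (hlf z hz.2).trans (hM z hz.2).symm) z₁ ⟨by simp [hz₁], hz₁K⟩ z₂
    ⟨by simp [hz₂], hz₂K⟩
  have e2 := log_sub_const hpre' (hl.mono fun z hz => hz.2) hMc'
    (fun z hz => (hlf z hz.2).trans (hM' z hz.2).symm) z₁ ⟨hz₁.ge, hz₁K⟩ z₂ ⟨hz₂.ge, hz₂K⟩
  have e3 : (M z₁ - M' z₁).im = (M z₂ - M' z₂).im := by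
    have : M z₁ - M' z₁ = M z₂ - M' z₂ := by linear_combination e2 - e1
    rw [this]
  have hd : ∀ z, (M z - M' z).im =
      (-Complex.I * q z).arg - (Complex.I * q z).arg + Real.pi := fun z => by
    simp only [M, M', Complex.sub_im, Complex.add_im, Complex.log_im]
    have : ((Real.pi / 2 : ℂ) * Complex.I).im = Real.pi / 2 := by
      rw [← Complex.ofReal_ofNat, ← Complex.ofReal_div]; simp
    rw [this]
    have : ((-Real.pi / 2 : ℂ) * Complex.I).im = -Real.pi / 2 := by
      rw [← Complex.ofReal_ofNat, ← Complex.ofReal_neg, ← Complex.ofReal_div]; simp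
    rw [this]
    ring
  have a1 : (-Complex.I * q z₁).arg = -(Real.pi / 2) := by
    rw [Complex.arg_eq_neg_pi_div_two_iff, hm₁]; simp [hs₁]
  have a2 : (Complex.I * q z₁).arg = Real.pi / 2 := by
    rw [Complex.arg_eq_pi_div_two_iff, hm₁]; simp [hs₁]
  have a3 : (-Complex.I * q z₂).arg = Real.pi / 2 := by
    rw [Complex.arg_eq_pi_div_two_iff, hm₂]; simp [hs₂]
  have a4 : (Complex.I * q z₂).arg = -(Real.pi / 2) := by
    rw [Complex.arg_eq_neg_pi_div_two_iff, hm₂]; simp [hs₂]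
  rw [hd, hd, a1, a2, a3, a4] at e3
  linarith [Real.pi_pos]

end Crosscut

section Trace

variable {S : Type*} {ψ : Annulus → S} {C D : Set S} {r : ℝ}

/-- The trace of a subset of a surface in the collar parametrized by `ψ`. -/
def trace (ψ : Annulus → S) (C : Set S) : Set ℂ :=
  {z | ∃ h : 1 ≤ ‖z‖ ∧ ‖z‖ < 2, ψ ⟨z, h⟩ ∈ C}

lemma trace_eq_image (ψ : Annulus → S) (C : Set S) : trace ψ C = Subtype.val '' (ψ ⁻¹' C) := by
  ext z
  constructor
  · rintro ⟨h, hz⟩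
    exact ⟨⟨z, h⟩, hz, rfl⟩
  · rintro ⟨⟨w, h⟩, hw, rfl⟩
    exact ⟨h, hw⟩

lemma disjoint_trace (h : Disjoint C D) : Disjoint (trace ψ C) (trace ψ D) :=
  disjoint_left.2 fun _ ⟨_, h1⟩ ⟨_, h2⟩ => disjoint_left.1 h h1 h2

variable [TopologicalSpace S]

lemma isCompact_annulus_le (hr : r < 2) : IsCompact {z : Annulus | ‖z.1‖ ≤ r} := by
  rw [Subtype.isCompact_iff]
  have : Subtype.val '' {z : Annulus | ‖z.1‖ ≤ r} =
      Metric.closedBall (0:ℂ) r ∩ {z | 1 ≤ ‖z‖} := by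
    ext z
    constructor
    · rintro ⟨w, hw, rfl⟩
      exact ⟨by simpa using hw, w.2.1⟩
    · rintro ⟨h1, h2⟩
      rw [mem_closedBall_zero_iff] at h1
      exact ⟨⟨z, h2, h1.trans_lt hr⟩, h1, rfl⟩
  rw [this]
  exact (isCompact_closedBall _ _).inter_right (isClosed_le continuous_const continuous_norm)

lemma isCompact_trace (hψ : Continuous ψ) (hC : IsClosed C) (hr : r < 2) :
    IsCompact (trace ψ C ∩ Metric.closedBall 0 r) := by
  have : trace ψ C ∩ Metric.closedBall 0 r =
      Subtype.val '' ({z : Annulus | ‖z.1‖ ≤ r} ∩ ψ ⁻¹' C) := by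
    rw [trace_eq_image]
    ext z
    constructor
    · rintro ⟨⟨w, hw, rfl⟩, h⟩
      exact ⟨w, ⟨by simpa using h, hw⟩, rfl⟩
    · rintro ⟨w, ⟨h, hw⟩, rfl⟩
      exact ⟨⟨w, hw, rfl⟩, by simpa using h⟩
  rw [this]
  exact ((isCompact_annulus_le hr).inter_right (hC.preimage hψ)).image continuous_subtype_val

instance : Nonempty Annulus := ⟨1, by norm_num⟩

/-- An inverse of the collar parametrization. -/
lemma exists_collar_inverse (hψ : IsOpenEmbedding ψ) :
    ∃ ι : S → ℂ, ContinuousOn ι (range ψ) ∧ ∀ z : Annulus, ι (ψ z) = z := by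
  let e := hψ.toOpenPartialHomeomorph ψ
  refine ⟨fun x => (e.symm x).1, ?_, fun z => ?_⟩
  · have := e.continuousOn_symm
    simp only [e, IsOpenEmbedding.toOpenPartialHomeomorph_target] at this
    exact continuous_subtype_val.comp_continuousOn this
  · have : e.symm (e z) = z := e.left_inv (by simp [e])
    exact congrArg Subtype.val this

/-- A circle not contained in a smaller collar meets it in crosscuts. -/
lemma exists_arc_of_trace [T2Space S] (hψ : IsOpenEmbedding ψ) (hC : IsCircle C) (hr : r < 2)
    (hout : ∃ b ∈ C, b ∉ ψ '' {z | ‖z.1‖ ≤ r}) {z₀ : ℂ} (hz₀ : z₀ ∈ trace ψ C)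
    (hz₀r : ‖z₀‖ < r) :
    ∃ β : C(unitInterval, ℂ), Function.Injective β ∧ ‖β 0‖ = r ∧ ‖β 1‖ = r ∧
      range β = connectedComponentIn (trace ψ C ∩ Metric.closedBall 0 r) z₀ := by
  obtain ⟨f, hf, hfi, rfl⟩ := exists_param_of_isCircle hC
  obtain ⟨_, ⟨ub, rfl⟩, hb⟩ := hout
  obtain ⟨ι, hι, hιψ⟩ := exists_collar_inverse hψ
  have hpi := Real.pi_pos
  let α : ℝ → S := fun θ => f (ub * Circle.exp (-Real.pi) * Circle.exp θ)
  have hα : Continuous α := by fun_prop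
  have hαi : InjOn α (Ioc (-Real.pi) Real.pi) := fun θ hθ θ' hθ' h => by
    have := mul_left_cancel (hfi h)
    exact Circle.invOn_arg_exp.1.injOn hθ hθ' this
  have hαpi : α Real.pi = f ub := by
    simp [α, mul_assoc]
  have hαnpi : α (-Real.pi) = f ub := by
    rw [← hαpi]
    simp only [α]
    congr 2
    have := Circle.periodic_exp (-Real.pi)
    rw [← this]
    congr 1
    ring
  have hαsurj : ∀ u, ∃ θ ∈ Ioc (-Real.pi) Real.pi, α θ = f u := fun u => by
    refine ⟨Complex.arg ((ub * Circle.exp (-Real.pi))⁻¹ * u : Circle),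
      ⟨Complex.neg_pi_lt_arg _, Complex.arg_le_pi _⟩, ?_⟩
    simp only [α]
    rw [Circle.exp_arg, mul_inv_cancel_left]
  set A := ψ '' {z : Annulus | ‖z.1‖ ≤ r} with hA
  have hAcl : IsClosed A := ((isCompact_annulus_le hr).image hψ.continuous).isClosed
  have hAo : IsOpen (ψ '' {z : Annulus | ‖z.1‖ < r}) :=
    hψ.isOpenMap _ (isOpen_lt (by fun_prop) continuous_const)
  set D := Icc (-Real.pi) Real.pi ∩ α ⁻¹' A with hD
  have hDc : IsCompact D := isCompact_Icc.inter_right (hAcl.preimage hα)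
  have hDo : D ⊆ Ioo (-Real.pi) Real.pi := by
    rintro θ ⟨⟨h1, h2⟩, h⟩
    refine ⟨lt_of_le_of_ne h1 ?_, lt_of_le_of_ne h2 ?_⟩
    · rintro rfl
      exact hb (hαnpi ▸ h)
    · rintro rfl
      exact hb (hαpi ▸ h)
  set g : ℝ → ℂ := fun θ => ι (α θ) with hg
  have hψι : ∀ x ∈ A, ∃ z : Annulus, ι x = z ∧ ψ z = x ∧ ‖z.1‖ ≤ r := by
    rintro _ ⟨z, hz, rfl⟩
    exact ⟨z, hιψ z, rfl, hz⟩
  have hgc : ContinuousOn g D :=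
    hι.comp hα.continuousOn fun θ hθ => image_subset_range _ _ hθ.2
  have hgi : InjOn g D := fun θ hθ θ' hθ' h => by
    obtain ⟨z, h1, h2, -⟩ := hψι _ hθ.2
    obtain ⟨z', h1', h2', -⟩ := hψι _ hθ'.2
    have hzz : z = z' := Subtype.ext (h1.symm.trans (h.trans h1'))
    exact hαi (Ioo_subset_Ioc_self (hDo hθ)) (Ioo_subset_Ioc_self (hDo hθ'))
      (h2.symm.trans (hzz ▸ h2'))
  have hgE : g '' D = trace ψ (range f) ∩ Metric.closedBall 0 r := by
    ext z
    constructor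
    · rintro ⟨θ, hθ, rfl⟩
      obtain ⟨w, h1, h2, h3⟩ := hψι _ hθ.2
      simp only [hg, h1]
      exact ⟨⟨w.2, by rw [show (⟨w.1, w.2⟩ : Annulus) = w from rfl, h2]; exact ⟨_, rfl⟩⟩,
        by simpa using h3⟩
    · rintro ⟨⟨hz, ⟨u, hu⟩⟩, hzr⟩
      obtain ⟨θ, hθ, h⟩ := hαsurj u
      have hθA : α θ ∈ A := ⟨⟨z, hz⟩, by simpa using hzr, by rw [h, hu]⟩
      exact ⟨θ, ⟨Ioc_subset_Icc_self hθ, hθA⟩, by simp only [hg]; rw [h, hu, hιψ]⟩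
  have hz₀E : z₀ ∈ g '' D := hgE ▸ ⟨hz₀, by simpa using hz₀r.le⟩
  obtain ⟨θ₀, hθ₀, hgθ₀⟩ := hz₀E
  rw [← hgE]
  set Q := connectedComponentIn D θ₀ with hQ
  have hQD : Q ⊆ D := connectedComponentIn_subset _ _
  have hQconn : IsConnected Q := isConnected_connectedComponentIn_iff.2 hθ₀
  have hQcomp : IsCompact Q :=
    hDc.of_isClosed_subset (isClosed_connectedComponentIn' hDc.isClosed _) hQD
  have hnear : ∀ θ ∈ Q, ‖g θ‖ < r → ∃ ε > 0, θ - ε ∈ Q ∧ θ + ε ∈ Q := by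
    intro θ hθ hlt
    have hmem : α θ ∈ ψ '' {z : Annulus | ‖z.1‖ < r} := by
      obtain ⟨z, h1, h2, h3⟩ := hψι _ (hQD hθ).2
      refine ⟨z, ?_, h2⟩
      show ‖z.1‖ < r
      rw [← h1]; exact hlt
    have hnhds : Ioo (-Real.pi) Real.pi ∩ α ⁻¹' (ψ '' {z : Annulus | ‖z.1‖ < r}) ∈ 𝓝 θ :=
      (isOpen_Ioo.inter (hAo.preimage hα)).mem_nhds ⟨hDo (hQD hθ), hmem⟩
    obtain ⟨ε, hε, hball⟩ := Metric.nhds_basis_closedBall.mem_iff.1 hnhds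
    have hballD : Metric.closedBall θ ε ⊆ D := fun t ht =>
      ⟨Ioo_subset_Icc_self (hball ht).1, by
        obtain ⟨z, hz, h⟩ := (hball ht).2
        exact ⟨z, (show ‖z.1‖ < r from hz).le, h⟩⟩
    have hsub : Metric.closedBall θ ε ⊆ Q := by
      have : Q = connectedComponentIn D θ := connectedComponentIn_eq hθ
      rw [this]
      refine IsPreconnected.subset_connectedComponentIn ?_ (Metric.mem_closedBall_self hε.le) hballD
      rw [Real.closedBall_eq_Icc]
      exact isPreconnected_Icc
    refine ⟨ε, hε, hsub ?_, hsub ?_⟩ <;> simp [abs_of_pos hε]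
  have hQI := eq_Icc_of_connected_compact hQconn hQcomp
  set s := sInf Q with hs
  set t := sSup Q with ht
  have hsQ : s ∈ Q := hQcomp.sInf_mem hQconn.nonempty
  have htQ : t ∈ Q := hQcomp.sSup_mem hQconn.nonempty
  have hle : ∀ θ ∈ Q, ‖g θ‖ ≤ r := fun θ hθ => by
    have : g θ ∈ g '' D := ⟨θ, hQD hθ, rfl⟩
    rw [hgE] at this
    simpa using this.2
  have hgs : ‖g s‖ = r := by
    by_contra hne
    obtain ⟨ε, hε, h1, -⟩ := hnear s hsQ (lt_of_le_of_ne (hle s hsQ) hne)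
    rw [hQI] at h1
    linarith [h1.1]
  have hgt : ‖g t‖ = r := by
    by_contra hne
    obtain ⟨ε, hε, -, h1⟩ := hnear t htQ (lt_of_le_of_ne (hle t htQ) hne)
    rw [hQI] at h1
    linarith [h1.2]
  have hst : s < t := by
    obtain ⟨ε, hε, h1, h2⟩ := hnear θ₀ (mem_connectedComponentIn hθ₀) (by rw [hgθ₀]; exact hz₀r)
    rw [hQI] at h1 h2
    linarith [h1.1, h2.2]
  have himg : (fun u : unitInterval => s + (t - s) * u) '' univ = Q := by
    rw [hQI]
    ext θ
    constructor
    · rintro ⟨u, -, rfl⟩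
      have := u.2.1; have := u.2.2
      constructor <;> nlinarith
    · rintro ⟨h1, h2⟩
      refine ⟨⟨(θ - s) / (t - s), div_nonneg (by linarith) (by linarith),
        (div_le_one (by linarith)).2 (by linarith)⟩, mem_univ _, ?_⟩
      have : t - s ≠ 0 := by linarith
      simp only
      field_simp
      ring
  have hmem : ∀ u : unitInterval, s + (t - s) * u ∈ D := fun u =>
    hQD (himg ▸ ⟨u, mem_univ _, rfl⟩)
  refine ⟨⟨fun u => g (s + (t - s) * u), hgc.comp_continuous (by fun_prop) hmem⟩, ?_, ?_, ?_, ?_⟩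
  · intro u v huv
    have := hgi (hmem u) (hmem v) huv
    have h2 : (t - s) * (u : ℝ) = (t - s) * v := by linarith
    exact Subtype.ext (mul_left_cancel₀ (by linarith) h2)
  · simpa using hgs
  · simpa using hgt
  · have hr' : range (fun u : unitInterval => g (s + (t - s) * u)) = g '' Q := by
      rw [← himg, image_image, image_univ]
    change range (fun u : unitInterval => g (s + (t - s) * u)) = _
    rw [hr']
    apply Subset.antisymm
    · refine (hQconn.isPreconnected.image _ (hgc.mono hQD)).subset_connectedComponentIn ?_
        (image_mono hQD)
      exact ⟨θ₀, mem_connectedComponentIn hθ₀, hgθ₀⟩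
    · set K := connectedComponentIn (g '' D) z₀
      have hKsub : K ⊆ g '' D := connectedComponentIn_subset _ _
      let gD : D → ℂ := fun θ => g θ
      have hgD : Continuous gD := continuousOn_iff_continuous_domRestrict.1 hgc
      have : CompactSpace D := isCompact_iff_compactSpace.1 hDc
      have hpre : IsPreconnected (gD ⁻¹' K) :=
        isPreconnected_connectedComponentIn.preimage_of_isClosedMap
          (fun a b h => Subtype.ext (hgi a.2 b.2 h)) hgD.isClosedMap
          (fun z hz => by obtain ⟨θ, hθ, h⟩ := hKsub hz; exact ⟨⟨θ, hθ⟩, h⟩)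
      have h3 : Subtype.val '' (gD ⁻¹' K) ⊆ Q := by
        refine (hpre.image _ continuous_subtype_val.continuousOn).subset_connectedComponentIn
          ⟨⟨θ₀, hθ₀⟩, ?_, rfl⟩ (by rintro _ ⟨x, -, rfl⟩; exact x.2)
        show g θ₀ ∈ K
        rw [hgθ₀]
        exact mem_connectedComponentIn ⟨θ₀, hθ₀, hgθ₀⟩
      intro z hz
      obtain ⟨θ, hθ, rfl⟩ := hKsub hz
      exact ⟨θ, h3 ⟨⟨θ, hθ⟩, hz, rfl⟩, rfl⟩

end Trace

section CircleInCollar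

variable {S : Type*} [TopologicalSpace S] {ψ : Annulus → S} {C D : Set S} {r : ℝ}

/-- Some circle of the decomposition other than the boundary circle lies within the collar. -/
lemma exists_circle_in_collar [T2Space S] {𝒞 : Set (Set S)} (h𝒞 : IsCircleDecomposition 𝒞)
    (hψ : IsOpenEmbedding ψ) {C₀ : Set S} (hC₀ : ψ '' {z | ‖z.1‖ = 1} = C₀)
    (hcirc : IsCircle C₀) : ∃ C ∈ 𝒞, C ≠ C₀ ∧ C ⊆ ψ '' {z | ‖z.1‖ ≤ 3 / 2} := by
  by_contra! hcon
  replace hcon : ∀ C ∈ 𝒞, C ≠ C₀ → ∃ b ∈ C, b ∉ ψ '' {z | ‖z.1‖ ≤ 3 / 2} :=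
    fun C hC hne => not_subset.1 (hcon C hC hne)
  obtain ⟨h1, h2, h3⟩ := h𝒞
  let X := Metric.closedBall (0:ℂ) (3 / 2)
  have : CompactSpace X := isCompact_iff_compactSpace.1 (isCompact_closedBall _ _)
  have hconvX : Convex ℝ (Metric.closedBall (0:ℂ) (3 / 2)) := convex_closedBall _ _
  have : ConnectedSpace X := isConnected_iff_connectedSpace.1
    (hconvX.isConnected ⟨0, by norm_num [Metric.mem_closedBall]⟩)
  have : LocallyPathConnectedSpace X := hconvX.locallyPathConnectedSpace
  have hX : ∀ z, z ∈ X ↔ ‖z‖ ≤ 3 / 2 := fun z => mem_closedBall_zero_iff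
  let o : X := ⟨0, by rw [hX]; norm_num⟩
  let comp : Set S → ℂ → Set ℂ := fun C z =>
    connectedComponentIn (trace ψ C ∩ Metric.closedBall 0 (3 / 2)) z
  have hcompsub : ∀ C z, comp C z ⊆ trace ψ C ∩ Metric.closedBall 0 (3 / 2) :=
    fun C z => connectedComponentIn_subset _ _
  let 𝒦 : Set (Set X) := {K | ∃ C ∈ 𝒞, C ≠ C₀ ∧ ∃ z ∈ trace ψ C, ‖z‖ < 3 / 2 ∧
    K = Subtype.val ⁻¹' comp C z}
  have harc : ∀ K ∈ 𝒦, ∃ β : C(unitInterval, ℂ), Function.Injective β ∧ ‖β 0‖ = 3 / 2 ∧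
      ‖β 1‖ = 3 / 2 ∧ (∃ t, ‖β t‖ < 3 / 2) ∧ (∀ t, ‖β t‖ ≤ 3 / 2) ∧
      range β = Subtype.val '' K := by
    rintro K ⟨C, hC, hne, z, hz, hzr, rfl⟩
    obtain ⟨β, b1, b2, b3, b4⟩ := exists_arc_of_trace hψ (h1 C hC) (by norm_num)
      (hcon C hC hne) hz hzr
    have hle : ∀ t, ‖β t‖ ≤ 3 / 2 := fun t => by
      have : β t ∈ comp C z := by
        show β t ∈ connectedComponentIn _ _
        rw [← b4]
        exact ⟨t, rfl⟩
      simpa using (hcompsub _ _ this).2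
    refine ⟨β, b1, b2, b3, ?_, hle, ?_⟩
    · have : z ∈ range β := by
        rw [b4]
        exact mem_connectedComponentIn ⟨hz, by simpa using hzr.le⟩
      obtain ⟨t, rfl⟩ := this
      exact ⟨t, hzr⟩
    · rw [Subtype.image_preimage_coe, b4, eq_comm, inter_eq_right]
      exact fun w hw => (hcompsub _ _ hw).2
  have hcl : ∀ K ∈ 𝒦, IsClosed K := by
    rintro K ⟨C, hC, hne, z, hz, hzr, rfl⟩
    exact (isClosed_connectedComponentIn' (isCompact_trace hψ.continuous
      (isCircle_isCompact (h1 C hC)).isClosed (by norm_num)).isClosed _).preimage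
        continuous_subtype_val
  have hcK : ∀ K ∈ 𝒦, IsConnected K := by
    intro K hK
    obtain ⟨β, -, -, -, -, hle, hr⟩ := harc K hK
    let β' : unitInterval → X := fun t => ⟨β t, (hX _).2 (hle t)⟩
    have : K = range β' := by
      apply Subtype.val_injective.image_injective
      rw [← hr, ← range_comp]
      rfl
    rw [this]
    exact isConnected_range (by fun_prop)
  have hoK : ∀ K ∈ 𝒦, o ∉ K := by
    rintro K ⟨C, hC, hne, z, hz, hzr, rfl⟩ ho
    obtain ⟨h, -⟩ := (hcompsub _ _ ho).1
    norm_num [o] at h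
  have hd : 𝒦.PairwiseDisjoint id := by
    rintro K ⟨C, hC, hne, z, hz, hzr, rfl⟩ K' ⟨C', hC', hne', z', hz', hzr', rfl⟩ hKK
    simp only [Function.onFun, id]
    rw [disjoint_left]
    intro x hx hx'
    have hCC : C = C' := by
      by_contra hCC
      exact disjoint_left.1 (disjoint_trace (h2 C hC C' hC' hCC)) (hcompsub _ _ hx).1
        (hcompsub _ _ hx').1
    subst hCC
    apply hKK
    have e1 : comp C z = comp C x := connectedComponentIn_eq hx
    have e2 : comp C z' = comp C x := connectedComponentIn_eq hx'
    simp only [e1, e2]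
  have hH : ∀ K ∈ 𝒦, (hidden o K).Nonempty := by
    intro K hK
    by_contra hne
    rw [not_nonempty_iff_eq_empty, hidden, compl_empty_iff] at hne
    obtain ⟨β, b1, b2, b3, b4, b5, b6⟩ := harc K hK
    refine crosscut_separates β b1 b5 b2 b3 b4 ?_
    have : Metric.closedBall (0:ℂ) (3 / 2) \ range β =
        Subtype.val '' connectedComponentIn Kᶜ o := by
      rw [b6]
      ext z
      constructor
      · rintro ⟨hz, hzK⟩
        have : (⟨z, hz⟩ : X) ∈ connectedComponentIn Kᶜ o ∪ K := hne ▸ mem_univ _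
        exact ⟨⟨z, hz⟩, this.resolve_right fun h => hzK ⟨_, h, rfl⟩, rfl⟩
      · rintro ⟨w, hw, rfl⟩
        refine ⟨w.2, ?_⟩
        rintro ⟨w', hw', h⟩
        rw [Subtype.ext h] at hw'
        exact connectedComponentIn_subset _ _ hw hw'
    rw [this]
    exact isPreconnected_connectedComponentIn.image _ continuous_subtype_val.continuousOn
  set Y := core o 𝒦 with hY
  have hYconn : IsConnected Y := isConnected_core hcl hcK hoK hd
  have hYcl : IsClosed Y := isClosed_core hcl
  have hoY : o ∈ Y := mem_core hoK
  have hcount := countable_meeting_core hcl hcK hoK hd hH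
  have hcover : ∀ w : X, w ∈ Y → 1 ≤ ‖w.1‖ → ‖w.1‖ < 3 / 2 → (C₀ ∈ 𝒞 → 1 < ‖w.1‖) →
      ∃ K ∈ {K ∈ 𝒦 | (K ∩ Y).Nonempty}, w ∈ K := by
    intro w hwY hw1 hw2 hw3
    have hwm : 1 ≤ ‖w.1‖ ∧ ‖w.1‖ < 2 := ⟨hw1, by linarith⟩
    obtain ⟨C, hC, hwC⟩ : ψ ⟨w, hwm⟩ ∈ ⋃₀ 𝒞 := h3 ▸ mem_univ _
    have hne : C ≠ C₀ := by
      rintro rfl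
      rw [← hC₀] at hwC
      obtain ⟨v, hv, hvw⟩ := hwC
      have := hψ.injective hvw
      subst this
      exact (hw3 hC).ne' hv
    have hwT : w.1 ∈ trace ψ C := ⟨hwm, hwC⟩
    have hwK : w ∈ (Subtype.val ⁻¹' comp C w : Set X) :=
      mem_connectedComponentIn ⟨hwT, w.2⟩
    exact ⟨_, ⟨⟨C, hC, hne, w, hwT, hw2, rfl⟩, w, hwK, hwY⟩, hwK⟩
  have hpw : {K ∈ 𝒦 | (K ∩ Y).Nonempty}.PairwiseDisjoint id := hd.subset fun K hK => hK.1
  by_cases hmem : C₀ ∈ 𝒞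
  · have hJ : (Y ∩ {w : X | ‖w.1‖ = 3 / 2}).Nonempty := by
      refine core_inter_nonempty hcl hcK hoK hd
        (isClosed_eq (by fun_prop) continuous_const).isCompact ?_ ?_
      · exact ⟨⟨(3 / 2 : ℝ), by rw [hX]; norm_num⟩, by simp⟩
      · intro K hK
        obtain ⟨β, -, b2, -, -, -, b6⟩ := harc K hK
        obtain ⟨w, hw, h⟩ : β 0 ∈ Subtype.val '' K := b6 ▸ ⟨0, rfl⟩
        exact ⟨w, hw, by show ‖w.1‖ = _; rw [h, b2]⟩
    obtain ⟨p, hpY, hp⟩ := hJ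
    replace hp : ‖p.1‖ = 3 / 2 := hp
    let U : Set X := {w | ‖w.1‖ < 5 / 4}
    have hU : IsOpen U := isOpen_lt (by fun_prop) continuous_const
    have hclU : ∀ w ∈ closure U, ‖w.1‖ ≤ 5 / 4 := fun w hw =>
      closure_minimal (t := {w : X | ‖w.1‖ ≤ 5 / 4}) (fun z hz => (show ‖z.1‖ < 5 / 4 from hz).le)
        (isClosed_le (by fun_prop) continuous_const) hw
    have hoU : o ∈ U := by show ‖(0:ℂ)‖ < _; norm_num
    obtain ⟨v, hvF, hvU⟩ := boundary_bumping hYcl.isCompact hYconn.isPreconnected hU hoY hoU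
      fun h => by
        have : ‖p.1‖ < 5 / 4 := h hpY
        rw [hp] at this
        norm_num at this
    set F := connectedComponentIn (Y ∩ closure U) o with hF
    have hFsub : F ⊆ Y ∩ closure U := connectedComponentIn_subset _ _
    have hFconn : IsConnected F :=
      isConnected_connectedComponentIn_iff.2 ⟨hoY, subset_closure hoU⟩
    have hFcl : IsClosed F := isClosed_connectedComponentIn' (hYcl.inter isClosed_closure) _
    let D₁ : Set X := {w | ‖w.1‖ ≤ 1}
    obtain ⟨L, hL, hFL⟩ := sierpinski_sUnion (𝒦 := insert D₁ {K ∈ 𝒦 | (K ∩ Y).Nonempty})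
      (hcount.insert _) (by
        rintro K (rfl | hK)
        · exact isClosed_le (by fun_prop) continuous_const
        · exact hcl K hK.1)
      (by
        refine hpw.insert fun K hK hne => ?_
        obtain ⟨⟨C, hC, hne', z, hz, hzr, rfl⟩, -⟩ := hK
        simp only [id]
        rw [disjoint_left]
        intro w hw hwK
        obtain ⟨h, hwC⟩ := (hcompsub _ _ hwK).1
        refine disjoint_left.1 (h2 C hC C₀ hmem hne') hwC ?_
        rw [← hC₀]
        exact ⟨_, le_antisymm (show ‖w.1‖ ≤ 1 from hw) h.1, rfl⟩)
      hFcl.isCompact hFconn (by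
        intro w hw
        by_cases hw1 : ‖w.1‖ ≤ 1
        · exact ⟨D₁, Or.inl rfl, hw1⟩
        · push Not at hw1
          obtain ⟨K, hK, hwK⟩ := hcover w (hFsub hw).1 hw1.le
            (by linarith [hclU w (hFsub hw).2]) fun _ => hw1
          exact ⟨K, Or.inr hK, hwK⟩)
    have hoF : o ∈ F := mem_connectedComponentIn ⟨hoY, subset_closure hoU⟩
    rcases hL with rfl | hL
    · apply hvU
      have : ‖v.1‖ ≤ 1 := hFL hvF
      show ‖v.1‖ < 5 / 4
      linarith
    · exact hoK L hL.1 (hFL hoF)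
  · let τ : Circle → X := fun u => ⟨u, by rw [mem_closedBall_zero_iff, Circle.norm_coe]; norm_num⟩
    have hτ : Continuous τ := by fun_prop
    have hτY : range τ ⊆ Y := by
      rintro _ ⟨u, rfl⟩
      refine mem_iInter₂.2 fun K hK => ?_
      rw [hidden, compl_compl]
      by_contra hcon'
      rw [mem_union, not_or] at hcon'
      apply hcon'.1
      let σ : unitInterval → X := fun t => ⟨(t : ℝ) * u, by
        rw [mem_closedBall_zero_iff, norm_mul, Circle.norm_coe, Complex.norm_real,
          Real.norm_eq_abs, abs_of_nonneg t.2.1]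
        linarith [t.2.2]⟩
      have hσ : Continuous σ := by fun_prop
      refine (isPreconnected_range hσ).subset_connectedComponentIn ⟨0, ?_⟩ ?_ ⟨1, ?_⟩
      · ext; simp [σ, o]
      · rintro _ ⟨t, rfl⟩ htK
        rcases t.2.2.lt_or_eq with ht | ht
        · obtain ⟨C, hC, hne, z, hz, hzr, rfl⟩ := hK
          obtain ⟨h, -⟩ := (hcompsub _ _ htK).1
          have h5 := h.1
          simp only [σ] at h5
          rw [norm_mul, Circle.norm_coe, Complex.norm_real,
            Real.norm_eq_abs, abs_of_nonneg t.2.1] at h5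
          linarith
        · apply hcon'.2
          convert htK using 1
          ext
          simp [σ, τ, ht]
      · ext; simp [σ, τ]
    obtain ⟨L, hL, hTL⟩ := sierpinski_sUnion hcount (fun K hK => hcl K hK.1) hpw
      (isCompact_range hτ) (isConnected_range hτ) (by
        rintro _ ⟨u, rfl⟩
        obtain ⟨K, hK, hwK⟩ := hcover (τ u) (hτY ⟨u, rfl⟩) (Circle.norm_coe u).ge
          (by rw [show ‖(τ u).1‖ = 1 from Circle.norm_coe u]; norm_num)
          fun h => absurd h hmem
        exact ⟨K, hK, hwK⟩)
    obtain ⟨⟨C, hC, hne, z, hz, hzr, rfl⟩, -⟩ := hL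
    apply hne
    refine (isCircle_eq_of_subset hcirc (h1 C hC) ?_).symm
    rw [← hC₀]
    rintro _ ⟨w, hw, rfl⟩
    replace hw : ‖w.1‖ = 1 := hw
    have := hTL ⟨⟨w.1, by simpa [Submonoid.unitSphere] using hw⟩, rfl⟩
    exact (hcompsub _ _ this).1.2

end CircleInCollar

section HullCollar

variable {S : Type*} {ψ : Annulus → S} {C D : Set S} {r : ℝ}

lemma image_trace (hC : C ⊆ range ψ) : ψ '' (Subtype.val ⁻¹' trace ψ C) = C := by
  apply Subset.antisymm
  · rintro _ ⟨z, ⟨_, hz⟩, rfl⟩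
    exact hz
  · intro x hx
    obtain ⟨z, rfl⟩ := hC hx
    exact ⟨z, ⟨z.2, hx⟩, rfl⟩

lemma norm_le_of_mem_trace (hψ : Function.Injective ψ) (hCr : C ⊆ ψ '' {z | ‖z.1‖ ≤ r}) {z : ℂ}
    (hz : z ∈ trace ψ C) : ‖z‖ ≤ r := by
  obtain ⟨h, hz⟩ := hz
  obtain ⟨w, hw, hwz⟩ := hCr hz
  rw [hψ hwz] at hw
  exact hw

variable [TopologicalSpace S]

lemma isCircle_trace (hψ : IsOpenEmbedding ψ) (hC : IsCircle C) (hCr : C ⊆ range ψ) :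
    IsCircle (trace ψ C) := by
  obtain ⟨ι, hι, hιψ⟩ := exists_collar_inverse hψ
  have : trace ψ C = ι '' C := by
    rw [trace_eq_image]
    ext z
    constructor
    · rintro ⟨w, hw, rfl⟩
      exact ⟨ψ w, hw, hιψ w⟩
    · rintro ⟨x, hx, rfl⟩
      obtain ⟨w, rfl⟩ := hCr hx
      exact ⟨w, hx, (hιψ w).symm⟩
  rw [this]
  refine isCircle_image hC (hι.mono hCr) fun x hx y hy h => ?_
  obtain ⟨w, rfl⟩ := hCr hx
  obtain ⟨v, rfl⟩ := hCr hy
  rw [hιψ, hιψ] at h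
  rw [Subtype.ext h]

lemma isOpen_hull_diff {K : Set ℂ} (hK : IsCompact K) : IsOpen (hull K \ K) := by
  have : hull K \ K = interior (hull K) \ K := by
    ext z
    constructor
    · rintro ⟨h1, h2⟩
      refine ⟨?_, h2⟩
      by_contra h
      apply h2
      apply frontier_compl_hull_subset hK
      rw [frontier_compl]
      exact ⟨subset_closure h1, h⟩
    · rintro ⟨h1, h2⟩
      exact ⟨interior_subset h1, h2⟩
  rw [this]
  exact isOpen_interior.sdiff hK.isClosed

/-- Circles of the decomposition through points of the hull stay in the hull. -/
lemma trace_subset_hull [T2Space S] {𝒞 : Set (Set S)} (h𝒞 : IsCircleDecomposition 𝒞)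
    (hψ : IsOpenEmbedding ψ) (hr : r < 2) (hC : C ∈ 𝒞) (hCr : C ⊆ ψ '' {z | ‖z.1‖ ≤ r})
    (hD : D ∈ 𝒞) {z : Annulus} (hz : z.1 ∈ hull (trace ψ C)) (hzD : ψ z ∈ D) :
    D ⊆ ψ '' {z | ‖z.1‖ ≤ r} ∧ trace ψ D ⊆ hull (trace ψ C) := by
  obtain ⟨h1, h2, h3⟩ := h𝒞
  have hCrange : C ⊆ range ψ := hCr.trans (image_subset_range _ _)
  have hCc := isCircle_isCompact (isCircle_trace hψ (h1 C hC) hCrange)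
  have hnorm : ∀ z ∈ hull (trace ψ C), ‖z‖ ≤ r := fun z hz =>
    norm_le_of_mem_hull (fun w hw => norm_le_of_mem_trace hψ.injective hCr hw) hz
  suffices h : D ⊆ ψ '' (Subtype.val ⁻¹' hull (trace ψ C)) by
    refine ⟨h.trans (image_mono fun w hw => hnorm _ hw), ?_⟩
    rintro w ⟨hw, hwD⟩
    obtain ⟨v, hv, hvw⟩ := h hwD
    rw [hψ.injective hvw] at hv
    exact hv
  by_cases hCD : C = D
  · subst hCD
    conv_lhs => rw [← image_trace hCrange]
    exact image_mono (preimage_mono (subset_hull _))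
  have hd := h2 C hC D hD hCD
  have hclosed : IsClosed (ψ '' (Subtype.val ⁻¹' hull (trace ψ C))) := by
    have : IsCompact (Subtype.val ⁻¹' hull (trace ψ C) : Set Annulus) :=
      (isCompact_annulus_le hr).of_isClosed_subset
        ((isCompact_hull hCc).isClosed.preimage continuous_subtype_val) fun w hw => hnorm _ hw
    exact (this.image hψ.continuous).isClosed
  have hopen : IsOpen (ψ '' (Subtype.val ⁻¹' (hull (trace ψ C) \ trace ψ C))) :=
    hψ.isOpenMap _ ((isOpen_hull_diff hCc).preimage continuous_subtype_val)
  have hnot : ∀ w : Annulus, ψ w ∈ D → w.1 ∉ trace ψ C := fun w hw h =>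
    disjoint_left.1 hd h.2 hw
  have hsub := (isCircle_isConnected (h1 D hD)).isPreconnected.subset_left_of_subset_union hopen
    hclosed.isOpen_compl ?_ ?_ ⟨ψ z, hzD, z, ⟨hz, hnot z hzD⟩, rfl⟩
  · exact hsub.trans (image_mono (preimage_mono sdiff_subset))
  · rw [disjoint_compl_right_iff_subset]
    exact image_mono (preimage_mono sdiff_subset)
  · intro x hx
    by_cases h : x ∈ ψ '' (Subtype.val ⁻¹' hull (trace ψ C))
    · obtain ⟨w, hw, rfl⟩ := h
      exact Or.inl ⟨w, ⟨hw, hnot w hx⟩, rfl⟩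
    · exact Or.inr h

/-- Circles of the decomposition within the collar are essential. -/
lemma ball_subset_hull_trace [T2Space S] {𝒞 : Set (Set S)} (h𝒞 : IsCircleDecomposition 𝒞)
    (hψ : IsOpenEmbedding ψ) (hr : r < 2) (hC : C ∈ 𝒞) (hCr : C ⊆ ψ '' {z | ‖z.1‖ ≤ r}) :
    Metric.closedBall 0 1 ⊆ hull (trace ψ C) := by
  have hrange : ∀ D, D ⊆ ψ '' {z | ‖z.1‖ ≤ r} → D ⊆ range ψ := fun D h =>
    h.trans (image_subset_range _ _)
  have hCc := isCircle_isCompact (isCircle_trace hψ (h𝒞.1 C hC) (hrange C hCr))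
  rw [← closure_ball _ one_ne_zero]
  refine closure_minimal ?_ (isCompact_hull hCc).isClosed
  by_contra hnot
  have hdisj : Disjoint (trace ψ C) (Metric.ball 0 1) := disjoint_left.2 fun z hz hz1 => by
    rw [mem_ball_zero_iff] at hz1
    exact hz.1.1.not_gt hz1
  have hball : ∀ z ∈ hull (trace ψ C), 1 ≤ ‖z‖ := fun z hz => by
    by_contra! hz1
    exact hnot (subset_hull_of_disjoint (convex_ball _ _).isPreconnected hdisj
      ⟨z, by simpa using hz1, hz⟩)
  have hnorm : ∀ z ∈ hull (trace ψ C), ‖z‖ ≤ r := fun z hz =>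
    norm_le_of_mem_hull (fun w hw => norm_le_of_mem_trace hψ.injective hCr hw) hz
  refine hull_not_subset_sUnion (𝒟 := trace ψ '' {D ∈ 𝒞 | D ⊆ ψ '' {z | ‖z.1‖ ≤ r}}) ?_ ?_
    ⟨C, ⟨hC, hCr⟩, rfl⟩ ?_
  · rintro _ ⟨D, ⟨hD, hDr⟩, rfl⟩
    exact isCircle_trace hψ (h𝒞.1 D hD) (hrange D hDr)
  · rintro _ ⟨D, ⟨hD, -⟩, rfl⟩ _ ⟨D', ⟨hD', -⟩, rfl⟩ hne
    exact disjoint_trace (h𝒞.2.1 D hD D' hD' fun h => hne (h ▸ rfl))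
  · intro z hz
    obtain ⟨D, hD, hzD⟩ : ψ ⟨z, hball z hz, (hnorm z hz).trans_lt hr⟩ ∈ ⋃₀ 𝒞 :=
      h𝒞.2.2 ▸ mem_univ _
    exact ⟨_, ⟨D, ⟨hD, (trace_subset_hull h𝒞 hψ hr hC hCr hD hz hzD).1⟩, rfl⟩, _, hzD⟩

/-- A circle of the decomposition within the collar meeting the boundary is the boundary circle. -/
lemma eq_of_meets_boundary [T2Space S] {𝒞 : Set (Set S)} (h𝒞 : IsCircleDecomposition 𝒞)
    (hψ : IsOpenEmbedding ψ) {C₀ : Set S} (hC₀ : ψ '' {z | ‖z.1‖ = 1} = C₀)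
    (hcirc : IsCircle C₀) (hr : r < 2) (hC : C ∈ 𝒞) (hCr : C ⊆ ψ '' {z | ‖z.1‖ ≤ r})
    (hne : (C ∩ C₀).Nonempty) : C = C₀ := by
  by_contra hCC
  have hrange : ∀ D, D ⊆ ψ '' {z | ‖z.1‖ ≤ r} → D ⊆ range ψ := fun D h =>
    h.trans (image_subset_range _ _)
  have htr : ∀ D ∈ 𝒞, D ⊆ ψ '' {z | ‖z.1‖ ≤ r} → IsCircle (trace ψ D) := fun D hD hDr =>
    isCircle_trace hψ (h𝒞.1 D hD) (hrange D hDr)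
  obtain ⟨x, hx, hxC⟩ := not_subset.1 fun h =>
    hCC (isCircle_eq_of_subset hcirc (h𝒞.1 C hC) h).symm
  rw [← hC₀] at hx
  obtain ⟨z, hz, rfl⟩ := hx
  obtain ⟨y, hyC, hy⟩ := hne
  rw [← hC₀] at hy
  obtain ⟨w, hw, rfl⟩ := hy
  obtain ⟨D, hD, hzD⟩ : ψ z ∈ ⋃₀ 𝒞 := h𝒞.2.2 ▸ mem_univ _
  have hCD : C ≠ D := fun h => hxC (h ▸ hzD)
  have hzH := ball_subset_hull_trace h𝒞 hψ hr hC hCr (mem_closedBall_zero_iff.2 (le_of_eq hz))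
  obtain ⟨hDr, hDC⟩ := trace_subset_hull h𝒞 hψ hr hC hCr hD hzH hzD
  have hwH := ball_subset_hull_trace h𝒞 hψ hr hD hDr (mem_closedBall_zero_iff.2 (le_of_eq hw))
  obtain ⟨-, hCD'⟩ := trace_subset_hull h𝒞 hψ hr hD hDr hC hwH hyC
  have hC' := htr C hC hCr
  exact not_mutually_in_hull (isCircle_isCompact hC') (isCircle_isCompact (htr D hD hDr))
    (isCircle_isConnected hC').nonempty (disjoint_trace (h𝒞.2.1 C hC D hD hCD)) hCD' hDC

/-- The boundary circle belongs to the decomposition, and another circle of the decomposition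
surrounds it within the collar. -/
lemma exists_essential_circle [T2Space S] {𝒞 : Set (Set S)} (h𝒞 : IsCircleDecomposition 𝒞)
    (hψ : IsOpenEmbedding ψ) {C₀ : Set S} (hC₀ : ψ '' {z | ‖z.1‖ = 1} = C₀)
    (hcirc : IsCircle C₀) : C₀ ∈ 𝒞 ∧ ∃ K : Set ℂ, IsCircle K ∧ Metric.closedBall 0 1 ⊆ hull K ∧
      (∀ z ∈ K, 1 < ‖z‖ ∧ ‖z‖ ≤ 3 / 2) ∧ ψ '' (Subtype.val ⁻¹' K) ∈ 𝒞 := by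
  obtain ⟨C, hC, hne, hCr⟩ := exists_circle_in_collar h𝒞 hψ hC₀ hcirc
  have hr : (3 / 2 : ℝ) < 2 := by norm_num
  have hCrange : C ⊆ range ψ := hCr.trans (image_subset_range _ _)
  have hball := ball_subset_hull_trace h𝒞 hψ hr hC hCr
  constructor
  · let z : Annulus := ⟨1, by norm_num⟩
    have hz : z ∈ {z : Annulus | ‖z.1‖ = 1} := by show ‖(1:ℂ)‖ = 1; norm_num
    obtain ⟨D, hD, hzD⟩ : ψ z ∈ ⋃₀ 𝒞 := h𝒞.2.2 ▸ mem_univ _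
    have hDr := (trace_subset_hull h𝒞 hψ hr hC hCr hD
      (hball (mem_closedBall_zero_iff.2 (le_of_eq hz))) hzD).1
    have := eq_of_meets_boundary h𝒞 hψ hC₀ hcirc hr hD hDr ⟨ψ z, hzD, hC₀ ▸ ⟨z, hz, rfl⟩⟩
    exact this ▸ hD
  · refine ⟨trace ψ C, isCircle_trace hψ (h𝒞.1 C hC) hCrange, hball, fun z hz => ⟨?_, ?_⟩, ?_⟩
    · refine lt_of_le_of_ne hz.1.1 fun h => hne ?_
      exact eq_of_meets_boundary h𝒞 hψ hC₀ hcirc hr hC hCr ⟨_, hz.2, hC₀ ▸ ⟨⟨z, hz.1⟩, h.symm, rfl⟩⟩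
    · exact norm_le_of_mem_trace hψ.injective hCr hz
    · rw [image_trace hCrange]
      exact hC

end HullCollar

section FilledLog

variable {K : Set ℂ} {f : ℂ → ℂ} {ω : ℂ} {c : ℝ}

/-- Integer-valued functions on the two sides of a line, with a jump at a point of the line. -/
lemma exists_log_jump (hω : ω ≠ 0) {a : ℂ} (haK : a ∉ K) (hac : (ω * a).re = c)
    (hlog : HasLog (fun z => z - a) K) : ∃ d₁ d₂ : ℂ → ℂ,
      ContinuousOn d₁ (K ∩ {z | (ω * z).re ≤ c}) ∧ ContinuousOn d₂ (K ∩ {z | c ≤ (ω * z).re}) ∧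
      (∀ z ∈ K, (ω * z).re ≤ c → Complex.exp (d₁ z) = 1) ∧
      (∀ z ∈ K, c ≤ (ω * z).re → Complex.exp (d₂ z) = 1) ∧
      (∀ z ∈ K, (ω * z).re = c → (ω * a).im < (ω * z).im → d₁ z = d₂ z) ∧
      (∀ z ∈ K, (ω * z).re = c → (ω * z).im < (ω * a).im →
        d₁ z - d₂ z = 2 * Real.pi * Complex.I) := by
  obtain ⟨w, hw, hwf⟩ := (hasLog_const hω K).mul hlog
  have hne : ∀ z ∈ K, ω * (z - a) ≠ 0 := fun z hz =>
    mul_ne_zero hω (sub_ne_zero.2 fun h => haK (h ▸ hz))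
  have hslit : ∀ v : ℂ, v ≠ 0 → 0 ≤ v.re → v ∈ Complex.slitPlane := fun v hv hr => by
    rw [Complex.mem_slitPlane_iff]
    rcases hr.lt_or_eq with h | h
    · exact Or.inl h
    · exact Or.inr fun h' => hv (Complex.ext h.symm h')
  have hre : ∀ z, (ω * (z - a)).re = (ω * z).re - c := fun z => by
    rw [mul_sub, Complex.sub_re, hac]
  have him : ∀ z, (ω * (z - a)).im = (ω * z).im - (ω * a).im := fun z => by
    rw [mul_sub, Complex.sub_im]
  have hdiff : ∀ z, Complex.log (-(ω * (z - a))) + Real.pi * Complex.I - w z -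
      (Complex.log (ω * (z - a)) - w z) =
      (((-(ω * (z - a))).arg - (ω * (z - a)).arg + Real.pi : ℝ) : ℂ) * Complex.I := fun z => by
    apply Complex.ext <;> simp [Complex.log_re, Complex.log_im]
    ring
  refine ⟨fun z => Complex.log (-(ω * (z - a))) + Real.pi * Complex.I - w z,
    fun z => Complex.log (ω * (z - a)) - w z, ?_, ?_, ?_, ?_, ?_, ?_⟩
  · refine ((ContinuousOn.clog (by fun_prop) ?_).add continuousOn_const).sub
      (hw.mono inter_subset_left)
    rintro z ⟨hz, hzc⟩
    refine hslit _ (neg_ne_zero.2 (hne z hz)) ?_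
    rw [Complex.neg_re, hre]
    linarith [show (ω * z).re ≤ c from hzc]
  · refine (ContinuousOn.clog (by fun_prop) ?_).sub (hw.mono inter_subset_left)
    rintro z ⟨hz, hzc⟩
    refine hslit _ (hne z hz) ?_
    rw [hre]
    linarith [show c ≤ (ω * z).re from hzc]
  · intro z hz _
    rw [Complex.exp_sub, hwf z hz, Complex.exp_add, Complex.exp_log (neg_ne_zero.2 (hne z hz)),
      Complex.exp_pi_mul_I, mul_neg_one, neg_neg, div_self (hne z hz)]
  · intro z hz _
    rw [Complex.exp_sub, hwf z hz, Complex.exp_log (hne z hz), div_self (hne z hz)]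
  · intro z hz hzc him'
    have h1 : (-(ω * (z - a))).arg = -(Real.pi / 2) := by
      rw [Complex.arg_eq_neg_pi_div_two_iff, Complex.neg_re, Complex.neg_im, hre, him]
      constructor <;> linarith
    have h2 : (ω * (z - a)).arg = Real.pi / 2 := by
      rw [Complex.arg_eq_pi_div_two_iff, hre, him]
      constructor <;> linarith
    have := hdiff z
    rw [h1, h2] at this
    rw [← sub_eq_zero]
    simp only
    rw [this]
    push_cast
    ring
  · intro z hz hzc him'
    have h1 : (-(ω * (z - a))).arg = Real.pi / 2 := by
      rw [Complex.arg_eq_pi_div_two_iff, Complex.neg_re, Complex.neg_im, hre, him]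
      constructor <;> linarith
    have h2 : (ω * (z - a)).arg = -(Real.pi / 2) := by
      rw [Complex.arg_eq_neg_pi_div_two_iff, hre, him]
      constructor <;> linarith
    simp only
    rw [hdiff z, h1, h2]
    push_cast
    ring

/-- If a compact set does not separate the plane, logarithms on the two sides of a line give a
logarithm on the whole set. -/
lemma HasLog.union_half (hω : ω ≠ 0) (hK : IsCompact K)
    (hfill : ∀ a ∉ K, HasLog (fun z => z - a) K)
    (h1 : HasLog f (K ∩ {z | (ω * z).re ≤ c})) (h2 : HasLog f (K ∩ {z | c ≤ (ω * z).re})) :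
    HasLog f K := by
  classical
  have hcont : Continuous fun z : ℂ => ω * z := by fun_prop
  have hcl1 : IsClosed {z : ℂ | (ω * z).re ≤ c} := isClosed_le (by fun_prop) continuous_const
  have hcl2 : IsClosed {z : ℂ | c ≤ (ω * z).re} := isClosed_le continuous_const (by fun_prop)
  let Logs : (ℂ → ℂ) → (ℂ → ℂ) → Prop := fun u v =>
    ContinuousOn u (K ∩ {z | (ω * z).re ≤ c}) ∧ ContinuousOn v (K ∩ {z | c ≤ (ω * z).re}) ∧
    (∀ z ∈ K ∩ {z | (ω * z).re ≤ c}, Complex.exp (u z) = f z) ∧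
    (∀ z ∈ K ∩ {z | c ≤ (ω * z).re}, Complex.exp (v z) = f z)
  suffices h : ∃ u v, Logs u v ∧ ∀ z ∈ K, (ω * z).re = c → u z = v z by
    obtain ⟨u, v, ⟨hu, hv, hue, hve⟩, huv⟩ := h
    have hEq : EqOn (fun z => if (ω * z).re ≤ c then u z else v z) v (K ∩ {z | c ≤ (ω * z).re}) := by
      rintro z ⟨hz, hzc⟩
      by_cases h : (ω * z).re ≤ c
      · simp only [h, if_true]
        exact huv z hz (le_antisymm h hzc)
      · simp only [h, if_false]
    have hEq1 : EqOn (fun z => if (ω * z).re ≤ c then u z else v z) u (K ∩ {z | (ω * z).re ≤ c}) := by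
      rintro z ⟨hz, hzc⟩
      simp only [show (ω * z).re ≤ c from hzc, if_true]
    have hun : K = K ∩ {z | (ω * z).re ≤ c} ∪ K ∩ {z | c ≤ (ω * z).re} := by
      ext z
      constructor
      · intro hz
        rcases le_total (ω * z).re c with h | h
        · exact Or.inl ⟨hz, h⟩
        · exact Or.inr ⟨hz, h⟩
      · rintro (h | h)
        · exact h.1
        · exact h.1
    refine ⟨fun z => if (ω * z).re ≤ c then u z else v z, ?_, ?_⟩
    · rw [hun]
      exact (hu.congr hEq1).union_of_isClosed (hv.congr hEq) (hK.isClosed.inter hcl1)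
        (hK.isClosed.inter hcl2)
    · intro z hz
      rcases le_total (ω * z).re c with h | h
      · exact (congrArg Complex.exp (hEq1 ⟨hz, h⟩)).trans (hue z ⟨hz, h⟩)
      · exact (congrArg Complex.exp (hEq ⟨hz, h⟩)).trans (hve z ⟨hz, h⟩)
  obtain ⟨u₀, hu₀, hue₀⟩ := h1
  obtain ⟨v₀, hv₀, hve₀⟩ := h2
  set E := K ∩ {z | (ω * z).re = c} with hE
  have hEc : IsCompact E := hK.inter_right (isClosed_eq (by fun_prop) continuous_const)
  have hE1 : E ⊆ K ∩ {z | (ω * z).re ≤ c} := fun z hz => ⟨hz.1, le_of_eq hz.2⟩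
  have hE2 : E ⊆ K ∩ {z | c ≤ (ω * z).re} := fun z hz => ⟨hz.1, ge_of_eq hz.2⟩
  have hint : ∀ u v, Logs u v → ∀ z ∈ E, ∃ n : ℤ, u z - v z = n * (2 * Real.pi * Complex.I) := by
    rintro u v ⟨-, -, hu, hv⟩ z hz
    rw [← Complex.exp_eq_one_iff, Complex.exp_sub, hu z (hE1 hz), hv z (hE2 hz), div_self]
    rw [← hu z (hE1 hz)]
    exact Complex.exp_ne_zero _
  have huc := hEc.uniformContinuousOn_of_continuous ((hu₀.mono hE1).sub (hv₀.mono hE2))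
  obtain ⟨δ, hδ, hδE⟩ := Metric.uniformContinuousOn_iff.1 huc 1 one_pos
  obtain ⟨M, hM⟩ := ((hEc.image hcont).image Complex.continuous_im).isBounded.exists_norm_le
  replace hM : ∀ z ∈ E, |(ω * z).im| ≤ M := fun z hz => hM _ ⟨_, ⟨z, hz, rfl⟩, rfl⟩
  have hωpos : 0 < ‖ω‖ := norm_pos_iff.2 hω
  set η := ‖ω‖ * δ / 2 with hη
  have hηpos : 0 < η := by positivity
  have key : ∀ j : ℕ, ∃ u v, Logs u v ∧ (∀ z ∈ E, M + 1 - j * η ≤ (ω * z).im → u z = v z) ∧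
      ∀ z ∈ E, ∀ z' ∈ E, (ω * z).im ≤ M + 1 - j * η → (ω * z').im ≤ M + 1 - j * η →
        |(ω * z).im - (ω * z').im| ≤ η → u z - v z = u z' - v z' := by
    intro j
    induction j with
    | zero =>
      refine ⟨u₀, v₀, ⟨hu₀, hv₀, hue₀, hve₀⟩, ?_, ?_⟩
      · intro z hz h
        have := (abs_le.1 (hM z hz)).2
        simp only [Nat.cast_zero, zero_mul, sub_zero] at h
        linarith
      · intro z hz z' hz' _ _ hzz
        have hd : dist z z' < δ := by
          have h1 : ω * (z - z') = (((ω * z).im - (ω * z').im : ℝ) : ℂ) * Complex.I := by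
            have e1 : (ω * z).re = c := hz.2
            have e2 : (ω * z').re = c := hz'.2
            rw [mul_sub]
            apply Complex.ext
            · rw [Complex.sub_re, e1, e2, sub_self, Complex.re_ofReal_mul, Complex.I_re, mul_zero]
            · rw [Complex.sub_im, Complex.im_ofReal_mul, Complex.I_im, mul_one]
          have h2 : ‖ω‖ * ‖z - z'‖ = |(ω * z).im - (ω * z').im| := by
            rw [← norm_mul, h1, norm_mul, Complex.norm_real, Complex.norm_I, mul_one,
              Real.norm_eq_abs]
          rw [dist_eq_norm]
          have h3 : ‖ω‖ * ‖z - z'‖ < ‖ω‖ * δ := by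
            rw [h2]
            have : 0 < ‖ω‖ * δ := by positivity
            linarith
          exact lt_of_mul_lt_mul_left h3 hωpos.le
        have hlt := hδE z hz z' hz' hd
        obtain ⟨n, hn⟩ := hint u₀ v₀ ⟨hu₀, hv₀, hue₀, hve₀⟩ z hz
        obtain ⟨n', hn'⟩ := hint u₀ v₀ ⟨hu₀, hv₀, hue₀, hve₀⟩ z' hz'
        rw [dist_eq_norm] at hlt
        simp only [Pi.sub_apply] at hlt
        rw [hn, hn', ← sub_mul, norm_mul] at hlt
        have h2pi : 1 ≤ ‖(2 * Real.pi * Complex.I : ℂ)‖ := by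
          simp only [norm_mul, Complex.norm_ofNat, Complex.norm_real, Complex.norm_I, mul_one,
            Real.norm_of_nonneg Real.pi_pos.le]
          linarith [Real.pi_gt_three]
        have h4 : ‖((n : ℂ) - n')‖ < 1 := by
          by_contra! h
          nlinarith [norm_nonneg ((n : ℂ) - n')]
        have h5 : n = n' := by
          rw [← Int.cast_sub, Complex.norm_intCast] at h4
          have : |n - n'| < 1 := by exact_mod_cast h4
          rw [Int.abs_lt_one_iff] at this
          omega
        rw [hn, hn', h5]
    | succ j ih =>
      obtain ⟨u, v, hL, hge, hle⟩ := ih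
      set T := M + 1 - j * η with hT
      have hT' : M + 1 - ((j + 1 : ℕ) : ℝ) * η = T - η := by push_cast; rw [hT]; ring
      rw [hT']
      by_cases hall : ∀ z ∈ E, T - η ≤ (ω * z).im → u z = v z
      · exact ⟨u, v, hL, hall, fun z hz z' hz' h h' => hle z hz z' hz' (by linarith) (by linarith)⟩
      push Not at hall
      obtain ⟨z₁, hz₁, hz₁T, hne⟩ := hall
      have hz₁lt : (ω * z₁).im < T := by
        by_contra! h
        exact hne (hge z₁ hz₁ h)
      obtain ⟨n, hn⟩ := hint u v hL z₁ hz₁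
      set a : ℂ := ω⁻¹ * (c + T * Complex.I) with ha
      have hωa : ω * a = c + T * Complex.I := by rw [ha, mul_inv_cancel_left₀ hω]
      have hare : (ω * a).re = c := by rw [hωa]; simp
      have haim : (ω * a).im = T := by rw [hωa]; simp
      have haK : a ∉ K := fun haK => by
        have haE : a ∈ E := ⟨haK, hare⟩
        have e1 := hge a haE haim.ge
        have e2 := hle a haE z₁ hz₁ haim.le hz₁lt.le (by
          rw [haim, abs_le]; constructor <;> linarith)
        rw [e1, sub_self, eq_comm, sub_eq_zero] at e2
        exact hne e2
      obtain ⟨d₁, d₂, hd₁, hd₂, he₁, he₂, hup, hdown⟩ := exists_log_jump hω haK hare (hfill a haK)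
      obtain ⟨hu, hv, hue, hve⟩ := hL
      refine ⟨fun z => u z - n * d₁ z, fun z => v z - n * d₂ z, ⟨hu.sub (continuousOn_const.mul hd₁),
        hv.sub (continuousOn_const.mul hd₂), fun z hz => ?_, fun z hz => ?_⟩, ?_, ?_⟩
      · rw [Complex.exp_sub, hue z hz, Complex.exp_int_mul, he₁ z hz.1 hz.2, one_zpow, div_one]
      · rw [Complex.exp_sub, hve z hz, Complex.exp_int_mul, he₂ z hz.1 hz.2, one_zpow, div_one]
      · intro z hz hzT
        simp only
        rcases lt_trichotomy (ω * z).im T with h | h | h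
        · have e1 := hdown z hz.1 hz.2 (by rwa [haim])
          have e2 := hle z hz z₁ hz₁ h.le hz₁lt.le (by
            rw [abs_le]; constructor <;> linarith)
          linear_combination e2 + hn - n * e1
        · refine absurd ?_ haK
          have : ω * z = ω * a := Complex.ext (hz.2.trans hare.symm) (h.trans haim.symm)
          rw [← mul_left_cancel₀ hω this]
          exact hz.1
        · rw [hup z hz.1 hz.2 (by rwa [haim]), hge z hz h.le]
      · intro z hz z' hz' h h' hd
        have e1 := hdown z hz.1 hz.2 (by rw [haim]; linarith)
        have e2 := hdown z' hz'.1 hz'.2 (by rw [haim]; linarith)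
        have e3 := hle z hz z' hz' (by linarith) (by linarith) hd
        simp only
        linear_combination e3 - n * e1 + n * e2
  obtain ⟨j, hj⟩ := exists_nat_ge ((2 * M + 1) / η)
  obtain ⟨u, v, hL, hge, -⟩ := key j
  refine ⟨u, v, hL, fun z hz hzc => hge z ⟨hz, hzc⟩ ?_⟩
  have h3 := (abs_le.1 (hM z ⟨hz, hzc⟩)).1
  rw [div_le_iff₀ hηpos] at hj
  linarith

lemma filled_inter (hfill : ∀ a ∉ K, HasLog (fun z => z - a) K) {H : Set ℂ} (hH : Convex ℝ H) :
    ∀ a ∉ K ∩ H, HasLog (fun z => z - a) (K ∩ H) := by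
  intro a ha
  by_cases haK : a ∈ K
  · refine (hasLog_of_convex hH (by fun_prop) fun z hz h => ?_).mono inter_subset_right
    exact ha ⟨haK, (sub_eq_zero.1 h) ▸ hz⟩
  · exact (hfill a haK).mono inter_subset_left

lemma convex_strip (ω : ℂ) (p q : ℝ) : Convex ℝ {z : ℂ | p ≤ (ω * z).re ∧ (ω * z).re ≤ q} := by
  have : {z : ℂ | p ≤ (ω * z).re ∧ (ω * z).re ≤ q} =
      (Complex.reLm ∘ₗ (LinearMap.mulLeft ℝ ω)) ⁻¹' Icc p q := rfl
  rw [this]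
  exact (convex_Icc p q).linear_preimage _

lemma isClosed_strip (ω : ℂ) (p q : ℝ) : IsClosed {z : ℂ | p ≤ (ω * z).re ∧ (ω * z).re ≤ q} := by
  have h1 : IsClosed {z : ℂ | p ≤ (ω * z).re} := isClosed_le continuous_const (by fun_prop)
  have h2 : IsClosed {z : ℂ | (ω * z).re ≤ q} := isClosed_le (by fun_prop) continuous_const
  exact h1.inter h2

/-- Logarithms on thin strips give a logarithm on the whole set. -/
lemma hasLog_of_strips (hω : ω ≠ 0) {η : ℝ} (hη : 0 < η) (hK : IsCompact K)
    (hfill : ∀ a ∉ K, HasLog (fun z => z - a) K)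
    (hs : ∀ p : ℝ, HasLog f (K ∩ {z | p ≤ (ω * z).re ∧ (ω * z).re ≤ p + η})) : HasLog f K := by
  have hcont : Continuous fun z : ℂ => (ω * z).re := by fun_prop
  obtain ⟨M, hM⟩ := (hK.image hcont).isBounded.exists_norm_le
  replace hM : ∀ z ∈ K, |(ω * z).re| ≤ M := fun z hz => hM _ ⟨z, hz, rfl⟩
  have key : ∀ j : ℕ, HasLog f (K ∩ {z | -M ≤ (ω * z).re ∧ (ω * z).re ≤ -M + j * η}) := by
    intro j
    induction j with
    | zero =>
      refine (hs (-M)).mono (inter_subset_inter_right _ fun z hz => ⟨hz.1, ?_⟩)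
      have := hz.2
      simp only [Nat.cast_zero, zero_mul, add_zero] at this
      linarith
    | succ j ih =>
      refine HasLog.union_half (c := -M + j * η) hω (hK.inter_right (isClosed_strip _ _ _))
        (filled_inter hfill (convex_strip _ _ _)) (ih.mono ?_) ((hs (-M + j * η)).mono ?_)
      · rintro z ⟨⟨hz, h1, -⟩, h2⟩
        exact ⟨hz, h1, h2⟩
      · rintro z ⟨⟨hz, -, h1⟩, h2⟩
        refine ⟨hz, h2, h1.trans (le_of_eq ?_)⟩
        push_cast
        ring
  obtain ⟨j, hj⟩ := exists_nat_ge ((2 * M) / η)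
  refine (key j).mono fun z hz => ⟨hz, ?_⟩
  have h3 := abs_le.1 (hM z hz)
  rw [div_le_iff₀ hη] at hj
  exact ⟨h3.1, by linarith⟩

/-- Every nonvanishing continuous function on a compact set not separating the plane has a
continuous logarithm. -/
lemma hasLog_of_filled (hK : IsCompact K) (hfill : ∀ a ∉ K, HasLog (fun z => z - a) K)
    (hf : ContinuousOn f K) (h0 : ∀ z ∈ K, f z ≠ 0) : HasLog f K := by
  rcases K.eq_empty_or_nonempty with rfl | hKne
  · exact ⟨fun _ => 0, by simp, by simp⟩
  obtain ⟨z₀, hz₀, hmin⟩ := hK.exists_isMinOn hKne hf.norm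
  have hpos : 0 < ‖f z₀‖ := norm_pos_iff.2 (h0 z₀ hz₀)
  obtain ⟨δ, hδ, hδK⟩ := Metric.uniformContinuousOn_iff.1
    (hK.uniformContinuousOn_of_continuous hf) _ hpos
  have hsmall : ∀ L ⊆ K, (∀ z ∈ L, ∀ w ∈ L, dist z w < δ) → HasLog f L := by
    intro L hL hd
    rcases L.eq_empty_or_nonempty with rfl | ⟨w, hw⟩
    · exact ⟨fun _ => 0, by simp, by simp⟩
    have hslit : HasLog (fun z => f z / f w) L := by
      refine hasLog_of_slitPlane ((hf.mono hL).div_const _) fun z hz => ?_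
      have h1 := hδK z (hL hz) w (hL hw) (hd z hz w hw)
      have h2 : ‖f z₀‖ ≤ ‖f w‖ := hmin (hL hw)
      have hw0 := h0 w (hL hw)
      apply Complex.ball_one_subset_slitPlane
      rw [mem_ball_iff_norm, div_sub_one hw0, norm_div, div_lt_one (norm_pos_iff.2 hw0)]
      rw [dist_eq_norm] at h1
      exact h1.trans_le h2
    refine (hslit.mul (hasLog_const (h0 w (hL hw)) L)).congr fun z hz => ?_
    rw [div_mul_cancel₀ _ (h0 w (hL hw))]
  refine hasLog_of_strips one_ne_zero (show 0 < δ / 3 by positivity) hK hfill fun p => ?_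
  refine hasLog_of_strips Complex.I_ne_zero (show 0 < δ / 3 by positivity)
    (hK.inter_right (isClosed_strip _ _ _)) (filled_inter hfill (convex_strip _ _ _)) fun q => ?_
  refine hsmall _ (fun z hz => hz.1.1) ?_
  rintro z ⟨⟨hz, h1, h2⟩, h3, h4⟩ w ⟨⟨hw, g1, g2⟩, g3, g4⟩
  simp only [one_mul, Complex.mul_re, Complex.I_re, Complex.I_im, zero_mul, zero_sub] at *
  rw [dist_eq_norm]
  refine (Complex.norm_le_abs_re_add_abs_im _).trans_lt ?_
  rw [Complex.sub_re, Complex.sub_im]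
  have e1 : |z.re - w.re| ≤ δ / 3 := abs_le.2 ⟨by linarith, by linarith⟩
  have e2 : |z.im - w.im| ≤ δ / 3 := abs_le.2 ⟨by linarith, by linarith⟩
  linarith

lemma filled_hull (hK : IsCompact K) : ∀ a ∉ hull K, HasLog (fun z => z - a) (hull K) := by
  intro a ha
  refine hasLog_of_unbounded (isCompact_hull hK) fun hb => ?_
  have h1 : (hull K)ᶜ ⊆ connectedComponentIn (hull K)ᶜ a :=
    (isConnected_compl_hull hK.isBounded).isPreconnected.subset_connectedComponentIn ha subset_rfl
  have h2 := hb.subset h1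
  exact ha ((component_eq_compl_hull hK.isBounded ha ▸ h2 :
    Bornology.IsBounded (connectedComponentIn Kᶜ a)))

end FilledLog

section Domain

variable {B : Set ℂ} {f : ℂ → ℂ}

lemma hull_subset_of_subset (hBb : Bornology.IsBounded B) (hBc : IsPreconnected Bᶜ) {L : Set ℂ}
    (hL : L ⊆ B) : hull L ⊆ B := by
  intro a ha
  by_contra haB
  have h1 : Bᶜ ⊆ connectedComponentIn Lᶜ a :=
    hBc.subset_connectedComponentIn haB (compl_subset_compl.2 hL)
  have h2 : Bornology.IsBounded (Set.univ : Set ℂ) := by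
    rw [← union_compl_self B]
    exact hBb.union (Bornology.IsBounded.subset ha h1)
  exact NormedSpace.unbounded_univ ℝ ℂ h2

/-- On a bounded domain with connected complement, nonvanishing continuous functions have
logarithms. -/
lemma hasLog_of_simplyConnected (hBo : IsOpen B) (hBconn : IsConnected B)
    (hBb : Bornology.IsBounded B) (hBc : IsPreconnected Bᶜ) (hf : ContinuousOn f B)
    (h0 : ∀ z ∈ B, f z ≠ 0) : HasLog f B := by
  obtain ⟨o, ho⟩ := hBconn.nonempty
  have hcomp : ∀ L ⊆ B, IsCompact L → o ∈ L → ∃ g : ℂ → ℂ, ContinuousOn g L ∧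
      (∀ z ∈ L, Complex.exp (g z) = f z) ∧ g o = Complex.log (f o) := by
    intro L hL hLc hoL
    have hsub := hull_subset_of_subset hBb hBc hL
    obtain ⟨g, hg, hgf⟩ := (hasLog_of_filled (isCompact_hull hLc) (filled_hull hLc) (hf.mono hsub)
      fun z hz => h0 z (hsub hz)).mono (subset_hull L)
    refine ⟨fun z => g z - g o + Complex.log (f o), (hg.sub continuousOn_const).add
      continuousOn_const, fun z hz => ?_, by simp⟩
    rw [Complex.exp_add, Complex.exp_sub, hgf z hz, hgf o hoL, Complex.exp_log (h0 o ho),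
      div_mul_cancel₀ _ (h0 o ho)]
  let R : ℂ → ℂ → Prop := fun z w => ∃ L ⊆ B, IsCompact L ∧ IsPreconnected L ∧ o ∈ L ∧ z ∈ L ∧
    ∃ g : ℂ → ℂ, ContinuousOn g L ∧ (∀ z ∈ L, Complex.exp (g z) = f z) ∧
      g o = Complex.log (f o) ∧ g z = w
  have huniq : ∀ z w w', R z w → R z w' → w = w' := by
    rintro z w w' ⟨L, hL, hLc, hLp, hoL, hzL, g, hg, hgf, hgo, rfl⟩
      ⟨L', hL', hLc', hLp', hoL', hzL', g', hg', hgf', hgo', rfl⟩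
    obtain ⟨l, hl, hlf, hlo⟩ := hcomp (L ∪ L') (union_subset hL hL') (hLc.union hLc') (Or.inl hoL)
    have e1 := log_sub_const hLp hg (hl.mono subset_union_left)
      (fun x hx => (hgf x hx).trans (hlf x (Or.inl hx)).symm) z hzL o hoL
    have e2 := log_sub_const hLp' hg' (hl.mono subset_union_right)
      (fun x hx => (hgf' x hx).trans (hlf x (Or.inr hx)).symm) z hzL' o hoL'
    rw [hgo, hlo] at e1
    rw [hgo', hlo] at e2
    linear_combination e1 - e2
  have hexL : ∀ z ∈ B, ∃ L ⊆ B, IsCompact L ∧ IsPreconnected L ∧ o ∈ L ∧ z ∈ L := by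
    intro z hz
    obtain ⟨γ, hγ⟩ := (hBo.isConnected_iff_isPathConnected.1 hBconn).joinedIn o ho z hz
    exact ⟨range γ, by rintro _ ⟨t, rfl⟩; exact hγ t, isCompact_range γ.continuous,
      isPreconnected_range γ.continuous, ⟨0, γ.source⟩, ⟨1, γ.target⟩⟩
  have hex : ∀ z ∈ B, ∃ w, R z w := by
    intro z hz
    obtain ⟨L, hL, hLc, hLp, hoL, hzL⟩ := hexL z hz
    obtain ⟨g, hg, hgf, hgo⟩ := hcomp L hL hLc hoL
    exact ⟨g z, L, hL, hLc, hLp, hoL, hzL, g, hg, hgf, hgo, rfl⟩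
  choose! l hl using hex
  refine ⟨l, fun z hz => ContinuousAt.continuousWithinAt ?_, fun z hz => ?_⟩
  · obtain ⟨L, hL, hLc, hLp, hoL, hzL⟩ := hexL z hz
    obtain ⟨r, hr, hrB⟩ := Metric.nhds_basis_closedBall.mem_iff.1 (hBo.mem_nhds hz)
    have hU : L ∪ Metric.closedBall z r ⊆ B := union_subset hL hrB
    have hUc := hLc.union (isCompact_closedBall z r)
    obtain ⟨g, hg, hgf, hgo⟩ := hcomp _ hU hUc (Or.inl hoL)
    have hUp : IsPreconnected (L ∪ Metric.closedBall z r) :=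
      hLp.union z hzL (Metric.mem_closedBall_self hr.le) (convex_closedBall z r).isPreconnected
    have hgl : ∀ x ∈ Metric.closedBall z r, g x = l x := fun x hx =>
      huniq x _ _ ⟨_, hU, hUc, hUp, Or.inl hoL, Or.inr hx, g, hg, hgf, hgo, rfl⟩ (hl x (hrB hx))
    have hnhds := Metric.closedBall_mem_nhds z hr
    exact ((hg.mono subset_union_right).continuousAt hnhds).congr
      (Filter.eventually_of_mem hnhds hgl)
  · obtain ⟨L, hL, hLc, hLp, hoL, hzL, g, hg, hgf, hgo, hgz⟩ := hl z hz
    rw [← hgz, hgf z hzL]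

end Domain

section Riemann

variable {B : Set ℂ}

/-- A weak form of Montel's theorem. -/
lemma exists_tendstoLocallyUniformlyOn (hBo : IsOpen B) {F : ℕ → ℂ → ℂ}
    (hd : ∀ n, DifferentiableOn ℂ (F n) B) (hm : ∀ n, MapsTo (F n) B (Metric.closedBall 0 1)) :
    ∃ l : Ultrafilter ℕ, (l : Filter ℕ) ≤ Filter.atTop ∧
      ∃ f, TendstoLocallyUniformlyOn F f l B := by
  refine ⟨Filter.hyperfilter ℕ, Nat.hyperfilter_le_atTop, ?_⟩
  set l := Filter.hyperfilter ℕ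
  have hpt : ∀ z ∈ B, ∃ y, Filter.Tendsto (fun n => F n z) l (𝓝 y) := by
    intro z hz
    obtain ⟨y, -, hy⟩ := isCompact_iff_ultrafilter_le_nhds.1
      (isCompact_closedBall (0 : ℂ) 1) (l.map fun n => F n z) (by
        rw [Filter.le_principal_iff]
        exact Filter.univ_mem' (f := (l : Filter ℕ)) fun n => hm n hz)
    exact ⟨y, hy⟩
  choose! f hf using hpt
  refine ⟨f, Metric.tendstoLocallyUniformlyOn_iff.2 fun ε hε z₀ hz₀ => ?_⟩
  obtain ⟨R, hR, hRB⟩ := Metric.isOpen_iff.1 hBo z₀ hz₀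
  have hlip : ∀ n, ∀ z ∈ Metric.ball z₀ R, dist (F n z) (F n z₀) ≤ 2 / R * dist z z₀ := by
    intro n z hz
    refine Complex.dist_le_div_mul_dist_of_mapsTo_ball ((hd n).mono hRB) (fun w hw => ?_) hz
    have h1 := mem_closedBall_zero_iff.1 (hm n (hRB hw))
    have h2 := mem_closedBall_zero_iff.1 (hm n hz₀)
    rw [Metric.mem_closedBall, dist_eq_norm]
    linarith [norm_sub_le (F n w) (F n z₀)]
  have hlim : ∀ z ∈ Metric.ball z₀ R, dist (f z) (f z₀) ≤ 2 / R * dist z z₀ := fun z hz =>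
    le_of_tendsto ((hf z (hRB hz)).dist (hf z₀ hz₀)) (Filter.Eventually.of_forall fun n =>
      hlip n z hz)
  refine ⟨Metric.ball z₀ (min R (ε * R / 6)), mem_nhdsWithin_of_mem_nhds
    (Metric.ball_mem_nhds _ (by positivity)), ?_⟩
  filter_upwards [(hf z₀ hz₀).eventually (Metric.ball_mem_nhds _ (show 0 < ε / 3 by positivity))]
    with n hn z hz
  have hz1 : z ∈ Metric.ball z₀ R := Metric.ball_subset_ball (min_le_left _ _) hz
  have hz2 : dist z z₀ < ε * R / 6 := lt_of_lt_of_le hz (min_le_right _ _)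
  have h3 : 2 / R * dist z z₀ < ε / 3 := by
    rw [div_mul_eq_mul_div, div_lt_iff₀ hR]
    linarith
  have h4 := hlip n z hz1
  have h5 := hlim z hz1
  have h6 : dist (F n z₀) (f z₀) < ε / 3 := hn
  have h7 := dist_triangle4 (f z) (f z₀) (F n z₀) (F n z)
  rw [dist_comm (f z₀), dist_comm (F n z₀) (F n z)] at h7
  linarith

/-- A weak form of Hurwitz's theorem. -/
lemma injOn_of_tendstoLocallyUniformlyOn (hBo : IsOpen B) (hBc : IsPreconnected B)
    {F : ℕ → ℂ → ℂ} {f : ℂ → ℂ} {l : Filter ℕ} [l.NeBot] (hF : TendstoLocallyUniformlyOn F f l B)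
    (hd : ∀ n, DifferentiableOn ℂ (F n) B) (hinj : ∀ n, InjOn (F n) B) {z₁ : ℂ} (hz₁ : z₁ ∈ B)
    (hne : deriv f z₁ ≠ 0) : InjOn f B := by
  have hfd : DifferentiableOn ℂ f B := hF.differentiableOn (Filter.Eventually.of_forall hd) hBo
  have hfa : AnalyticOnNhd ℂ f B := hfd.analyticOnNhd hBo
  intro a ha b hb hab
  by_contra hne'
  have hnc : ¬ ∃ᶠ z in 𝓝[≠] b, f z = f b := by
    intro h
    have h1 := hfa.eqOn_of_preconnected_of_frequently_eq analyticOnNhd_const hBc hb h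
    apply hne
    rw [(h1.eventuallyEq_of_mem (hBo.mem_nhds hz₁)).deriv_eq, deriv_const]
  have hev : ∀ᶠ z in 𝓝[≠] b, f z ≠ f b := Filter.not_frequently.1 hnc
  rw [eventually_nhdsWithin_iff] at hev
  obtain ⟨r, hr, hrB⟩ := Metric.eventually_nhds_iff_ball.1
    (hev.and ((show ∀ᶠ z in 𝓝 b, z ∈ B from hBo.mem_nhds hb).and
      (show ∀ᶠ z in 𝓝 b, z ≠ a from isOpen_ne.mem_nhds (Ne.symm hne'))))
  have hsub : Metric.closedBall b (r / 2) ⊆ Metric.ball b r :=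
    Metric.closedBall_subset_ball (by linarith)
  have hBsub : Metric.closedBall b (r / 2) ⊆ B := fun z hz => (hrB z (hsub hz)).2.1
  have hcb : ContinuousOn f (Metric.sphere b (r / 2)) :=
    hfd.continuousOn.mono (Metric.sphere_subset_closedBall.trans hBsub)
  obtain ⟨w, hw, hmin⟩ := (isCompact_sphere b (r / 2)).exists_isMinOn
    (NormedSpace.sphere_nonempty.2 (by positivity))
    ((hcb.sub (continuousOn_const (c := f b))).norm)
  have hwne : w ≠ b := Metric.ne_of_mem_sphere hw (by positivity)
  have hm : 0 < ‖f w - f b‖ := norm_pos_iff.2 (sub_ne_zero.2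
    ((hrB w (hsub (Metric.sphere_subset_closedBall hw))).1 hwne))
  set m := ‖f w - f b‖
  have hmle : ∀ z ∈ Metric.sphere b (r / 2), m ≤ ‖f z - f b‖ := fun z hz => hmin hz
  have hunif := Metric.tendstoUniformlyOn_iff.1
    ((tendstoLocallyUniformlyOn_iff_forall_isCompact hBo).1 hF _ hBsub
      (isCompact_closedBall b (r / 2))) (m / 16) (by positivity)
  have hta := Metric.tendsto_nhds.1 (hF.tendsto_at ha) (m / 16) (by positivity)
  obtain ⟨n, hn, hna⟩ := (hunif.and hta).exists
  have hnb := hn b (Metric.mem_closedBall_self (by positivity))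
  have hball := DiffContOnCl.ball_subset_image_closedBall (f := F n) (z₀ := b) (r := r / 2)
    (ε := m / 2) (((hd n).mono hBsub).diffContOnCl_ball subset_rfl) (by positivity)
    (fun z hz => by
      have h1 := hmle z hz
      have h2 := hn z (Metric.sphere_subset_closedBall hz)
      rw [← dist_eq_norm] at h1 ⊢
      have h3 := dist_triangle4 (f z) (F n z) (F n b) (f b)
      rw [dist_comm (F n b)] at h3
      linarith)
    (by
      have h1 : ∀ᶠ z in 𝓝[≠] b, F n z ≠ F n b := by
        rw [eventually_nhdsWithin_iff]
        filter_upwards [hBo.mem_nhds hb] with z hz hzb h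
        exact hzb (hinj n hz hb h)
      exact h1.frequently.filter_mono nhdsWithin_le_nhds)
  obtain ⟨c, hc, hca⟩ := hball (show F n a ∈ Metric.ball (F n b) (m / 2 / 2) by
    rw [Metric.mem_ball]
    have h3 := dist_triangle4 (F n a) (f a) (f b) (F n b)
    rw [hab, dist_self] at h3
    rw [hab] at hna
    linarith)
  have hce := hinj n (hBsub hc) ha hca
  exact (hrB c (hsub hc)).2.2 hce

lemma exists_sqrt (hBo : IsOpen B) {f : ℂ → ℂ} (hd : DifferentiableOn ℂ f B) (hlog : HasLog f B) :
    ∃ h : ℂ → ℂ, DifferentiableOn ℂ h B ∧ ∀ z ∈ B, h z ^ 2 = f z := by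
  obtain ⟨g, hg, hgf⟩ := hlog
  have hsq : ∀ z ∈ B, Complex.exp (g z / 2) ^ 2 = f z := fun z hz => by
    rw [← Complex.exp_nat_mul, ← hgf z hz]
    congr 1
    push_cast
    ring
  refine ⟨fun z => Complex.exp (g z / 2), fun z hz => ?_, hsq⟩
  have hhc : ContinuousAt (fun z => Complex.exp (g z / 2)) z :=
    ((hg.continuousAt (hBo.mem_nhds hz)).div_const 2).cexp
  have hfd := (hd.differentiableAt (hBo.mem_nhds hz)).hasDerivAt
  have hne : Complex.exp (g z / 2) + Complex.exp (g z / 2) ≠ 0 := by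
    rw [← two_mul]
    exact mul_ne_zero two_ne_zero (Complex.exp_ne_zero _)
  refine HasDerivAt.differentiableAt (f' := deriv f z / (Complex.exp (g z / 2) +
    Complex.exp (g z / 2))) ?_ |>.differentiableWithinAt
  rw [hasDerivAt_iff_tendsto_slope] at hfd ⊢
  have hsum := (hhc.add (continuousAt_const (y := Complex.exp (g z / 2)))).tendsto
  refine (hfd.div (hsum.mono_left nhdsWithin_le_nhds) hne).congr' ?_
  filter_upwards [nhdsWithin_le_nhds (hsum.eventually (isOpen_ne.mem_nhds hne)),
    nhdsWithin_le_nhds (hBo.mem_nhds hz), self_mem_nhdsWithin] with w hw hwB hwz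
  have hw' : Complex.exp (g w / 2) + Complex.exp (g z / 2) ≠ 0 := hw
  have hwz' : w - z ≠ 0 := sub_ne_zero.2 hwz
  show slope f z w / (Complex.exp (g w / 2) + Complex.exp (g z / 2)) = _
  rw [slope_def_field, slope_def_field, ← hsq w hwB, ← hsq z hz]
  field_simp
  ring

/-- The disc automorphism exchanging `a` and `0`, up to sign. -/
noncomputable def moebius (a w : ℂ) : ℂ := (w - a) / (1 - starRingEnd ℂ a * w)

lemma moebius_den_ne_zero {a w : ℂ} (ha : ‖a‖ < 1) (hw : ‖w‖ ≤ 1) :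
    1 - starRingEnd ℂ a * w ≠ 0 := by
  intro h
  have h1 : ‖starRingEnd ℂ a * w‖ = 1 := by rw [← sub_eq_zero.1 h, norm_one]
  rw [norm_mul, RCLike.norm_conj] at h1
  nlinarith [norm_nonneg a, norm_nonneg w]

lemma norm_moebius_lt_one {a w : ℂ} (ha : ‖a‖ < 1) (hw : ‖w‖ < 1) : ‖moebius a w‖ < 1 := by
  have h0 := moebius_den_ne_zero ha hw.le
  rw [moebius, norm_div, div_lt_one (norm_pos_iff.2 h0)]
  refine lt_of_pow_lt_pow_left₀ 2 (norm_nonneg _) ?_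
  have h1 : ‖a‖ ^ 2 < 1 := by nlinarith [norm_nonneg a]
  have h2 : ‖w‖ ^ 2 < 1 := by nlinarith [norm_nonneg w]
  rw [Complex.sq_norm, Complex.normSq_apply] at h1 h2 ⊢
  rw [Complex.sq_norm, Complex.normSq_apply]
  simp only [Complex.sub_re, Complex.sub_im, Complex.mul_re, Complex.mul_im, Complex.conj_re,
    Complex.conj_im, Complex.one_re, Complex.one_im]
  nlinarith [mul_pos (sub_pos.2 h1) (sub_pos.2 h2)]

lemma moebius_inj {a w w' : ℂ} (ha : ‖a‖ < 1) (hw : ‖w‖ ≤ 1) (hw' : ‖w'‖ ≤ 1)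
    (h : moebius a w = moebius a w') : w = w' := by
  rw [moebius, moebius, div_eq_div_iff (moebius_den_ne_zero ha hw) (moebius_den_ne_zero ha hw')]
    at h
  have h1 : (w - w') * (1 - starRingEnd ℂ a * a) = 0 := by linear_combination h
  exact sub_eq_zero.1 ((mul_eq_zero.1 h1).resolve_right (moebius_den_ne_zero ha ha.le))

lemma hasDerivAt_moebius {a w : ℂ} (ha : ‖a‖ < 1) (hw : ‖w‖ ≤ 1) : HasDerivAt (moebius a)
    ((1 - starRingEnd ℂ a * a) / (1 - starRingEnd ℂ a * w) ^ 2) w := by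
  have h0 := moebius_den_ne_zero ha hw
  have h1 : HasDerivAt (fun w => w - a) 1 w := (hasDerivAt_id w).sub_const a
  have h2 : HasDerivAt (fun w => 1 - starRingEnd ℂ a * w) (-starRingEnd ℂ a) w := by
    simpa using ((hasDerivAt_id w).const_mul (starRingEnd ℂ a)).const_sub 1
  refine HasDerivAt.congr_deriv (h1.div h2 h0) ?_
  rw [div_left_inj' (pow_ne_zero 2 h0)]
  ring

/-- The Riemann mapping theorem for bounded domains on which nonvanishing functions have continuous
logarithms. -/
lemma exists_riemann_map (hBo : IsOpen B) (hBc : IsPreconnected B)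
    (hBb : Bornology.IsBounded B) (h0 : (0 : ℂ) ∈ B)
    (hlog : ∀ f : ℂ → ℂ, ContinuousOn f B → (∀ z ∈ B, f z ≠ 0) → HasLog f B) :
    ∃ f : ℂ → ℂ, DifferentiableOn ℂ f B ∧ InjOn f B ∧ f '' B = Metric.ball 0 1 ∧ f 0 = 0 := by
  set V : Set ℝ := {x | ∃ f : ℂ → ℂ, DifferentiableOn ℂ f B ∧ InjOn f B ∧
    MapsTo f B (Metric.closedBall 0 1) ∧ f 0 = 0 ∧ ‖deriv f 0‖ = x} with hV
  obtain ⟨R, hR, hRB⟩ := hBb.exists_pos_norm_le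
  have hmem : R⁻¹ ∈ V := by
    refine ⟨fun z => (R : ℂ)⁻¹ * z, by fun_prop, fun x _ y _ h => ?_, fun z hz => ?_, mul_zero _, ?_⟩
    · exact mul_left_cancel₀ (inv_ne_zero (Complex.ofReal_ne_zero.2 hR.ne')) h
    · rw [mem_closedBall_zero_iff, norm_mul, norm_inv, Complex.norm_real, Real.norm_of_nonneg hR.le,
        inv_mul_le_iff₀ hR, mul_one]
      exact hRB z hz
    · rw [deriv_const_mul _ differentiableAt_id, deriv_id'', mul_one, norm_inv, Complex.norm_real,
        Real.norm_of_nonneg hR.le]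
  obtain ⟨r, hr, hrB⟩ := Metric.isOpen_iff.1 hBo 0 h0
  have hbdd : BddAbove V := by
    refine ⟨1 / r, ?_⟩
    rintro x ⟨f, hf, -, hm, hf0, rfl⟩
    refine Complex.norm_deriv_le_div_of_mapsTo_ball (hf.mono hrB) ?_ hr
    rw [hf0]
    exact hm.mono_left hrB
  obtain ⟨u, -, hu, huV⟩ := exists_seq_tendsto_sSup ⟨_, hmem⟩ hbdd
  choose F hFd hFi hFm hF0 hFu using huV
  obtain ⟨l, hl, f, hFf⟩ := exists_tendstoLocallyUniformlyOn hBo hFd hFm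
  have hfd := hFf.differentiableOn (Filter.Eventually.of_forall hFd) hBo
  have hpos : 0 < sSup V := lt_of_lt_of_le (inv_pos.2 hR) (le_csSup hbdd hmem)
  have hM : ‖deriv f 0‖ = sSup V := by
    refine tendsto_nhds_unique ((hFf.deriv (Filter.Eventually.of_forall hFd) hBo).tendsto_at
      h0).norm ((hu.mono_left hl).congr fun n => (hFu n).symm)
  have hne : deriv f 0 ≠ 0 := norm_pos_iff.1 (hM ▸ hpos)
  have hfi := injOn_of_tendstoLocallyUniformlyOn hBo hBc hFf hFd hFi h0 hne
  have hf0 : f 0 = 0 := tendsto_nhds_unique (hFf.tendsto_at h0)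
    (tendsto_const_nhds.congr fun n => (hF0 n).symm)
  have hfm : MapsTo f B (Metric.closedBall 0 1) := fun z hz =>
    Metric.isClosed_closedBall.mem_of_tendsto (hFf.tendsto_at hz)
      (Filter.Eventually.of_forall fun n => hFm n hz)
  have hopen : IsOpen (f '' B) := by
    rcases (hfd.analyticOnNhd hBo).is_constant_or_isOpen hBc with ⟨w, hw⟩ | h
    · refine absurd ?_ hne
      rw [((show EqOn f (fun _ => w) B from hw).eventuallyEq_of_mem (hBo.mem_nhds h0)).deriv_eq,
        deriv_const]
    · exact h B subset_rfl hBo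
  have hsub : f '' B ⊆ Metric.ball 0 1 := by
    rw [← interior_closedBall (0 : ℂ) one_ne_zero]
    exact hopen.subset_interior_iff.2 hfm.image_subset
  refine ⟨f, hfd, hfi, hsub.antisymm fun a ha => ?_, hf0⟩
  by_contra haf
  have ha1 : ‖a‖ < 1 := mem_ball_zero_iff.1 ha
  have hf1 : ∀ z ∈ B, ‖f z‖ < 1 := fun z hz => mem_ball_zero_iff.1 (hsub ⟨z, hz, rfl⟩)
  have hgd : DifferentiableOn ℂ (fun z => moebius a (f z)) B := fun z hz =>
    ((hasDerivAt_moebius ha1 (hf1 z hz).le).differentiableAt.comp z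
      (hfd.differentiableAt (hBo.mem_nhds hz))).differentiableWithinAt
  obtain ⟨h, hhd, hsq⟩ := exists_sqrt hBo hgd (hlog _ hgd.continuousOn fun z hz hz0 => by
    rw [moebius, div_eq_zero_iff] at hz0
    exact haf ⟨z, hz, sub_eq_zero.1 (hz0.resolve_right (moebius_den_ne_zero ha1 (hf1 z hz).le))⟩)
  have hh1 : ∀ z ∈ B, ‖h z‖ < 1 := fun z hz => by
    refine lt_of_pow_lt_pow_left₀ 2 zero_le_one ?_
    rw [← norm_pow, hsq z hz, one_pow]
    exact norm_moebius_lt_one ha1 (hf1 z hz)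
  have hh0 : h 0 ^ 2 = -a := by rw [hsq 0 h0, hf0, moebius]; simp
  have hnh0 : ‖h 0‖ ^ 2 = ‖a‖ := by rw [← norm_pow, hh0, norm_neg]
  have hane : a ≠ 0 := fun h => haf ⟨0, h0, by rw [hf0, h]⟩
  have hsmem : ‖deriv (fun z => moebius (h 0) (h z)) 0‖ ∈ V := by
    refine ⟨_, fun z hz => ((hasDerivAt_moebius (hh1 0 h0) (hh1 z hz).le).differentiableAt.comp z
      (hhd.differentiableAt (hBo.mem_nhds hz))).differentiableWithinAt, fun z hz w hw hzw => ?_,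
      fun z hz => ?_, ?_, rfl⟩
    · have e1 := moebius_inj (hh1 0 h0) (hh1 z hz).le (hh1 w hw).le hzw
      have e2 : moebius a (f z) = moebius a (f w) := by rw [← hsq z hz, ← hsq w hw, e1]
      exact hfi hz hw (moebius_inj ha1 (hf1 z hz).le (hf1 w hw).le e2)
    · exact mem_closedBall_zero_iff.2 (norm_moebius_lt_one (hh1 0 h0) (hh1 z hz)).le
    · simp [moebius]
  have hle := le_csSup hbdd hsmem
  rw [← hM] at hle
  have hhd0 := (hhd.differentiableAt (hBo.mem_nhds h0)).hasDerivAt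
  have hfd0 := (hfd.differentiableAt (hBo.mem_nhds h0)).hasDerivAt
  have d1 : deriv (fun z => moebius (h 0) (h z)) 0 =
      (1 - starRingEnd ℂ (h 0) * h 0) / (1 - starRingEnd ℂ (h 0) * h 0) ^ 2 * deriv h 0 :=
    ((hasDerivAt_moebius (hh1 0 h0) (hh1 0 h0).le).comp 0 hhd0).deriv
  have d2 : 2 * h 0 * deriv h 0 = (1 - starRingEnd ℂ a * a) * deriv f 0 := by
    have e1 : HasDerivAt (fun z => h z ^ 2) (2 * h 0 * deriv h 0) 0 := by
      exact (hhd0.pow 2).congr_deriv (by simp)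
    have e2 : HasDerivAt (fun z => moebius a (f z)) ((1 - starRingEnd ℂ a * a) /
        (1 - starRingEnd ℂ a * f 0) ^ 2 * deriv f 0) 0 :=
      (hasDerivAt_moebius ha1 (hf1 0 h0).le).comp 0 hfd0
    rw [hf0, mul_zero, sub_zero, one_pow, div_one] at e2
    exact e1.unique (e2.congr_of_eventuallyEq
      ((show EqOn (fun z => h z ^ 2) (fun z => moebius a (f z)) B from hsq).eventuallyEq_of_mem
        (hBo.mem_nhds h0)))
  have hconj : ∀ w : ℂ, ‖w‖ < 1 → ‖1 - starRingEnd ℂ w * w‖ = 1 - ‖w‖ ^ 2 := fun w hw => by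
    rw [Complex.conj_mul', ← Complex.ofReal_pow, ← Complex.ofReal_one, ← Complex.ofReal_sub,
      Complex.norm_real, Real.norm_of_nonneg]
    nlinarith [norm_nonneg w]
  have d2' := congrArg norm d2
  rw [norm_mul, norm_mul, norm_mul, hconj a ha1, Complex.norm_ofNat] at d2'
  rw [d1, norm_mul, norm_div, norm_pow, hconj _ (hh1 0 h0)] at hle
  set s := ‖h 0‖ with hs
  have hs1 : s < 1 := hh1 0 h0
  have hs0 : 0 < s := norm_pos_iff.2 fun h' => hane (by rw [h'] at hh0; simpa using hh0.symm)
  have hD : 0 < ‖deriv f 0‖ := norm_pos_iff.2 hne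
  have hsq1 : 0 < 1 - s ^ 2 := by nlinarith
  have hle' : ‖deriv h 0‖ ≤ ‖deriv f 0‖ * (1 - s ^ 2) := by
    have : (1 - s ^ 2) / (1 - s ^ 2) ^ 2 * ‖deriv h 0‖ = ‖deriv h 0‖ / (1 - s ^ 2) := by
      field_simp
    rwa [this, div_le_iff₀ hsq1] at hle
  rw [← hnh0] at d2'
  have h3 : (1 - (s ^ 2) ^ 2) * ‖deriv f 0‖ ≤ 2 * s * (‖deriv f 0‖ * (1 - s ^ 2)) := by
    rw [← d2']
    exact mul_le_mul_of_nonneg_left hle' (by positivity)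
  have h4 : 0 < (1 - s) ^ 2 * ((1 - s ^ 2) * ‖deriv f 0‖) := by
    have : 0 < 1 - s := by linarith
    positivity
  nlinarith

/-- The inverse Riemann map. -/
lemma exists_inverse_riemann_map (hBo : IsOpen B) (hBc : IsPreconnected B)
    (hBb : Bornology.IsBounded B) (h0 : (0 : ℂ) ∈ B)
    (hlog : ∀ f : ℂ → ℂ, ContinuousOn f B → (∀ z ∈ B, f z ≠ 0) → HasLog f B) :
    ∃ f G : ℂ → ℂ, ContinuousOn f B ∧ DifferentiableOn ℂ G (Metric.ball 0 1) ∧ G 0 = 0 ∧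
      deriv G 0 ≠ 0 ∧ MapsTo f B (Metric.ball 0 1) ∧ MapsTo G (Metric.ball 0 1) B ∧
      (∀ z ∈ B, G (f z) = z) ∧ ∀ w ∈ Metric.ball (0 : ℂ) 1, f (G w) = w := by
  obtain ⟨f, hfd, hfi, hfB, hf0⟩ := exists_riemann_map hBo hBc hBb h0 hlog
  have hfa : AnalyticOnNhd ℂ f B := hfd.analyticOnNhd hBo
  have hbij : BijOn f B (Metric.ball 0 1) := hfB ▸ hfi.bijOn_image
  set G := Function.invFunOn f B with hG
  have hinv : InvOn G f B (Metric.ball 0 1) := hbij.invOn_invFunOn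
  have hGm : MapsTo G (Metric.ball 0 1) B := hbij.surjOn.mapsTo_invFunOn
  have hopen : ∀ s ⊆ B, IsOpen s → IsOpen (f '' s) := by
    rcases hfa.is_constant_or_isOpen hBc with ⟨w, hw⟩ | h
    · have h1 : Metric.ball (0 : ℂ) 1 ⊆ {w} := by
        rw [← hfB]
        rintro _ ⟨z, hz, rfl⟩
        exact hw z hz
      have e1 := h1 (show (0 : ℂ) ∈ Metric.ball (0 : ℂ) 1 by simp)
      have e2 := h1 (show (1 / 2 : ℂ) ∈ Metric.ball (0 : ℂ) 1 by
        rw [mem_ball_zero_iff]; norm_num)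
      rw [mem_singleton_iff] at e1 e2
      rw [← e1] at e2
      norm_num at e2
    · exact h
  have hGc : ContinuousOn G (Metric.ball 0 1) := by
    rw [continuousOn_open_iff Metric.isOpen_ball]
    intro t ht
    convert hopen (t ∩ B) inter_subset_right (ht.inter hBo) using 1
    ext w
    constructor
    · rintro ⟨hw, hwt⟩
      exact ⟨G w, ⟨hwt, hGm hw⟩, hinv.2 hw⟩
    · rintro ⟨z, ⟨hzt, hzB⟩, rfl⟩
      refine ⟨hbij.mapsTo hzB, ?_⟩
      rw [mem_preimage, hinv.1 hzB]
      exact hzt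
  have hderiv : ∀ w ∈ Metric.ball (0 : ℂ) 1, deriv f (G w) ≠ 0 →
      HasDerivAt G (deriv f (G w))⁻¹ w := fun w hw h =>
    HasDerivAt.of_local_left_inverse (hGc.continuousAt (Metric.isOpen_ball.mem_nhds hw))
      (hfd.differentiableAt (hBo.mem_nhds (hGm hw))).hasDerivAt h
      (Filter.eventually_of_mem (Metric.isOpen_ball.mem_nhds hw) fun y hy => hinv.2 hy)
  have hGd : DifferentiableOn ℂ G (Metric.ball 0 1) := by
    intro w hw
    have hz := hGm hw
    rcases ((hfa.deriv) (G w) hz).eventually_eq_zero_or_eventually_ne_zero with h | h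
    · exfalso
      have h1 := hfa.deriv.eqOn_zero_of_preconnected_of_eventuallyEq_zero hBc hz h
      have hhalf : (1 / 2 : ℂ) ∈ Metric.ball (0 : ℂ) 1 := by rw [mem_ball_zero_iff]; norm_num
      have h2 := hBo.is_const_of_deriv_eq_zero hBc hfd h1 h0 (hGm hhalf)
      rw [hf0, hinv.2 hhalf] at h2
      norm_num at h2
    · rw [eventually_nhdsWithin_iff] at h
      have h1 : ∀ᶠ y in 𝓝 w, y ∈ Metric.ball (0 : ℂ) 1 ∧ (G y ≠ G w → deriv f (G y) ≠ 0) :=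
        (show ∀ᶠ y in 𝓝 w, y ∈ Metric.ball (0 : ℂ) 1 from Metric.isOpen_ball.mem_nhds hw).and
          ((hGc.continuousAt (Metric.isOpen_ball.mem_nhds hw)).eventually h)
      have h2 := (Complex.differentiableOn_compl_singleton_and_continuousAt_iff h1).1 ⟨?_,
        hGc.continuousAt (Metric.isOpen_ball.mem_nhds hw)⟩
      · exact (h2.differentiableAt h1).differentiableWithinAt
      · rintro y ⟨⟨hy, hy'⟩, hyw⟩
        refine (hderiv y hy (hy' fun h => hyw ?_)).differentiableAt.differentiableWithinAt
        exact hinv.2.injOn hy hw h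
  have hG0 : G 0 = 0 := by
    have := hinv.1 h0
    rwa [hf0] at this
  refine ⟨f, G, hfd.continuousOn, hGd, hG0, ?_, hbij.mapsTo, hGm, fun z hz => hinv.1 hz,
    fun w hw => hinv.2 hw⟩
  intro h
  have hball : (0 : ℂ) ∈ Metric.ball (0 : ℂ) 1 := by simp
  have e1 := (hGd.differentiableAt (Metric.isOpen_ball.mem_nhds hball)).hasDerivAt
  have e2 := (hfd.differentiableAt (hBo.mem_nhds (hGm hball))).hasDerivAt
  have e3 := (e2.comp 0 e1).congr_of_eventuallyEq (f₁ := id)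
    (Filter.eventually_of_mem (Metric.isOpen_ball.mem_nhds hball) fun y hy => (hinv.2 hy).symm)
  have e4 := e3.unique (hasDerivAt_id 0)
  rw [h, mul_zero] at e4
  exact zero_ne_one e4

end Riemann

section LengthArea

open MeasureTheory ENNReal

lemma lintegral_sq_deriv_le {D : Set ℂ} (hD : IsOpen D) {G : ℂ → ℂ} (hG : DifferentiableOn ℂ G D)
    (hinj : InjOn G D) : ∫⁻ z in D, ‖deriv G z‖ₑ ^ 2 = volume (G '' D) := by
  rw [← lintegral_abs_det_fderiv_eq_addHaar_image volume hD.measurableSet (fun z hz =>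
    ((hG.differentiableAt (hD.mem_nhds hz)).hasDerivAt.complexToReal_fderiv).hasFDerivWithinAt)
    hinj]
  refine setLIntegral_congr_fun hD.measurableSet fun z _ => ?_
  have h : (deriv G z • (1 : ℂ →L[ℝ] ℂ)).det = ‖deriv G z‖ ^ 2 := by
    have h1 : (deriv G z • (1 : ℂ →L[ℝ] ℂ)).det = Algebra.norm ℝ (deriv G z) := by
      rw [Algebra.norm_apply]
      rfl
    rw [h1, Algebra.norm_complex_apply, Complex.normSq_eq_norm_sq]
  simp only [h]
  rw [abs_of_nonneg (by positivity), ENNReal.ofReal_pow (norm_nonneg _), ofReal_norm]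

lemma lintegral_inv_eq_top {δ : ℝ} (hδ : 0 < δ) : ∫⁻ r in Ioo 0 δ, ENNReal.ofReal r⁻¹ = ⊤ := by
  by_contra h
  have h1 := (lintegral_ofReal_ne_top_iff_integrable (μ := volume.restrict (Ioo 0 δ))
    (f := fun r : ℝ => r⁻¹) measurable_inv.aestronglyMeasurable (by
      rw [Filter.EventuallyLE, ae_restrict_iff' measurableSet_Ioo]
      exact Filter.Eventually.of_forall fun r hr => inv_nonneg.2 hr.1.le)).1 h
  have h2 := (intervalIntegrable_iff_integrableOn_Ioo_of_le hδ.le).2 h1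
  rw [intervalIntegrable_inv_iff] at h2
  rcases h2 with h2 | h2
  · exact hδ.ne h2
  · exact h2 left_mem_uIcc

lemma exists_small_circle {g : ℂ → ℝ≥0∞} (hg : Measurable g) (hfin : ∫⁻ z, g z ≠ ⊤) {κ δ : ℝ}
    (hκ : 0 < κ) (hδ : 0 < δ) : ∃ r ∈ Ioo 0 δ, ENNReal.ofReal (r ^ 2) *
      ∫⁻ θ in Ioo (-Real.pi) Real.pi, g (r * (Real.cos θ + Real.sin θ * Complex.I)) <
        ENNReal.ofReal κ := by
  by_contra! hcon
  apply hfin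
  rw [eq_top_iff, ← Complex.lintegral_comp_polarCoord_symm]
  have htarget : polarCoord.target = Ioi (0 : ℝ) ×ˢ Ioo (-Real.pi) Real.pi := rfl
  rw [htarget]
  have hcont : Continuous fun p : ℝ × ℝ => (p.1 : ℂ) * (Real.cos p.2 + Real.sin p.2 * Complex.I) := by
    fun_prop
  have hmeas : Measurable fun p : ℝ × ℝ =>
      ENNReal.ofReal p.1 * g (p.1 * (Real.cos p.2 + Real.sin p.2 * Complex.I)) :=
    (ENNReal.measurable_ofReal.comp measurable_fst).mul (hg.comp hcont.measurable)
  simp only [Complex.polarCoord_symm_apply, smul_eq_mul]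
  rw [Measure.volume_eq_prod, setLIntegral_prod _ hmeas.aemeasurable]
  calc (⊤ : ℝ≥0∞) = ENNReal.ofReal κ * ∫⁻ r in Ioo 0 δ, ENNReal.ofReal r⁻¹ := by
        rw [lintegral_inv_eq_top hδ, ENNReal.mul_top (by simpa using hκ)]
    _ = ∫⁻ r in Ioo 0 δ, ENNReal.ofReal κ * ENNReal.ofReal r⁻¹ :=
        (lintegral_const_mul' _ _ ENNReal.ofReal_ne_top).symm
    _ ≤ ∫⁻ r in Ioo 0 δ, ∫⁻ θ in Ioo (-Real.pi) Real.pi,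
          ENNReal.ofReal r * g (r * (Real.cos θ + Real.sin θ * Complex.I)) := by
        refine setLIntegral_mono' measurableSet_Ioo fun r hr => ?_
        rw [lintegral_const_mul' _ _ ENNReal.ofReal_ne_top]
        have h1 := hcon r hr
        have h2 : ENNReal.ofReal r = ENNReal.ofReal (r ^ 2) * ENNReal.ofReal r⁻¹ := by
          rw [← ENNReal.ofReal_mul (by positivity)]
          congr 1
          have := hr.1.ne'
          field_simp
        rw [h2, mul_right_comm]
        gcongr
    _ ≤ _ := lintegral_mono_set Ioo_subset_Ioi_self

/-- The length-area principle at the boundary point `0` of the disc `ball 1 1`. -/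
lemma exists_short_crosscut {G : ℂ → ℂ} (hG : DifferentiableOn ℂ G (Metric.ball 1 1))
    (hinj : InjOn G (Metric.ball 1 1)) (hb : Bornology.IsBounded (G '' Metric.ball 1 1)) {ε δ : ℝ}
    (hε : 0 < ε) (hδ : 0 < δ) : ∃ r ∈ Ioo 0 δ, ∀ z ∈ Metric.ball (1 : ℂ) 1,
      ∀ w ∈ Metric.ball (1 : ℂ) 1, ‖z‖ = r → ‖w‖ = r → dist (G z) (G w) ≤ ε := by
  set D := Metric.ball (1 : ℂ) 1
  have hDo : IsOpen D := Metric.isOpen_ball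
  set g : ℂ → ℝ≥0∞ := D.indicator fun z => ‖deriv G z‖ₑ ^ 2 with hg
  have hgm : Measurable g := ((measurable_deriv G).enorm.pow_const 2).indicator hDo.measurableSet
  have hgf : ∫⁻ z, g z ≠ ⊤ := by
    rw [lintegral_indicator hDo.measurableSet, lintegral_sq_deriv_le hDo hG hinj]
    exact hb.measure_lt_top.ne
  have hπ := Real.pi_pos
  obtain ⟨r, hr, hrI⟩ := exists_small_circle hgm hgf
    (show 0 < ε ^ 2 / (2 * Real.pi) by positivity) hδ
  refine ⟨r, hr, ?_⟩
  set e : ℝ → ℂ := fun θ => r * (Real.cos θ + Real.sin θ * Complex.I) with he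
  have hee : ∀ θ, e θ = r * Complex.exp (θ * Complex.I) := fun θ => by
    rw [he, Complex.exp_mul_I]; simp
  have hmem : ∀ θ, e θ ∈ D ↔ r / 2 < Real.cos θ := by
    intro θ
    have h1 : ‖e θ - 1‖ ^ 2 = r ^ 2 - 2 * r * Real.cos θ + 1 := by
      rw [Complex.sq_norm, Complex.normSq_apply]
      simp only [he, Complex.sub_re, Complex.sub_im, Complex.re_ofReal_mul, Complex.im_ofReal_mul,
        Complex.add_re, Complex.add_im, Complex.ofReal_re, Complex.ofReal_im, Complex.I_re,
        Complex.I_im, Complex.one_re, Complex.one_im]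
      linear_combination r ^ 2 * Real.sin_sq_add_cos_sq θ
    have h2 : e θ ∈ D ↔ ‖e θ - 1‖ ^ 2 < 1 := by
      rw [mem_ball_iff_norm, sq_lt_one_iff₀ (norm_nonneg _)]
    rw [h2, h1]
    constructor
    · intro h
      by_contra! h'
      nlinarith [hr.1]
    · intro h
      nlinarith [hr.1]
  have key : ∀ α β : ℝ, α ≤ β → -Real.pi < α → β ≤ Real.pi → e α ∈ D → e β ∈ D →
      dist (G (e α)) (G (e β)) ≤ ε := by
    intro α β hαβ hα hβ hαD hβD
    have hin : ∀ θ ∈ Icc α β, e θ ∈ D := by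
      intro θ hθ
      rw [hmem] at hαD hβD ⊢
      rcases le_total 0 θ with h | h
      · exact hβD.trans_le (Real.cos_le_cos_of_nonneg_of_le_pi h hβ hθ.2)
      · refine hαD.trans_le ?_
        rw [← Real.cos_neg α, ← Real.cos_neg θ]
        exact Real.cos_le_cos_of_nonneg_of_le_pi (by linarith) (by linarith) (by linarith [hθ.1])
    have hed : ∀ θ, HasDerivAt e (e θ * Complex.I) θ := by
      intro θ
      have h1 : HasDerivAt (fun θ : ℝ => (r : ℂ) * Complex.exp (θ * Complex.I))
          (r * (Complex.exp (θ * Complex.I) * (1 * Complex.I))) θ :=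
        (((Complex.ofRealCLM.hasDerivAt (x := θ)).mul_const Complex.I).cexp).const_mul _
      rw [funext hee]
      exact h1.congr_deriv (by ring)
    have hder : ∀ θ ∈ uIcc α β, HasDerivAt (fun θ => G (e θ))
        (deriv G (e θ) * (e θ * Complex.I)) θ := fun θ hθ => by
      rw [uIcc_of_le hαβ] at hθ
      exact (hG.differentiableAt (hDo.mem_nhds (hin θ hθ))).hasDerivAt.comp θ (hed θ)
    have hec : Continuous e := by fun_prop
    have hint : IntervalIntegrable (fun θ => deriv G (e θ) * (e θ * Complex.I)) volume α β := by
      refine ContinuousOn.intervalIntegrable ?_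
      rw [uIcc_of_le hαβ]
      refine ContinuousOn.mul ?_ (by fun_prop)
      exact (hG.deriv hDo).continuousOn.comp hec.continuousOn hin
    have hFTC := intervalIntegral.integral_eq_sub_of_hasDerivAt hder hint
    rw [intervalIntegral.integral_of_le hαβ] at hFTC
    rw [dist_comm, dist_eq_norm, ← hFTC]
    rw [← ENNReal.ofReal_le_ofReal_iff hε.le, ofReal_norm]
    set c := ε / (4 * Real.pi) with hc
    have hcpos : 0 < c := by positivity
    have hne : ∀ θ, ‖e θ‖ = r := fun θ => by
      rw [hee, norm_mul, Complex.norm_exp_ofReal_mul_I, Complex.norm_real,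
        Real.norm_of_nonneg hr.1.le, mul_one]
    have hAMGM : ∀ θ ∈ Ioc α β, ‖deriv G (e θ) * (e θ * Complex.I)‖ₑ ≤ ENNReal.ofReal c +
        ENNReal.ofReal (1 / (4 * c)) * (ENNReal.ofReal (r ^ 2) * g (e θ)) := by
      intro θ hθ
      have h1 : g (e θ) = ENNReal.ofReal (‖deriv G (e θ)‖ ^ 2) := by
        rw [hg, indicator_of_mem (hin θ (Ioc_subset_Icc_self hθ)),
          ENNReal.ofReal_pow (norm_nonneg _), ofReal_norm]
      rw [h1, ← ENNReal.ofReal_mul (by positivity), ← ENNReal.ofReal_mul (by positivity),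
        ← ENNReal.ofReal_add hcpos.le (by positivity), ← ofReal_norm]
      refine ENNReal.ofReal_le_ofReal ?_
      rw [norm_mul, norm_mul, hne, Complex.norm_I, mul_one]
      have h2 : c + 1 / (4 * c) * (r ^ 2 * ‖deriv G (e θ)‖ ^ 2) - ‖deriv G (e θ)‖ * r =
          (‖deriv G (e θ)‖ * r - 2 * c) ^ 2 / (4 * c) := by
        field_simp
        ring
      have h3 : 0 ≤ (‖deriv G (e θ)‖ * r - 2 * c) ^ 2 / (4 * c) := by positivity
      linarith
    have hsub : ∫⁻ θ in Ioc α β, g (e θ) ≤ ∫⁻ θ in Ioo (-Real.pi) Real.pi, g (e θ) := by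
      rw [← restrict_Ioo_eq_restrict_Ioc]
      exact lintegral_mono_set (Ioo_subset_Ioo hα.le hβ)
    calc ‖∫ θ in Ioc α β, deriv G (e θ) * (e θ * Complex.I)‖ₑ
        ≤ ∫⁻ θ in Ioc α β, ‖deriv G (e θ) * (e θ * Complex.I)‖ₑ :=
          enorm_integral_le_lintegral_enorm _
      _ ≤ ∫⁻ θ in Ioc α β, (ENNReal.ofReal c +
          ENNReal.ofReal (1 / (4 * c)) * (ENNReal.ofReal (r ^ 2) * g (e θ))) :=
          setLIntegral_mono' measurableSet_Ioc hAMGM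
      _ = ENNReal.ofReal c * ENNReal.ofReal (β - α) + ENNReal.ofReal (1 / (4 * c)) *
          (ENNReal.ofReal (r ^ 2) * ∫⁻ θ in Ioc α β, g (e θ)) := by
          rw [lintegral_add_left measurable_const, lintegral_const_mul' _ _ ENNReal.ofReal_ne_top,
            lintegral_const_mul' _ _ ENNReal.ofReal_ne_top, setLIntegral_const, Real.volume_Ioc]
      _ ≤ ENNReal.ofReal c * ENNReal.ofReal (2 * Real.pi) + ENNReal.ofReal (1 / (4 * c)) *
          ENNReal.ofReal (ε ^ 2 / (2 * Real.pi)) := by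
          refine add_le_add ?_ ?_
          · gcongr
            linarith
          · gcongr
            refine le_trans ?_ hrI.le
            gcongr
      _ = ENNReal.ofReal ε := by
          rw [← ENNReal.ofReal_mul hcpos.le, ← ENNReal.ofReal_mul (by positivity),
            ← ENNReal.ofReal_add (by positivity) (by positivity)]
          congr 1
          rw [hc]
          field_simp
          ring
  intro z hz w hw hzr hwr
  have hez : ∀ z : ℂ, ‖z‖ = r → e z.arg = z := fun z hz => by
    rw [hee, ← hz, Complex.norm_mul_exp_arg_mul_I]
  rcases le_total z.arg w.arg with h | h
  · have := key z.arg w.arg h (Complex.neg_pi_lt_arg z) (Complex.arg_le_pi w)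
      (by rwa [hez z hzr]) (by rwa [hez w hwr])
    rwa [hez z hzr, hez w hwr] at this
  · have := key w.arg z.arg h (Complex.neg_pi_lt_arg w) (Complex.arg_le_pi z)
      (by rwa [hez w hwr]) (by rwa [hez z hzr])
    rwa [hez z hzr, hez w hwr, dist_comm] at this

end LengthArea

/-- Circles are uniformly locally connected. -/
lemma exists_small_arc_of_isCircle {X : Type*} [MetricSpace X] {C : Set X} (hC : IsCircle C) {η : ℝ}
    (hη : 0 < η) : ∃ κ > 0, ∀ p ∈ C, ∃ σ ⊆ C, σ ⊆ Metric.closedBall p η ∧ IsCompact σ ∧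
      IsPreconnected σ ∧ C ∩ Metric.closedBall p κ ⊆ σ := by
  obtain ⟨φ, hφ, hinj, rfl⟩ := exists_param_of_isCircle hC
  obtain ⟨δ₁, hδ₁, hφδ⟩ := Metric.uniformContinuous_iff.1
    (CompactSpace.uniformContinuous_of_continuous hφ) η hη
  obtain ⟨t₀, ht₀, hexp⟩ := Metric.continuousAt_iff.1 (Circle.exp.continuous.continuousAt (x := 0))
    δ₁ hδ₁
  have harg : ContinuousAt (fun u : Circle => Complex.arg u) 1 :=
    (Complex.continuousAt_arg (by simp)).comp continuous_subtype_val.continuousAt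
  obtain ⟨δ₂, hδ₂, harg⟩ := Metric.continuousAt_iff.1 harg (t₀ / 2) (by positivity)
  have hdist : ∀ u v : Circle, dist u v = dist (v / u) 1 := fun u v => by
    have h1 : ((v / u : Circle) : ℂ) - 1 = ((v : ℂ) - u) / u := by
      rw [Circle.coe_div, sub_div, div_self (Circle.coe_ne_zero u)]
    change dist (u : ℂ) v = dist ((v / u : Circle) : ℂ) ((1 : Circle) : ℂ)
    rw [dist_comm, dist_eq_norm, dist_eq_norm, Circle.coe_one, h1, norm_div, Circle.norm_coe,
      div_one]
  have hcpt : IsCompact {q : Circle × Circle | δ₂ ≤ dist q.1 q.2} :=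
    (isClosed_le continuous_const (by fun_prop)).isCompact
  obtain ⟨κ, hκ, hκφ⟩ : ∃ κ > 0, ∀ u v : Circle, dist (φ u) (φ v) ≤ κ → dist u v < δ₂ := by
    rcases {q : Circle × Circle | δ₂ ≤ dist q.1 q.2}.eq_empty_or_nonempty with he | hne
    · refine ⟨1, one_pos, fun u v _ => ?_⟩
      by_contra! h
      exact he.subset (show (u, v) ∈ {q : Circle × Circle | δ₂ ≤ dist q.1 q.2} from h)
    · obtain ⟨q, hq, hmin⟩ := hcpt.exists_isMinOn hne
        (f := fun q => dist (φ q.1) (φ q.2)) (by fun_prop)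
      have hpos : 0 < dist (φ q.1) (φ q.2) := dist_pos.2 fun h => by
        have h1 : δ₂ ≤ dist q.1 q.2 := hq
        rw [hinj h, dist_self] at h1
        linarith
      refine ⟨dist (φ q.1) (φ q.2) / 2, by positivity, fun u v huv => ?_⟩
      by_contra! h
      have : dist (φ q.1) (φ q.2) ≤ dist (φ u) (φ v) := hmin (a := (u, v)) h
      linarith
  refine ⟨κ, hκ, ?_⟩
  rintro _ ⟨u, rfl⟩
  have hc : Continuous fun t : ℝ => φ (u * Circle.exp t) := by fun_prop
  refine ⟨(fun t : ℝ => φ (u * Circle.exp t)) '' Icc (-(t₀ / 2)) (t₀ / 2), ?_, ?_,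
    isCompact_Icc.image hc, isPreconnected_Icc.image _ hc.continuousOn, ?_⟩
  · rintro _ ⟨t, -, rfl⟩
    exact ⟨_, rfl⟩
  · rintro _ ⟨t, ht, rfl⟩
    refine (hφδ ?_).le
    rw [dist_comm, hdist, mul_div_cancel_left, ← Circle.exp_zero]
    refine hexp ?_
    rw [Real.dist_eq, sub_zero, abs_lt]
    constructor <;> linarith [ht.1, ht.2]
  · rintro _ ⟨⟨v, rfl⟩, hv⟩
    have h1 := hκφ v u hv
    rw [dist_comm, hdist] at h1
    have h2 := harg h1
    rw [Circle.coe_one, Complex.arg_one, Real.dist_eq, sub_zero] at h2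
    refine ⟨Complex.arg ↑(v / u), abs_le.1 h2.le, ?_⟩
    simp only
    rw [Circle.exp_arg, mul_div_cancel]

/-- A pair of mutually inverse maps between a domain and the unit disc, the second one being
holomorphic. -/
structure IsRiemannPair (B : Set ℂ) (f G : ℂ → ℂ) : Prop where
  continuousOn : ContinuousOn f B
  differentiableOn : DifferentiableOn ℂ G (Metric.ball 0 1)
  map_zero : G 0 = 0
  deriv_ne_zero : deriv G 0 ≠ 0
  mapsTo : MapsTo f B (Metric.ball 0 1)
  mapsTo' : MapsTo G (Metric.ball 0 1) B
  left_inv : ∀ z ∈ B, G (f z) = z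
  right_inv : ∀ w ∈ Metric.ball (0 : ℂ) 1, f (G w) = w

section Caratheodory

variable {C : Set ℂ} {f G : ℂ → ℂ}

lemma isConnected_compl_closedBall (p : ℂ) (η : ℝ) : IsConnected {z : ℂ | η < ‖z - p‖} := by
  convert (isConnected_norm_gt η).image (fun z => z + p) (by fun_prop) using 1
  ext z
  constructor
  · exact fun h => ⟨z - p, h, sub_add_cancel z p⟩
  · rintro ⟨w, hw, rfl⟩
    rw [mem_ofPred_eq, add_sub_cancel_right]
    exact hw

lemma IsRiemannPair.injOn {B : Set ℂ} (h : IsRiemannPair B f G) : InjOn G (Metric.ball 0 1) :=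
  LeftInvOn.injOn (f₁' := f) h.right_inv

lemma IsRiemannPair.map_zero' {B : Set ℂ} (h : IsRiemannPair B f G) : f 0 = 0 := by
  rw [← h.map_zero, h.right_inv 0 (by simp), h.map_zero]

lemma IsRiemannPair.zero_mem {B : Set ℂ} (h : IsRiemannPair B f G) : 0 ∈ B := by
  rw [← h.map_zero]
  exact h.mapsTo' (by simp)

/-- The Riemann map is uniformly continuous near every boundary point. -/
lemma IsRiemannPair.exists_small_image (hC : IsCircle C)
    (hBb : Bornology.IsBounded (connectedComponentIn Cᶜ 0))
    (h : IsRiemannPair (connectedComponentIn Cᶜ 0) f G) {ζ : ℂ} (hζ : ‖ζ‖ = 1) {ε : ℝ}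
    (hε : 0 < ε) : ∃ r > 0, ∀ z ∈ Metric.ball (0 : ℂ) 1 ∩ Metric.ball ζ r,
      ∀ w ∈ Metric.ball (0 : ℂ) 1 ∩ Metric.ball ζ r, dist (G z) (G w) ≤ ε := by
  set B := connectedComponentIn Cᶜ 0 with hB
  have hCc : IsCompact C := isCircle_isCompact hC
  have hBo : IsOpen B := hCc.isClosed.isOpen_compl.connectedComponentIn
  have hζ0 : ζ ≠ 0 := norm_pos_iff.1 (by rw [hζ]; exact one_pos)
  obtain ⟨d, hd, hdB⟩ := Metric.continuousAt_iff.1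
    (h.continuousOn.continuousAt (hBo.mem_nhds h.zero_mem)) (1 / 2) (by norm_num)
  set η := min (ε / 2) (d / 2) with hη
  have hηpos : 0 < η := by positivity
  obtain ⟨κ, hκ, hulc⟩ := exists_small_arc_of_isCircle hC (show 0 < η / 2 by positivity)
  have hmaps : ∀ z ∈ Metric.ball (1 : ℂ) 1, ζ * (1 - z) ∈ Metric.ball (0 : ℂ) 1 := fun z hz => by
    rw [mem_ball_zero_iff, norm_mul, hζ, one_mul, norm_sub_rev]
    exact mem_ball_iff_norm.1 hz
  obtain ⟨r, hr, hcross⟩ := exists_short_crosscut (G := fun z => G (ζ * (1 - z)))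
    (h.differentiableOn.comp (by fun_prop) hmaps)
    (fun z hz w hw hzw => by
      have := mul_left_cancel₀ hζ0 (h.injOn (hmaps z hz) (hmaps w hw) hzw)
      exact sub_right_injective this)
    (hBb.subset (by rintro _ ⟨z, hz, rfl⟩; exact h.mapsTo' (hmaps z hz)))
    (show 0 < min κ (η / 2) by positivity) (show (0 : ℝ) < 1 / 2 by norm_num)
  set γ := Metric.ball (0 : ℂ) 1 ∩ {w | dist w ζ = r} with hγ
  have hγd : ∀ z ∈ γ, ∀ w ∈ γ, dist (G z) (G w) ≤ min κ (η / 2) := by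
    have hz : ∀ z ∈ γ, 1 - z / ζ ∈ Metric.ball (1 : ℂ) 1 ∧ ‖1 - z / ζ‖ = r ∧
        ζ * (1 - (1 - z / ζ)) = z := by
      rintro z ⟨hz, hzr⟩
      refine ⟨?_, ?_, by field_simp; ring⟩
      · rw [mem_ball_iff_norm, sub_sub_cancel_left, norm_neg, norm_div, hζ, div_one]
        exact mem_ball_zero_iff.1 hz
      · have h1 : 1 - z / ζ = (ζ - z) / ζ := by field_simp
        rw [h1, norm_div, hζ, div_one, norm_sub_rev, ← dist_eq_norm]
        exact hzr
    intro z hzγ w hwγ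
    obtain ⟨z1, z2, z3⟩ := hz z hzγ
    obtain ⟨w1, w2, w3⟩ := hz w hwγ
    have := hcross _ z1 _ w1 z2 w2
    rwa [z3, w3] at this
  set z₀ := ζ * (1 - r : ℝ) with hz₀
  have hz₀γ : z₀ ∈ γ := by
    have h1 : z₀ - ζ = ζ * (-r : ℝ) := by rw [hz₀]; push_cast; ring
    refine ⟨?_, ?_⟩
    · rw [mem_ball_zero_iff, norm_mul, hζ, one_mul, Complex.norm_real, Real.norm_eq_abs, abs_lt]
      constructor <;> linarith [hr.1, hr.2]
    · rw [mem_ofPred_eq, dist_eq_norm, h1, norm_mul, hζ, one_mul, Complex.norm_real, norm_neg,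
        Real.norm_of_nonneg hr.1.le]
  set p := G z₀ with hp
  have hpd : d ≤ ‖p‖ := by
    by_contra! hlt
    have h1 := hdB (x := p) (by rwa [dist_zero_right])
    rw [h.map_zero', dist_zero_right, hp, h.right_inv _ hz₀γ.1, hz₀, norm_mul, hζ, one_mul,
      Complex.norm_real, Real.norm_eq_abs] at h1
    have := (abs_lt.1 h1).2
    linarith [hr.2]
  set E := closure (G '' γ) with hE
  have hEd : ∀ x ∈ E, ∀ y ∈ E, dist x y ≤ min κ (η / 2) := by
    have h1 : ∀ q ∈ E ×ˢ E, dist q.1 q.2 ≤ min κ (η / 2) := by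
      intro q hq
      rw [hE, ← closure_prod_eq] at hq
      refine closure_minimal (t := {q : ℂ × ℂ | dist q.1 q.2 ≤ min κ (η / 2)}) ?_
        (isClosed_le (by fun_prop) continuous_const) hq
      rintro ⟨_, _⟩ ⟨⟨z, hz, rfl⟩, ⟨w, hw, rfl⟩⟩
      exact hγd z hz w hw
    exact fun x hx y hy => h1 (x, y) ⟨hx, hy⟩
  have hpE : p ∈ E := subset_closure ⟨z₀, hz₀γ, rfl⟩
  have hEc : IsCompact E :=
    (hBb.subset (by rintro _ ⟨z, hz, rfl⟩; exact h.mapsTo' hz.1)).isCompact_closure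
  obtain ⟨σ, hσC, hσp, hσc, hσpre, hEσ⟩ : ∃ σ ⊆ C, σ ⊆ Metric.closedBall p η ∧ IsCompact σ ∧
      IsPreconnected σ ∧ C ∩ E ⊆ σ := by
    rcases (C ∩ E).eq_empty_or_nonempty with he | ⟨q, hqC, hqE⟩
    · exact ⟨∅, empty_subset _, empty_subset _, isCompact_empty, isPreconnected_empty, he.subset⟩
    · obtain ⟨σ, h1, h2, h3, h4, h5⟩ := hulc q hqC
      refine ⟨σ, h1, fun x hx => ?_, h3, h4, fun x hx => h5 ⟨hx.1, ?_⟩⟩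
      · have e1 : dist x q ≤ η / 2 := h2 hx
        have e2 := (hEd q hqE p hpE).trans (min_le_right _ _)
        have := dist_triangle x q p
        rw [Metric.mem_closedBall]
        linarith
      · exact (hEd x hx.2 q hqE).trans (min_le_left _ _)
  set T := E ∪ σ with hT
  have hTp : T ⊆ Metric.closedBall p η := by
    refine union_subset (fun x hx => ?_) hσp
    have := (hEd x hx p hpE).trans (min_le_right _ _)
    rw [Metric.mem_closedBall]
    linarith
  have hCT : IsPreconnected (C ∩ T) := by
    have : C ∩ T = σ := by
      rw [hT, inter_union_distrib_left]
      exact (union_subset hEσ inter_subset_right).antisymm fun x hx => Or.inr ⟨hσC hx, hx⟩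
    rwa [this]
  have hmain : ∀ z ∈ Metric.ball (0 : ℂ) 1 ∩ Metric.ball ζ r, dist (G z) p ≤ η := by
    rintro z ⟨hz, hzr⟩
    by_contra! hlt
    have hout : IsPreconnected {z : ℂ | η < ‖z - p‖} := (isConnected_compl_closedBall p η).2
    have hTout : {z : ℂ | η < ‖z - p‖} ⊆ Tᶜ := fun x hx hxT => by
      have h1 := hTp hxT
      rw [Metric.mem_closedBall, dist_eq_norm] at h1
      exact absurd h1 (not_le.2 hx)
    have h0out : (0 : ℂ) ∈ {z : ℂ | η < ‖z - p‖} := by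
      rw [mem_ofPred_eq, zero_sub, norm_neg]
      linarith [min_le_right (ε / 2) (d / 2)]
    have hGT : G z ∈ connectedComponentIn Tᶜ 0 :=
      hout.subset_connectedComponentIn h0out hTout (by
        rw [mem_ofPred_eq, ← dist_eq_norm]; exact hlt)
    have hJ := janiszewski hCc (hEc.union hσc) hCT (h.mapsTo' hz) hGT
    set W := connectedComponentIn (C ∪ T)ᶜ 0 with hW
    have hWB : W ⊆ B := connectedComponentIn_mono 0 (compl_subset_compl.2 subset_union_left)
    have hWT : W ⊆ (C ∪ T)ᶜ := connectedComponentIn_subset _ _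
    have h0W : (0 : ℂ) ∈ W := by
      by_contra h0
      rw [hW, connectedComponentIn_eq_empty fun h1 => h0 (mem_connectedComponentIn h1)] at hJ
      exact hJ
    have hWp : IsPreconnected ((fun u => dist (f u) ζ) '' W) :=
      isPreconnected_connectedComponentIn.image _
        ((continuous_id.dist continuous_const).comp_continuousOn (h.continuousOn.mono hWB))
    have hr' : r ∈ (fun u => dist (f u) ζ) '' W := by
      refine hWp.Icc_subset ⟨G z, hJ, rfl⟩ ⟨0, h0W, rfl⟩ ⟨?_, ?_⟩
      · simp only
        rw [h.right_inv z hz]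
        exact (Metric.mem_ball.1 hzr).le
      · simp only
        rw [h.map_zero', dist_zero_left, hζ]
        linarith [hr.2]
    obtain ⟨u, huW, hur⟩ := hr'
    refine hWT huW (Or.inr (Or.inl (subset_closure ⟨f u, ⟨h.mapsTo (hWB huW), hur⟩, ?_⟩)))
    exact h.left_inv u (hWB huW)
  refine ⟨r, hr.1, fun z hz w hw => ?_⟩
  have h1 := hmain z hz
  have h2 := hmain w hw
  have h3 := dist_triangle_right (G z) (G w) p
  linarith [min_le_left (ε / 2) (d / 2)]

end Caratheodory

lemma isPreconnected_sdiff_singleton_of_isCircle {X : Type*} [TopologicalSpace X] {C : Set X}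
    (hC : IsCircle C) (p : X) : IsPreconnected (C \ {p}) := by
  obtain ⟨φ, hφ, hinj, rfl⟩ := exists_param_of_isCircle hC
  by_cases hp : p ∈ range φ
  swap
  · rw [sdiff_singleton_eq_self hp]
    exact isPreconnected_range hφ
  obtain ⟨u, rfl⟩ := hp
  have hpi : Circle.exp Real.pi * Circle.exp Real.pi = 1 := by
    rw [← Circle.exp_add, ← two_mul, Circle.exp_two_pi]
  have harg : ∀ t : ℝ, t ∈ Ioo (-Real.pi) Real.pi → Circle.exp t ≠ Circle.exp Real.pi :=
    fun t ht h => by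
      have h1 := congrArg (fun z : Circle => Complex.arg z) h
      simp only [Circle.arg_exp ht.1 ht.2.le,
        Circle.arg_exp (by linarith [Real.pi_pos] : -Real.pi < Real.pi) le_rfl] at h1
      exact ht.2.ne h1
  have : range φ \ {φ u} = (fun t : ℝ => φ (u * Circle.exp Real.pi * Circle.exp t)) ''
      Ioo (-Real.pi) Real.pi := by
    ext x
    constructor
    · rintro ⟨⟨v, rfl⟩, hv⟩
      refine ⟨Complex.arg ↑(v / (u * Circle.exp Real.pi)), ⟨Complex.neg_pi_lt_arg _,
        (Complex.arg_le_pi _).lt_of_ne fun h => hv ?_⟩, ?_⟩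
      · have h1 : v / (u * Circle.exp Real.pi) = Circle.exp Real.pi := by
          rw [← Circle.exp_arg (v / (u * Circle.exp Real.pi)), h]
        have h2 : v = u * Circle.exp Real.pi * Circle.exp Real.pi := by
          rw [div_eq_iff_eq_mul] at h1
          rw [h1, mul_comm]
        rw [mul_assoc, hpi, mul_one] at h2
        rw [h2]
        rfl
      · simp only
        rw [Circle.exp_arg, mul_div_cancel]
    · rintro ⟨t, ht, rfl⟩
      refine ⟨⟨_, rfl⟩, fun h => harg t ht ?_⟩
      have h1 := hinj h
      rw [mul_assoc, mul_eq_left] at h1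
      exact mul_left_cancel (h1.trans hpi.symm)
  rw [this]
  exact isPreconnected_Ioo.image _ (by fun_prop)

/-- If a holomorphic function on the disc has constant boundary values along an arc, then it takes
the same value at the centre. -/
lemma eq_of_boundary_const_on_arc {F : ℂ → ℂ} (hF : ContinuousOn F (Metric.closedBall 0 1))
    (hd : DifferentiableOn ℂ F (Metric.ball 0 1)) {V : Set ℂ} (hV : IsOpen V) {η : ℂ} (hη : η ∈ V)
    (hη1 : ‖η‖ = 1) {p : ℂ} (hp : ∀ z ∈ V, ‖z‖ = 1 → F z = p) : F 0 = p := by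
  classical
  have hcov : Metric.sphere (0 : ℂ) 1 ⊆
      ⋃ u : Metric.sphere (0 : ℂ) 1, {z | η / u * z ∈ V} := fun z hz => by
    have hz0 : z ≠ 0 := norm_pos_iff.1 (by rw [mem_sphere_zero_iff_norm.1 hz]; exact one_pos)
    refine mem_iUnion.2 ⟨⟨z, hz⟩, ?_⟩
    rw [mem_ofPred_eq, div_mul_cancel₀ _ hz0]
    exact hη
  obtain ⟨T, hT⟩ := (isCompact_sphere (0 : ℂ) 1).elim_finite_subcover
    (fun u : Metric.sphere (0 : ℂ) 1 => {z : ℂ | η / u * z ∈ V})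
    (fun u => hV.preimage (by fun_prop)) hcov
  have hnorm : ∀ (u : Metric.sphere (0 : ℂ) 1) (z : ℂ), ‖η / u * z‖ = ‖z‖ := fun u z => by
    rw [norm_mul, norm_div, hη1, mem_sphere_zero_iff_norm.1 u.2, div_one, one_mul]
  set H : ℂ → ℂ := fun z => ∏ u ∈ T, (F (η / u * z) - p) with hH
  have hHd : DiffContOnCl ℂ H (Metric.ball 0 1) := by
    constructor
    · refine DifferentiableOn.fun_finsetProd fun u _ => DifferentiableOn.sub_const ?_ _
      refine hd.comp (by fun_prop) fun z hz => ?_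
      rw [mem_ball_zero_iff, hnorm]
      exact mem_ball_zero_iff.1 hz
    · rw [closure_ball _ one_ne_zero]
      refine continuousOn_finsetProd _ fun u _ => ContinuousOn.sub ?_ continuousOn_const
      refine hF.comp (by fun_prop) fun z hz => ?_
      rw [mem_closedBall_zero_iff, hnorm]
      exact mem_closedBall_zero_iff.1 hz
  have h0 := Complex.norm_le_of_forall_mem_frontier_norm_le Metric.isBounded_ball hHd (C := 0)
    (fun z hz => ?_) (subset_closure (Metric.mem_ball_self one_pos) : (0 : ℂ) ∈ _)
  · rw [norm_le_zero_iff, hH] at h0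
    simp only [mul_zero] at h0
    obtain ⟨u, -, hu⟩ := Finset.prod_eq_zero_iff.1 h0
    exact sub_eq_zero.1 hu
  · rw [frontier_ball _ one_ne_zero] at hz
    obtain ⟨u, hu, hzu⟩ := mem_iUnion₂.1 (hT hz)
    rw [norm_le_zero_iff, hH]
    refine Finset.prod_eq_zero hu ?_
    rw [hp _ hzu ((hnorm u z).trans (mem_sphere_zero_iff_norm.1 hz)), sub_self]

section Caratheodory

variable {C : Set ℂ} {f G : ℂ → ℂ}

/-- The Riemann map of a bounded complementary domain of a circle extends continuously to the
closed disc. -/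
lemma IsRiemannPair.exists_extension (hC : IsCircle C)
    (hBb : Bornology.IsBounded (connectedComponentIn Cᶜ 0))
    (h : IsRiemannPair (connectedComponentIn Cᶜ 0) f G) :
    ∃ F : ℂ → ℂ, ContinuousOn F (Metric.closedBall 0 1) ∧ EqOn F G (Metric.ball 0 1) ∧
      MapsTo F (Metric.sphere 0 1) C := by
  set B := connectedComponentIn Cᶜ 0 with hB
  have hCc : IsCompact C := isCircle_isCompact hC
  have hBo : IsOpen B := hCc.isClosed.isOpen_compl.connectedComponentIn
  have hcl : closure (Metric.ball (0 : ℂ) 1) = Metric.closedBall 0 1 := closure_ball _ one_ne_zero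
  have hlim : ∀ ζ ∈ Metric.closedBall (0 : ℂ) 1, 
      ∃ y, Filter.Tendsto G (𝓝[Metric.ball 0 1] ζ) (𝓝 y) := by
    intro ζ hζ
    rcases (mem_closedBall_zero_iff.1 hζ).lt_or_eq with h1 | h1
    · exact ⟨G ζ, h.differentiableOn.continuousOn ζ (mem_ball_zero_iff.2 h1)⟩
    · have : (𝓝[Metric.ball 0 1] ζ).NeBot := mem_closure_iff_nhdsWithin_neBot.1 (hcl ▸ hζ)
      refine CompleteSpace.complete (Metric.cauchy_iff.2 ⟨inferInstance, fun ε hε => ?_⟩)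
      obtain ⟨r, hr, hG⟩ := h.exists_small_image hC hBb h1 (half_pos hε)
      refine ⟨G '' (Metric.ball 0 1 ∩ Metric.ball ζ r), Filter.image_mem_map
        (Filter.inter_mem self_mem_nhdsWithin
          (mem_nhdsWithin_of_mem_nhds (Metric.ball_mem_nhds ζ hr))), ?_⟩
      rintro _ ⟨z, hz, rfl⟩ _ ⟨w, hw, rfl⟩
      linarith [hG z hz w hw]
  refine ⟨extendFrom (Metric.ball 0 1) G, continuousOn_extendFrom hcl.ge hlim, fun ζ hζ => ?_,
    fun ζ hζ => ?_⟩
  · exact extendFrom_eq (subset_closure hζ) (h.differentiableOn.continuousOn ζ hζ)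
  · have hζc : ζ ∈ Metric.closedBall (0 : ℂ) 1 := Metric.sphere_subset_closedBall hζ
    have : (𝓝[Metric.ball 0 1] ζ).NeBot := mem_closure_iff_nhdsWithin_neBot.1 (hcl ▸ hζc)
    obtain ⟨y, hy⟩ := hlim ζ hζc
    rw [extendFrom_eq (hcl.ge hζc) hy]
    have hev : ∀ᶠ z in 𝓝[Metric.ball 0 1] ζ, z ∈ Metric.ball (0 : ℂ) 1 := self_mem_nhdsWithin
    have hycl : y ∈ closure B := mem_closure_of_tendsto hy (hev.mono fun z hz => h.mapsTo' hz)
    refine (closure_component_subset hCc.isClosed 0 hycl).resolve_left fun hyB => ?_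
    have h1 : Filter.Tendsto (fun z => f (G z)) (𝓝[Metric.ball 0 1] ζ) (𝓝 (f y)) :=
      (h.continuousOn.continuousAt (hBo.mem_nhds hyB)).tendsto.comp hy
    have h2 : Filter.Tendsto (fun z => f (G z)) (𝓝[Metric.ball 0 1] ζ) (𝓝 ζ) :=
      (Filter.tendsto_id'.2 nhdsWithin_le_nhds).congr'
        (hev.mono fun z hz => (h.right_inv z hz).symm)
    have h3 := h.mapsTo hyB
    rw [tendsto_nhds_unique h1 h2, mem_ball_zero_iff, mem_sphere_zero_iff_norm.1 hζ] at h3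
    exact lt_irrefl _ h3

/-- The boundary extension of the Riemann map is injective on the unit circle. -/
lemma IsRiemannPair.injOn_sphere (hC : IsCircle C)
    (h : IsRiemannPair (connectedComponentIn Cᶜ 0) f G) {F : ℂ → ℂ}
    (hF : ContinuousOn F (Metric.closedBall 0 1)) (hFG : EqOn F G (Metric.ball 0 1))
    (hFC : MapsTo F (Metric.sphere 0 1) C) : InjOn F (Metric.sphere 0 1) := by
  set B := connectedComponentIn Cᶜ 0 with hB
  have hCc : IsCompact C := isCircle_isCompact hC
  have hcl : closure (Metric.ball (0 : ℂ) 1) = Metric.closedBall 0 1 := closure_ball _ one_ne_zero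
  have hBC : ∀ z ∈ B, z ∉ C := fun z hz => connectedComponentIn_subset _ _ hz
  intro ζ₁ hζ₁ ζ₂ hζ₂ heq
  by_contra hne
  have hn₁ := mem_sphere_zero_iff_norm.1 hζ₁
  have hn₂ := mem_sphere_zero_iff_norm.1 hζ₂
  have hζ0 : ζ₁ ≠ 0 := norm_pos_iff.1 (by rw [hn₁]; exact one_pos)
  set p := F ζ₁ with hp
  set R : Set ℂ := (fun t : ℝ => (t : ℂ) * ζ₁) '' Icc 0 1 ∪ (fun t : ℝ => (t : ℂ) * ζ₂) '' Icc 0 1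
    with hR
  have hRc : IsCompact R :=
    (isCompact_Icc.image (by fun_prop)).union (isCompact_Icc.image (by fun_prop))
  have hray : ∀ ζ : ℂ, ‖ζ‖ = 1 → ∀ t ∈ Icc (0 : ℝ) 1, ‖(t : ℂ) * ζ‖ = t := fun ζ hζ t ht => by
    rw [norm_mul, hζ, mul_one, Complex.norm_real, Real.norm_of_nonneg ht.1]
  have hRb : R ⊆ Metric.closedBall 0 1 := by
    rintro _ (⟨t, ht, rfl⟩ | ⟨t, ht, rfl⟩)
    · exact mem_closedBall_zero_iff.2 ((hray ζ₁ hn₁ t ht).trans_le ht.2)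
    · exact mem_closedBall_zero_iff.2 ((hray ζ₂ hn₂ t ht).trans_le ht.2)
  set Γ := F '' R with hΓ
  have hΓc : IsCompact Γ := hRc.image_of_continuousOn (hF.mono hRb)
  have hΓp : ∀ z ∈ R, F z ∈ C → F z = p := by
    have key : ∀ ζ : ℂ, ‖ζ‖ = 1 → F ζ = p → ∀ t ∈ Icc (0 : ℝ) 1, F (t * ζ) ∈ C → F (t * ζ) = p := by
      intro ζ hζ hζp t ht hz
      rcases ht.2.lt_or_eq with h1 | h1
      · have h2 : (t : ℂ) * ζ ∈ Metric.ball (0 : ℂ) 1 :=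
          mem_ball_zero_iff.2 (by rw [hray ζ hζ t ht]; exact h1)
        rw [hFG h2] at hz
        exact absurd hz (hBC _ (h.mapsTo' h2))
      · rw [h1, Complex.ofReal_one, one_mul, hζp]
    rintro _ (⟨t, ht, rfl⟩ | ⟨t, ht, rfl⟩)
    · exact key ζ₁ hn₁ rfl t ht
    · exact key ζ₂ hn₂ heq.symm t ht
  have hpC : p ∈ C := hFC hζ₁
  have hCΓ : C ∩ Γ = {p} := by
    refine Subset.antisymm ?_ ?_
    · rintro _ ⟨hz, ⟨z, hzR, rfl⟩⟩
      exact hΓp z hzR hz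
    · rintro _ rfl
      exact ⟨hpC, ζ₁, Or.inl ⟨1, by simp, by simp⟩, rfl⟩
  set θ : ℂ → ℝ := fun z => Complex.arg (-z / ζ₁) with hθ
  have hslit : ∀ z : ℂ, -z / ζ₁ ∉ Complex.slitPlane → z = ‖z‖ * ζ₁ := by
    intro z hz
    rw [Complex.mem_slitPlane_iff_arg, not_and_or, not_not, not_not] at hz
    rcases hz with hz | hz
    · have h1 := Complex.norm_mul_exp_arg_mul_I (-z / ζ₁)
      rw [hz, Complex.exp_pi_mul_I, norm_div, norm_neg, hn₁, div_one, eq_div_iff hζ0] at h1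
      linear_combination h1
    · rw [div_eq_zero_iff, neg_eq_zero, or_iff_left hζ0] at hz
      simp [hz]
  have hθc : ∀ z : ℂ, -z / ζ₁ ∈ Complex.slitPlane → ContinuousAt θ z := fun z hz =>
    (Complex.continuousAt_arg hz).comp (f := fun z => -z / ζ₁) (by fun_prop)
  have hlev : ∀ z : ℂ, θ z = θ ζ₂ → z = ‖z‖ * ζ₂ := by
    intro z hz
    have h1 := Complex.norm_mul_exp_arg_mul_I (-z / ζ₁)
    have h2 := Complex.norm_mul_exp_arg_mul_I (-ζ₂ / ζ₁)
    simp only [hθ] at hz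
    rw [norm_div, norm_neg, hn₁, hn₂, div_one, Complex.ofReal_one, one_mul] at h2
    rw [hz, h2, norm_div, norm_neg, hn₁, div_one] at h1
    field_simp at h1
    linear_combination h1
  have hζ₂s : -ζ₂ / ζ₁ ∈ Complex.slitPlane := by
    by_contra hs
    have := hslit ζ₂ hs
    rw [hn₂, Complex.ofReal_one, one_mul] at this
    exact hne this.symm
  have hpt : ∀ t : ℝ, t ∈ Ioo (-Real.pi) Real.pi →
      ‖-ζ₁ * Complex.exp (t * Complex.I)‖ = 1 ∧ θ (-ζ₁ * Complex.exp (t * Complex.I)) = t := by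
    intro t ht
    refine ⟨by rw [norm_mul, norm_neg, hn₁, Complex.norm_exp_ofReal_mul_I, one_mul], ?_⟩
    have h1 : -(-ζ₁ * Complex.exp (t * Complex.I)) / ζ₁ = Complex.exp (t * Complex.I) := by
      field_simp
    simp only [hθ]
    rw [h1, Complex.exp_mul_I, Complex.arg_cos_add_sin_mul_I ⟨ht.1, ht.2.le⟩]
  have hβ1 : -Real.pi < θ ζ₂ := Complex.neg_pi_lt_arg _
  have hβ2 : θ ζ₂ < Real.pi :=
    (Complex.arg_le_pi _).lt_of_ne (Complex.slitPlane_arg_ne_pi hζ₂s)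
  have hside : (∀ z, -z / ζ₁ ∈ Complex.slitPlane → θ z < θ ζ₂ → ‖z‖ = 1 → F z = p) ∨
      ∀ z, -z / ζ₁ ∈ Complex.slitPlane → θ ζ₂ < θ z → ‖z‖ = 1 → F z = p := by
    by_contra! hcon
    obtain ⟨⟨η₁, hs₁, hlt₁, hη₁, hF₁⟩, η₂, hs₂, hlt₂, hη₂, hF₂⟩ := hcon
    set O := connectedComponentIn Γᶜ (F η₁) with hO
    have hOo : IsOpen O := hΓc.isClosed.isOpen_compl.connectedComponentIn
    have hm₁ : F η₁ ∈ C \ {p} := ⟨hFC (mem_sphere_zero_iff_norm.2 hη₁), hF₁⟩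
    have hm₂ : F η₂ ∈ C \ {p} := ⟨hFC (mem_sphere_zero_iff_norm.2 hη₂), hF₂⟩
    have hsubO : C \ {p} ⊆ O :=
      (isPreconnected_sdiff_singleton_of_isCircle hC p).subset_connectedComponentIn hm₁
        fun x hx hxΓ => hx.2 (hCΓ.subset ⟨hx.1, hxΓ⟩)
    have hnear : ∀ η : ℂ, ‖η‖ = 1 → F η ∈ O → ∀ U : Set ℂ, U ∈ 𝓝 η →
        ∃ z ∈ Metric.ball (0 : ℂ) 1, z ∈ U ∧ G z ∈ O := by
      intro η hη hηO U hU
      have hηc : η ∈ Metric.closedBall (0 : ℂ) 1 := mem_closedBall_zero_iff.2 hη.le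
      have : (𝓝[Metric.ball 0 1] η).NeBot := mem_closure_iff_nhdsWithin_neBot.1 (hcl ▸ hηc)
      have h1 : F ⁻¹' O ∈ 𝓝[Metric.ball 0 1] η :=
        (hF η hηc).mono Metric.ball_subset_closedBall (hOo.mem_nhds hηO)
      obtain ⟨z, ⟨hz1, hz2⟩, hz3⟩ := Filter.nonempty_of_mem
        (Filter.inter_mem (Filter.inter_mem h1 (mem_nhdsWithin_of_mem_nhds hU)) self_mem_nhdsWithin)
      exact ⟨z, hz3, hz2, by rw [← hFG hz3]; exact hz1⟩
    obtain ⟨z₁, hz₁, hθ₁, hG₁⟩ := hnear η₁ hη₁ (hsubO hm₁) {z | θ z < θ ζ₂}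
      ((hθc η₁ hs₁).eventually_lt continuousAt_const hlt₁)
    obtain ⟨z₂, hz₂, hθ₂, hG₂⟩ := hnear η₂ hη₂ (hsubO hm₂) {z | θ ζ₂ < θ z}
      (continuousAt_const.eventually_lt (hθc η₂ hs₂) hlt₂)
    have hJ := janiszewski hCc hΓc (by rw [hCΓ]; exact isPreconnected_singleton)
      (a := G z₁) (b := G z₂)
      (by rw [← connectedComponentIn_eq (h.mapsTo' hz₁)]; exact h.mapsTo' hz₂)
      (by rw [← connectedComponentIn_eq hG₁]; exact hG₂)
    set W := connectedComponentIn (C ∪ Γ)ᶜ (G z₁) with hW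
    have hWB : W ⊆ B := by
      rw [hB, connectedComponentIn_eq (h.mapsTo' hz₁)]
      exact connectedComponentIn_mono _ (compl_subset_compl.2 subset_union_left)
    have hWT : W ⊆ (C ∪ Γ)ᶜ := connectedComponentIn_subset _ _
    have hW₁ : G z₁ ∈ W := by
      by_contra h0
      rw [hW, connectedComponentIn_eq_empty fun h1 => h0 (mem_connectedComponentIn h1)] at hJ
      exact hJ
    have havoid : ∀ w ∈ W, f w ∉ R := fun w hw hfw => hWT hw (Or.inr ⟨f w, hfw, by
      rw [hFG (h.mapsTo (hWB hw)), h.left_inv w (hWB hw)]⟩)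
    have hunit : ∀ w ∈ W, ‖f w‖ ∈ Icc (0 : ℝ) 1 := fun w hw =>
      ⟨norm_nonneg _, (mem_ball_zero_iff.1 (h.mapsTo (hWB hw))).le⟩
    have hcont : ContinuousOn (fun w => θ (f w)) W := by
      intro w hw
      refine ContinuousAt.comp_continuousWithinAt (g := θ) (hθc _ ?_)
        (h.continuousOn.mono hWB w hw)
      by_contra hs
      exact havoid w hw (Or.inl ⟨‖f w‖, hunit w hw, (hslit _ hs).symm⟩)
    have hpre : IsPreconnected ((fun w => θ (f w)) '' W) :=
      isPreconnected_connectedComponentIn.image _ hcont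
    obtain ⟨w, hwW, hwθ⟩ : θ ζ₂ ∈ (fun w => θ (f w)) '' W := by
      refine hpre.Icc_subset ⟨G z₁, hW₁, rfl⟩ ⟨G z₂, hJ, rfl⟩ ⟨?_, ?_⟩
      · simp only
        rw [h.right_inv z₁ hz₁]
        exact le_of_lt hθ₁
      · simp only
        rw [h.right_inv z₂ hz₂]
        exact le_of_lt hθ₂
    exact havoid w hwW (Or.inr ⟨‖f w‖, hunit w hwW, (hlev _ hwθ).symm⟩)
  have hpF : F 0 = p := by
    have hFd : DifferentiableOn ℂ F (Metric.ball 0 1) := h.differentiableOn.congr hFG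
    have hθ' : ContinuousOn θ {z | -z / ζ₁ ∈ Complex.slitPlane} := fun z hz =>
      (hθc z hz).continuousWithinAt
    have hso : IsOpen {z | -z / ζ₁ ∈ Complex.slitPlane} :=
      Complex.isOpen_slitPlane.preimage (by fun_prop)
    have hsl : ∀ t ∈ Ioo (-Real.pi) Real.pi,
        -(-ζ₁ * Complex.exp (t * Complex.I)) / ζ₁ ∈ Complex.slitPlane := by
      intro t ht
      refine Complex.mem_slitPlane_iff_arg.2 ⟨?_, ?_⟩
      · have : Complex.arg (-(-ζ₁ * Complex.exp (t * Complex.I)) / ζ₁) = t := (hpt t ht).2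
        rw [this]
        exact ht.2.ne
      · simp [hζ0]
    rcases hside with hs | hs
    · have ht : (θ ζ₂ - Real.pi) / 2 ∈ Ioo (-Real.pi) Real.pi := ⟨by linarith, by linarith⟩
      exact eq_of_boundary_const_on_arc hF hFd (hθ'.isOpen_inter_preimage hso isOpen_Iio)
        ⟨hsl _ ht, show θ _ < θ ζ₂ by rw [(hpt _ ht).2]; linarith⟩ (hpt _ ht).1
        fun z hz => hs z hz.1 hz.2
    · have ht : (θ ζ₂ + Real.pi) / 2 ∈ Ioo (-Real.pi) Real.pi := ⟨by linarith, by linarith⟩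
      exact eq_of_boundary_const_on_arc hF hFd (hθ'.isOpen_inter_preimage hso isOpen_Ioi)
        ⟨hsl _ ht, show θ ζ₂ < θ _ by rw [(hpt _ ht).2]; linarith⟩ (hpt _ ht).1
        fun z hz => hs z hz.1 hz.2
  rw [hFG (by simp), h.map_zero] at hpF
  exact hBC _ h.zero_mem (hpF ▸ hpC)

/-- **Carathéodory's theorem**: the Riemann map onto the bounded complementary domain of a circle
extends to an injective continuous map on the closed disc. -/
theorem IsRiemannPair.caratheodory (hC : IsCircle C)
    (hBb : Bornology.IsBounded (connectedComponentIn Cᶜ 0))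
    (h : IsRiemannPair (connectedComponentIn Cᶜ 0) f G) :
    ∃ F : ℂ → ℂ, ContinuousOn F (Metric.closedBall 0 1) ∧ EqOn F G (Metric.ball 0 1) ∧
      InjOn F (Metric.closedBall 0 1) ∧ F '' Metric.sphere 0 1 = C := by
  obtain ⟨F, hF, hFG, hFC⟩ := h.exists_extension hC hBb
  have hinj := h.injOn_sphere hC hF hFG hFC
  have hBC : ∀ z ∈ Metric.ball (0 : ℂ) 1, F z ∉ C := fun z hz => by
    rw [hFG hz]
    exact connectedComponentIn_subset _ _ (h.mapsTo' hz)
  refine ⟨F, hF, hFG, fun z hz w hw hzw => ?_, ?_⟩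
  · rw [← Metric.ball_union_sphere] at hz hw
    rcases hz with hz | hz <;> rcases hw with hw | hw
    · rw [hFG hz, hFG hw] at hzw
      exact h.injOn hz hw hzw
    · exact absurd (hzw ▸ hFC hw) (hBC z hz)
    · exact absurd (hzw ▸ hFC hz) (hBC w hw)
    · exact hinj hz hw hzw
  · have hsph : IsCircle (Metric.sphere (0 : ℂ) 1) := by
      have : range ((↑) : Circle → ℂ) = Metric.sphere 0 1 := Subtype.range_coe
      rw [← this]
      exact isCircle_range continuous_subtype_val Subtype.val_injective
    exact isCircle_eq_of_subset
      (isCircle_image hsph (hF.mono Metric.sphere_subset_closedBall) hinj) hC hFC.image_subset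

end Caratheodory

lemma image_ball_subset_of_eqOn_sphere {P F : ℂ → ℂ} {ε : ℝ} (hε : 0 < ε)
    (hP : ContinuousOn P (Metric.closedBall 0 ε)) (hF : ContinuousOn F (Metric.closedBall 0 ε))
    (hPi : InjOn P (Metric.closedBall 0 ε)) (heq : EqOn P F (Metric.sphere 0 ε)) (h0 : P 0 = F 0)
    (ho : IsOpen (F '' Metric.ball 0 ε)) : P '' Metric.ball 0 ε ⊆ F '' Metric.ball 0 ε := by
  have hcon : IsPreconnected (P '' Metric.ball 0 ε) :=
    (convex_ball (0 : ℂ) ε).isPreconnected.image _ (hP.mono Metric.ball_subset_closedBall)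
  refine hcon.subset_of_closure_inter_subset ho
    ⟨P 0, ⟨0, Metric.mem_ball_self hε, rfl⟩, 0, Metric.mem_ball_self hε, h0.symm⟩ ?_
  have hcl : closure (F '' Metric.ball 0 ε) ⊆ F '' Metric.closedBall 0 ε :=
    closure_minimal (image_mono Metric.ball_subset_closedBall)
      ((isCompact_closedBall 0 ε).image_of_continuousOn hF).isClosed
  rintro _ ⟨hx, ⟨w, hw, rfl⟩⟩
  obtain ⟨z, hz, hzw⟩ := hcl hx
  rw [← Metric.ball_union_sphere] at hz
  rcases hz with hz | hz
  · exact ⟨z, hz, hzw⟩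
  · rw [← heq hz] at hzw
    have h1 := hPi (Metric.sphere_subset_closedBall hz) (Metric.ball_subset_closedBall hw) hzw
    rw [h1, mem_sphere_zero_iff_norm] at hz
    exact absurd (mem_ball_zero_iff.1 hw) hz.not_lt

/-- A radial cutoff function, vanishing for `‖w‖ ≤ ε / 2` and equal to one for `ε ≤ ‖w‖`. -/
noncomputable def cutoff (ε : ℝ) (w : ℂ) : ℝ := max 0 (min 1 (2 * ‖w‖ / ε - 1))

lemma continuous_cutoff (ε : ℝ) : Continuous (cutoff ε) := by
  unfold cutoff
  fun_prop

lemma cutoff_eq_zero {ε : ℝ} (hε : 0 < ε) {w : ℂ} (hw : ‖w‖ ≤ ε / 2) : cutoff ε w = 0 := by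
  have : 2 * ‖w‖ / ε ≤ 1 := by rw [div_le_one hε]; linarith
  exact max_eq_left ((min_le_right _ _).trans (by linarith))

lemma cutoff_eq_one {ε : ℝ} (hε : 0 < ε) {w : ℂ} (hw : ε ≤ ‖w‖) : cutoff ε w = 1 := by
  have : 2 ≤ 2 * ‖w‖ / ε := by rw [le_div_iff₀ hε]; linarith
  rw [cutoff, min_eq_left (by linarith), max_eq_right zero_le_one]

lemma abs_cutoff_le (ε : ℝ) (w : ℂ) : |cutoff ε w| ≤ 1 := by
  rw [abs_of_nonneg (le_max_left _ _)]
  exact max_le zero_le_one (min_le_left _ _)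

lemma abs_cutoff_sub_le {ε : ℝ} (hε : 0 < ε) (z w : ℂ) :
    |cutoff ε z - cutoff ε w| ≤ 2 / ε * ‖z - w‖ := by
  have h1 : |cutoff ε z - cutoff ε w| ≤ |(2 * ‖z‖ / ε - 1) - (2 * ‖w‖ / ε - 1)| := by
    refine (abs_max_sub_max_le_max _ _ _ _).trans (max_le (by simp) ?_)
    exact (abs_min_sub_min_le_max _ _ _ _).trans (max_le (by simp) le_rfl)
  have h2 : (2 * ‖z‖ / ε - 1) - (2 * ‖w‖ / ε - 1) = 2 / ε * (‖z‖ - ‖w‖) := by ring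
  rw [h2, abs_mul, abs_of_pos (by positivity : 0 < 2 / ε)] at h1
  exact h1.trans (mul_le_mul_of_nonneg_left (abs_norm_sub_norm_le z w) (by positivity))

lemma norm_cutoff_mul_sub_le {e : ℂ → ℂ} {ε c : ℝ} (hε : 0 < ε) (hc : 0 ≤ c) (h0 : e 0 = 0)
    (he : ∀ z ∈ Metric.closedBall (0 : ℂ) ε, ∀ w ∈ Metric.closedBall (0 : ℂ) ε,
      ‖e z - e w‖ ≤ c * ‖z - w‖) {z w : ℂ} (hz : z ∈ Metric.closedBall (0 : ℂ) ε)
    (hw : w ∈ Metric.closedBall (0 : ℂ) ε) :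
    ‖cutoff ε z * e z - cutoff ε w * e w‖ ≤ 3 * c * ‖z - w‖ := by
  have h1 : (cutoff ε z : ℂ) * e z - cutoff ε w * e w =
      cutoff ε z * (e z - e w) + ((cutoff ε z - cutoff ε w : ℝ) : ℂ) * e w := by
    push_cast
    ring
  have h2 : ‖e w‖ ≤ c * ε := by
    have := he w hw 0 (Metric.mem_closedBall_self hε.le)
    rw [h0, sub_zero, sub_zero] at this
    exact this.trans (mul_le_mul_of_nonneg_left (mem_closedBall_zero_iff.1 hw) hc)
  rw [h1]
  refine (norm_add_le _ _).trans ?_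
  rw [norm_mul, norm_mul, Complex.norm_real, Complex.norm_real, Real.norm_eq_abs, Real.norm_eq_abs]
  have h3 : |cutoff ε z| * ‖e z - e w‖ ≤ 1 * (c * ‖z - w‖) :=
    mul_le_mul (abs_cutoff_le ε z) (he z hz w hw) (norm_nonneg _) zero_le_one
  have h4 : |cutoff ε z - cutoff ε w| * ‖e w‖ ≤ 2 / ε * ‖z - w‖ * (c * ε) :=
    mul_le_mul (abs_cutoff_sub_le hε z w) h2 (norm_nonneg _) (by positivity)
  have h5 : 2 / ε * ‖z - w‖ * (c * ε) = 2 * c * ‖z - w‖ := by field_simp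
  linarith

/-- The boundary extension of the Riemann map can be modified near the origin so as to become
linear there. -/
lemma exists_linear_near_zero {F : ℂ → ℂ} (hF : ContinuousOn F (Metric.closedBall 0 1))
    (hFd : DifferentiableOn ℂ F (Metric.ball 0 1)) (hFi : InjOn F (Metric.closedBall 0 1))
    (hFo : ∀ ε < 1, IsOpen (F '' Metric.ball 0 ε)) (h0 : F 0 = 0) (hb : deriv F 0 ≠ 0) :
    ∃ (P : ℂ → ℂ) (b : ℂ) (ρ : ℝ), 0 < ρ ∧ ρ < 1 ∧ b ≠ 0 ∧ ‖b‖ * ρ < 1 ∧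
      ContinuousOn P (Metric.closedBall 0 1) ∧ InjOn P (Metric.closedBall 0 1) ∧
      EqOn P F (Metric.sphere 0 1) ∧ P '' Metric.ball 0 1 = F '' Metric.ball 0 1 ∧
      ∀ w : ℂ, ‖w‖ ≤ ρ → P w = b * w := by
  set b := deriv F 0 with hbdef
  have hbpos : 0 < ‖b‖ := norm_pos_iff.2 hb
  set c : NNReal := ‖b‖₊ / 6 with hc
  have hcr : (c : ℝ) = ‖b‖ / 6 := by rw [hc]; simp
  have hstrict : HasStrictDerivAt F b 0 :=
    (hFd.analyticAt (Metric.ball_mem_nhds 0 one_pos)).hasStrictDerivAt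
  obtain ⟨s, hs, happ⟩ := hstrict.hasStrictFDerivAt.approximates_deriv_on_nhds (c := c)
    (Or.inr (by rw [← NNReal.coe_pos, hcr]; positivity))
  obtain ⟨ε₀, hε₀, hsub⟩ := Metric.mem_nhds_iff.1 hs
  obtain ⟨ε, hεpos, hε⟩ : ∃ ε > 0, ε < min ε₀ (min 1 (1 / ‖b‖)) :=
    exists_between (by positivity)
  have hεs : ε < ε₀ := hε.trans_le (min_le_left _ _)
  have hε1 : ε < 1 := hε.trans_le ((min_le_right _ _).trans (min_le_left _ _))
  have hεb : ‖b‖ * ε < 1 := by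
    rw [mul_comm, ← lt_div_iff₀ hbpos]
    exact hε.trans_le ((min_le_right _ _).trans (min_le_right _ _))
  set e : ℂ → ℂ := fun w => F w - b * w with he
  have he0 : e 0 = 0 := by simp [he, h0]
  have hel : ∀ z ∈ Metric.closedBall (0 : ℂ) ε, ∀ w ∈ Metric.closedBall (0 : ℂ) ε,
      ‖e z - e w‖ ≤ c * ‖z - w‖ := by
    intro z hz w hw
    have h1 := happ z (hsub (Metric.closedBall_subset_ball hεs hz)) w
      (hsub (Metric.closedBall_subset_ball hεs hw))
    have h2 : e z - e w = F z - F w - ContinuousLinearMap.toSpanSingleton ℂ b (z - w) := by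
      rw [ContinuousLinearMap.toSpanSingleton_apply, smul_eq_mul]
      simp only [he]
      ring
    rw [h2]
    exact h1
  set P : ℂ → ℂ := fun w => F w - (1 - cutoff ε w) * e w with hP
  have hPe : ∀ w, P w = b * w + cutoff ε w * e w := fun w => by
    simp only [hP, he]
    ring
  have hPF : ∀ w, ε ≤ ‖w‖ → P w = F w := fun w hw => by
    simp [hP, cutoff_eq_one hεpos hw]
  have hPc : ContinuousOn P (Metric.closedBall 0 1) := by
    have h1 : ContinuousOn (fun w : ℂ => 1 - (cutoff ε w : ℂ)) (Metric.closedBall 0 1) :=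
      (continuous_const.sub (Complex.continuous_ofReal.comp (continuous_cutoff ε))).continuousOn
    exact hF.sub (h1.mul (hF.sub (by fun_prop)))
  have hPl : ∀ z ∈ Metric.closedBall (0 : ℂ) ε, ∀ w ∈ Metric.closedBall (0 : ℂ) ε,
      ‖P z - P w - b * (z - w)‖ ≤ ‖b‖ / 2 * ‖z - w‖ := by
    intro z hz w hw
    have h1 := norm_cutoff_mul_sub_le hεpos c.2 he0 hel hz hw
    have h2 : P z - P w - b * (z - w) = cutoff ε z * e z - cutoff ε w * e w := by
      rw [hPe, hPe]
      ring
    rw [h2]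
    refine h1.trans (le_of_eq ?_)
    change 3 * (c : ℝ) * _ = _
    rw [hcr]
    ring
  have hPiε : InjOn P (Metric.closedBall 0 ε) := by
    intro z hz w hw hzw
    have h1 := hPl z hz w hw
    rw [hzw, sub_self, zero_sub, norm_neg, norm_mul] at h1
    have h2 : ‖z - w‖ = 0 := by
      by_contra h3
      have h4 : 0 < ‖z - w‖ := lt_of_le_of_ne (norm_nonneg _) (Ne.symm h3)
      nlinarith [mul_pos hbpos h4]
    exact sub_eq_zero.1 (norm_eq_zero.1 h2)
  have hPo : IsOpen (P '' Metric.ball 0 ε) := by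
    have happP : ApproximatesLinearOn P (ContinuousLinearMap.mul ℂ ℂ b) (Metric.ball 0 ε)
        (‖b‖₊ / 2) := fun z hz w hw => by
      have := hPl z (Metric.ball_subset_closedBall hz) w (Metric.ball_subset_closedBall hw)
      simpa using this
    refine happP.open_image
      { toFun := fun y => b⁻¹ * y
        nnnorm := ‖b‖₊⁻¹
        bound' := fun y => by simp
        right_inv' := fun y => by simp [hb] } Metric.isOpen_ball (Or.inr ?_)
    rw [inv_inv]
    exact half_lt_self (by simpa using hb)
  have hsubε : Metric.closedBall (0 : ℂ) ε ⊆ Metric.closedBall 0 1 :=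
    Metric.closedBall_subset_closedBall hε1.le
  have hsph : EqOn P F (Metric.sphere 0 ε) := fun w hw =>
    hPF w (mem_sphere_zero_iff_norm.1 hw).ge
  have hP0 : P 0 = F 0 := by rw [hPe, he0, h0]; simp
  have hPFball : P '' Metric.ball 0 ε = F '' Metric.ball 0 ε :=
    (image_ball_subset_of_eqOn_sphere hεpos (hPc.mono hsubε) (hF.mono hsubε) hPiε hsph hP0
      (hFo ε hε1)).antisymm
    (image_ball_subset_of_eqOn_sphere hεpos (hF.mono hsubε) (hPc.mono hsubε) (hFi.mono hsubε)
      hsph.symm hP0.symm hPo)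
  have hsep : ∀ z ∈ Metric.ball (0 : ℂ) ε, ∀ w ∈ Metric.closedBall (0 : ℂ) 1, ε ≤ ‖w‖ →
      P z ≠ P w := by
    intro z hz w hw hwε hzw
    obtain ⟨z', hz', hzz⟩ := hPFball.subset ⟨z, hz, rfl⟩
    rw [hzw, hPF w hwε] at hzz
    have h1 := hFi (hsubε (Metric.ball_subset_closedBall hz')) hw hzz
    rw [h1, mem_ball_zero_iff] at hz'
    exact absurd hz' hwε.not_gt
  refine ⟨P, b, ε / 2, by positivity, by linarith, hb, by nlinarith, hPc, ?_, ?_, ?_, ?_⟩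
  · intro z hz w hw hzw
    rcases lt_or_ge ‖z‖ ε with h1 | h1 <;> rcases lt_or_ge ‖w‖ ε with h2 | h2
    · exact hPiε (mem_closedBall_zero_iff.2 h1.le) (mem_closedBall_zero_iff.2 h2.le) hzw
    · exact absurd hzw (hsep z (mem_ball_zero_iff.2 h1) w hw h2)
    · exact absurd hzw.symm (hsep w (mem_ball_zero_iff.2 h2) z hz h1)
    · rw [hPF z h1, hPF w h2] at hzw
      exact hFi hz hw hzw
  · exact fun w hw => hPF w (by rw [mem_sphere_zero_iff_norm.1 hw]; exact hε1.le)
  · have hspl : Metric.ball (0 : ℂ) 1 = Metric.ball 0 ε ∪ Metric.ball 0 1 ∩ {w | ε ≤ ‖w‖} := by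
      ext w
      simp only [mem_union, mem_inter_iff, mem_ball_zero_iff, mem_ofPred_eq]
      constructor
      · exact fun h => (lt_or_ge ‖w‖ ε).imp id fun h' => ⟨h, h'⟩
      · rintro (h | h)
        · exact h.trans hε1
        · exact h.1
    rw [hspl, image_union, image_union, hPFball, image_congr fun w hw => hPF w hw.2]
  · intro w hw
    rw [hPe, cutoff_eq_zero hεpos hw]
    simp

/-- A radial map pushing the circle of radius `r < 1` to the unit circle, and fixing all points of
norm at least `1 + δ`. -/
lemma exists_radial_push {r δ : ℝ} (hr : 0 < r) (hr1 : r < 1) (hδ : 0 < δ) :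
    ∃ Φ : ℂ → ℂ, ContinuousOn Φ {z | r ≤ ‖z‖} ∧ InjOn Φ {z | r ≤ ‖z‖} ∧
      (∀ z, 1 + δ ≤ ‖z‖ → Φ z = z) ∧ (∀ z, r ≤ ‖z‖ → 1 ≤ ‖Φ z‖) ∧
      (∀ z, r ≤ ‖z‖ → (‖Φ z‖ = 1 ↔ ‖z‖ = r)) ∧
      (∀ z, r ≤ ‖z‖ → ‖z‖ ≤ 1 + δ → ‖Φ z‖ ≤ 1 + δ) ∧
      ∀ y, 1 ≤ ‖y‖ → ‖y‖ ≤ 1 + δ → ∃ z, r ≤ ‖z‖ ∧ ‖z‖ ≤ 1 + δ ∧ Φ z = y := by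
  set k := δ / (1 + δ - r) with hk
  have hden : 0 < 1 + δ - r := by linarith
  have hkpos : 0 < k := div_pos hδ hden
  have hk1 : k ≤ 1 := by rw [hk, div_le_one hden]; linarith
  have hkmul : (1 + δ - r) * k = δ := by rw [hk]; field_simp
  set φ : ℝ → ℝ := fun t => max t (1 + (t - r) * k) with hφ
  have hφm : StrictMono φ := fun s t hst =>
    max_lt_max hst (by nlinarith)
  have hφc : Continuous φ := by fun_prop
  have hφr : φ r = 1 := by simp [hφ, hr1.le]
  have hφδ : ∀ t, 1 + δ ≤ t → φ t = t := fun t ht => by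
    refine max_eq_left ?_
    nlinarith
  have hpos : ∀ z : ℂ, r ≤ ‖z‖ → 0 < ‖z‖ := fun z hz => hr.trans_le hz
  have hφ1 : ∀ z : ℂ, r ≤ ‖z‖ → 1 ≤ φ ‖z‖ := fun z hz => hφr ▸ hφm.monotone hz
  set Φ : ℂ → ℂ := fun z => ((φ ‖z‖ / ‖z‖ : ℝ) : ℂ) * z with hΦ
  have hn : ∀ z : ℂ, r ≤ ‖z‖ → ‖Φ z‖ = φ ‖z‖ := fun z hz => by
    rw [hΦ, norm_mul, Complex.norm_real, Real.norm_of_nonneg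
      (div_nonneg (zero_le_one.trans (hφ1 z hz)) (norm_nonneg _)),
      div_mul_cancel₀ _ (hpos z hz).ne']
  refine ⟨Φ, ?_, ?_, ?_, ?_, ?_, ?_, ?_⟩
  · refine ContinuousOn.mul (Complex.continuous_ofReal.comp_continuousOn ?_) continuousOn_id
    exact (hφc.comp continuous_norm).continuousOn.div continuous_norm.continuousOn
      fun z hz => (hpos z hz).ne'
  · intro z hz w hw hzw
    have h1 : φ ‖z‖ = φ ‖w‖ := by rw [← hn z hz, ← hn w hw, hzw]
    have h2 := hφm.injective h1
    simp only [hΦ] at hzw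
    rw [h2] at hzw
    refine mul_left_cancel₀ (Complex.ofReal_ne_zero.2 (div_pos ?_ (hpos w hw)).ne') hzw
    exact one_pos.trans_le (hφ1 w hw)
  · intro z hz
    simp only [hΦ]
    rw [hφδ _ hz, div_self (by linarith), Complex.ofReal_one, one_mul]
  · intro z hz
    rw [hn z hz]
    exact hφ1 z hz
  · intro z hz
    rw [hn z hz, ← hφr]
    exact hφm.injective.eq_iff
  · intro z hz hz'
    rw [hn z hz, ← hφδ (1 + δ) le_rfl]
    exact hφm.monotone hz'
  · intro y hy hy'
    obtain ⟨t, ht, hty⟩ := intermediate_value_Icc (show r ≤ 1 + δ by linarith) hφc.continuousOn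
      (show ‖y‖ ∈ Icc (φ r) (φ (1 + δ)) by rw [hφr, hφδ _ le_rfl]; exact ⟨hy, hy'⟩)
    have ht0 : 0 < t := hr.trans_le ht.1
    have hy0 : (‖y‖ : ℂ) ≠ 0 := Complex.ofReal_ne_zero.2 (by linarith)
    have hnz : ‖((t / ‖y‖ : ℝ) : ℂ) * y‖ = t := by
      rw [norm_mul, Complex.norm_real, Real.norm_of_nonneg (by positivity),
        div_mul_cancel₀ _ (by linarith)]
    refine ⟨((t / ‖y‖ : ℝ) : ℂ) * y, ht.1.trans hnz.ge, hnz.le.trans ht.2, ?_⟩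
    simp only [hΦ]
    rw [hnz, hty]
    have ht0' : (t : ℂ) ≠ 0 := Complex.ofReal_ne_zero.2 ht0.ne'
    push_cast
    field_simp

/-- The region between the unit circle and a circle surrounding it is an annulus. -/
theorem exists_annulus_param {C : Set ℂ} (hC : IsCircle C) {f G : ℂ → ℂ}
    (hBb : Bornology.IsBounded (connectedComponentIn Cᶜ 0))
    (h : IsRiemannPair (connectedComponentIn Cᶜ 0) f G)
    (hdisc : Metric.closedBall 0 1 ⊆ connectedComponentIn Cᶜ 0) :
    ∃ Q : Circle × Icc (0 : ℝ) 1 → ℂ, Continuous Q ∧ Function.Injective Q ∧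
      Q '' {p | (p.2 : ℝ) = 0} = {z | ‖z‖ = 1} ∧ Q '' {p | (p.2 : ℝ) = 1} = C ∧
      range Q = {z | 1 ≤ ‖z‖} ∩ (connectedComponentIn Cᶜ 0 ∪ C) := by
  set B := connectedComponentIn Cᶜ 0 with hB
  have hCc : IsCompact C := isCircle_isCompact hC
  have hBo : IsOpen B := hCc.isClosed.isOpen_compl.connectedComponentIn
  have hBC : ∀ z ∈ B, z ∉ C := fun z hz => connectedComponentIn_subset _ _ hz
  obtain ⟨δ, hδ, hδB⟩ := (isCompact_closedBall (0 : ℂ) 1).exists_cthickening_subset_open hBo hdisc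
  rw [cthickening_closedBall hδ.le zero_le_one, add_comm] at hδB
  have hCδ : ∀ z ∈ C, 1 + δ ≤ ‖z‖ := fun z hz => by
    by_contra! hlt
    exact hBC z (hδB (mem_closedBall_zero_iff.2 hlt.le)) hz
  obtain ⟨F, hF, hFG, hFi, hFC⟩ := h.caratheodory hC hBb
  have hGb : ∀ ε ≤ 1, G '' Metric.ball 0 ε = B ∩ f ⁻¹' Metric.ball 0 ε := by
    intro ε hε
    ext z
    constructor
    · rintro ⟨w, hw, rfl⟩
      have hw1 := Metric.ball_subset_ball hε hw
      exact ⟨h.mapsTo' hw1, by rw [mem_preimage, h.right_inv w hw1]; exact hw⟩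
    · rintro ⟨hz, hfz⟩
      exact ⟨f z, hfz, h.left_inv z hz⟩
  have hFGb : ∀ ε ≤ 1, F '' Metric.ball 0 ε = B ∩ f ⁻¹' Metric.ball 0 ε := fun ε hε => by
    rw [← hGb ε hε]
    exact image_congr fun w hw => hFG (Metric.ball_subset_ball hε hw)
  have hFB : F '' Metric.ball 0 1 = B := by
    rw [hFGb 1 le_rfl]
    exact inter_eq_left.2 h.mapsTo
  obtain ⟨P, b, ρ, hρ, hρ1, hb, hbρ, hP, hPi, hPC, hPB, hPl⟩ := exists_linear_near_zero hF
    (h.differentiableOn.congr hFG) hFi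
    (fun ε hε => by
      rw [hFGb ε hε.le]
      exact h.continuousOn.isOpen_inter_preimage hBo Metric.isOpen_ball)
    (by rw [hFG (by simp), h.map_zero])
    (by
      rw [Filter.EventuallyEq.deriv_eq
        (Filter.eventuallyEq_of_mem (Metric.ball_mem_nhds 0 one_pos) hFG)]
      exact h.deriv_ne_zero)
  have hbpos : 0 < ‖b‖ := norm_pos_iff.2 hb
  have hr0 : 0 < ‖b‖ * ρ := mul_pos hbpos hρ
  have hPC' : P '' Metric.sphere 0 1 = C := by rw [hPC.image_eq, hFC]
  have hPBC : P '' Metric.closedBall 0 1 = B ∪ C := by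
    rw [← Metric.ball_union_sphere, image_union, hPC', hPB, hFB]
  have hPle : ∀ w ∈ Metric.closedBall (0 : ℂ) 1, ‖P w‖ ≤ ‖b‖ * ρ →
      w = P w / b ∧ ‖P w‖ = ‖b‖ * ‖w‖ := by
    intro w hw hle
    have h1 : ‖P w / b‖ ≤ ρ := by
      rw [norm_div, div_le_iff₀ hbpos, mul_comm]
      exact hle
    have h2 : P (P w / b) = P w := by rw [hPl _ h1, mul_div_cancel₀ _ hb]
    have h3 := hPi hw (mem_closedBall_zero_iff.2 (h1.trans hρ1.le)) h2.symm
    refine ⟨h3, ?_⟩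
    conv_rhs => rw [h3]
    rw [norm_div]
    field_simp
  have hPge : ∀ w ∈ Metric.closedBall (0 : ℂ) 1, ρ ≤ ‖w‖ → ‖b‖ * ρ ≤ ‖P w‖ := by
    intro w hw hρw
    by_contra! hlt
    rw [(hPle w hw hlt.le).2, mul_lt_mul_iff_right₀ hbpos] at hlt
    exact absurd hρw hlt.not_ge
  obtain ⟨Φ, hΦ, hΦi, hΦfix, hΦ1, hΦr, hΦδ, hΦs⟩ := exists_radial_push hr0 hbρ hδ
  set A : Circle × Icc (0 : ℝ) 1 → ℂ := fun p => ((ρ + (1 - ρ) * p.2 : ℝ) : ℂ) * p.1 with hA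
  have hAc : Continuous A := by
    have h1 : Continuous fun p : Circle × Icc (0 : ℝ) 1 => (p.1 : ℂ) :=
      continuous_subtype_val.comp continuous_fst
    exact (Complex.continuous_ofReal.comp (by fun_prop)).mul h1
  have hAnn : ∀ p : Circle × Icc (0 : ℝ) 1, 0 < ρ + (1 - ρ) * p.2 := fun p =>
    add_pos_of_pos_of_nonneg hρ (mul_nonneg (by linarith) p.2.2.1)
  have hAn : ∀ p, ‖A p‖ = ρ + (1 - ρ) * p.2 := fun p => by
    simp only [hA]
    rw [norm_mul, Circle.norm_coe, mul_one, Complex.norm_real, Real.norm_of_nonneg (hAnn p).le]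
  have hAi : Function.Injective A := by
    intro p q hpq
    have h1 : (ρ + (1 - ρ) * p.2 : ℝ) = ρ + (1 - ρ) * q.2 := by rw [← hAn, ← hAn, hpq]
    have h2 : p.2 = q.2 :=
      Subtype.ext (mul_left_cancel₀ (by linarith : 1 - ρ ≠ 0) (add_left_cancel h1))
    refine Prod.ext ?_ h2
    simp only [hA] at hpq
    rw [h2] at hpq
    exact Subtype.ext (mul_left_cancel₀ (Complex.ofReal_ne_zero.2 (hAnn q).ne') hpq)
  have hAcb : ∀ p, A p ∈ Metric.closedBall (0 : ℂ) 1 := fun p => by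
    rw [mem_closedBall_zero_iff, hAn]
    nlinarith [p.2.2.2]
  have hAρ : ∀ p, ρ ≤ ‖A p‖ := fun p => by
    rw [hAn]
    nlinarith [p.2.2.1]
  have hAs : ∀ w ∈ Metric.closedBall (0 : ℂ) 1, ρ ≤ ‖w‖ → ∃ p, A p = w := by
    intro w hw hρw
    have hw0 : w ≠ 0 := norm_pos_iff.1 (hρ.trans_le hρw)
    have h1 : 0 < 1 - ρ := by linarith
    refine ⟨(radial w hw0, ⟨(‖w‖ - ρ) / (1 - ρ), div_nonneg (by linarith) h1.le, ?_⟩), ?_⟩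
    · rw [div_le_one h1]
      linarith [mem_closedBall_zero_iff.1 hw]
    · simp only [hA]
      rw [mul_div_cancel₀ _ h1.ne', add_sub_cancel, norm_mul_radial]
  have hPA : ∀ p, ‖b‖ * ρ ≤ ‖P (A p)‖ := fun p => hPge _ (hAcb p) (hAρ p)
  have hPABC : ∀ p, P (A p) ∈ B ∪ C := fun p => hPBC.subset ⟨_, hAcb p, rfl⟩
  have hrange : range (fun p => Φ (P (A p))) = {z | 1 ≤ ‖z‖} ∩ (B ∪ C) := by
    ext y
    constructor
    · rintro ⟨p, rfl⟩
      refine ⟨hΦ1 _ (hPA p), ?_⟩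
      simp only
      rcases le_total (1 + δ) ‖P (A p)‖ with h1 | h1
      · rw [hΦfix _ h1]
        exact hPABC p
      · exact Or.inl (hδB (mem_closedBall_zero_iff.2 (hΦδ _ (hPA p) h1)))
    · rintro ⟨hy1, hyB⟩
      obtain ⟨z, hz, hzB, hzy⟩ : ∃ z, ‖b‖ * ρ ≤ ‖z‖ ∧ z ∈ B ∪ C ∧ Φ z = y := by
        rcases le_total (1 + δ) ‖y‖ with h1 | h1
        · exact ⟨y, by linarith, hyB, hΦfix y h1⟩
        · obtain ⟨z, h2, h3, h4⟩ := hΦs y hy1 h1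
          exact ⟨z, h2, Or.inl (hδB (mem_closedBall_zero_iff.2 h3)), h4⟩
      obtain ⟨w, hw, rfl⟩ := hPBC.superset hzB
      have hρw : ρ ≤ ‖w‖ := by
        by_contra! hlt
        rw [hPl w hlt.le, norm_mul] at hz
        exact absurd hz (mul_lt_mul_of_pos_left hlt hbpos).not_ge
      obtain ⟨p, rfl⟩ := hAs w hw hρw
      exact ⟨p, hzy⟩
  refine ⟨fun p => Φ (P (A p)), ?_, ?_, ?_, ?_, hrange⟩
  · exact hΦ.comp_continuous (hP.comp_continuous hAc hAcb) hPA
  · intro p q hpq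
    exact hAi (hPi (hAcb p) (hAcb q) (hΦi (hPA p) (hPA q) hpq))
  · have key : ∀ p, ‖Φ (P (A p))‖ = 1 ↔ (p.2 : ℝ) = 0 := by
      intro p
      have h1 : ‖A p‖ = ρ ↔ (p.2 : ℝ) = 0 := by
        rw [hAn, add_eq_left, mul_eq_zero, or_iff_right (by linarith : (1 - ρ : ℝ) ≠ 0)]
      rw [hΦr _ (hPA p), ← h1]
      constructor
      · intro h2
        have h3 := (hPle _ (hAcb p) h2.le).2
        rw [h2] at h3
        exact (mul_left_cancel₀ hbpos.ne' h3).symm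
      · intro h2
        rw [hPl _ h2.le, norm_mul, h2]
    ext y
    constructor
    · rintro ⟨p, hp, rfl⟩
      exact (key p).2 hp
    · intro hy
      obtain ⟨p, rfl⟩ := hrange.superset
        ⟨le_of_eq (Eq.symm hy), Or.inl (hdisc (mem_closedBall_zero_iff.2 (le_of_eq hy)))⟩
      exact ⟨p, (key p).1 hy, rfl⟩
  · have hA1 : A '' {p | (p.2 : ℝ) = 1} = Metric.sphere 0 1 := by
      have h1 : ∀ p, ‖A p‖ = 1 ↔ (p.2 : ℝ) = 1 := fun p => by
        rw [hAn]
        constructor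
        · intro h2
          refine mul_left_cancel₀ (by linarith : (1 - ρ : ℝ) ≠ 0) ?_
          linarith
        · intro h2
          rw [h2]
          ring
      ext w
      rw [mem_sphere_zero_iff_norm]
      constructor
      · rintro ⟨p, hp, rfl⟩
        exact (h1 p).2 hp
      · intro hw
        obtain ⟨p, rfl⟩ := hAs w (mem_closedBall_zero_iff.2 hw.le) (by rw [hw]; exact hρ1.le)
        exact ⟨p, (h1 p).1 hw, rfl⟩
    have h2 : (fun p => Φ (P (A p))) '' {p | (p.2 : ℝ) = 1} =
        Φ '' (P '' (A '' {p | (p.2 : ℝ) = 1})) := by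
      rw [image_image, image_image]
    rw [h2, hA1, hPC']
    exact (image_congr fun z hz => hΦfix z (hCδ z hz)).trans (image_id' C)

end CircleDecomp

open CircleDecomp

/-- Let `S` be a surface, `𝒞` a circle decomposition of `S`, and `C₀` a connected
component of the boundary `∂S` which is homeomorphic to the circle. Then `C₀ ∈ 𝒞`, and
there is an embedded half-open collar annulus `Circle × [0,1] ↪ S` whose bottom circle is
`C₀`, whose image is a neighborhood of `C₀`, and whose top circle belongs to `𝒞`. -/
theorem boundary_circle_mem_and_collar
    {S : Type*} [TopologicalSpace S] [T2Space S] [SecondCountableTopology S]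
    [ConnectedSpace S] [Nonempty S] [ChartedSpace (EuclideanHalfSpace 2) S]
    (𝒞 : Set (Set S)) (h𝒞 : IsCircleDecomposition 𝒞)
    (C₀ : Set S)
    (hcomp : ∃ x ∈ {y : S | ¬ IsManifoldInteriorPt y},
      C₀ = connectedComponentIn {y : S | ¬ IsManifoldInteriorPt y} x)
    (hcirc : Nonempty (C₀ ≃ₜ Circle)) :
    C₀ ∈ 𝒞 ∧
    ∃ h : Circle × Set.Icc (0:ℝ) 1 → S, Topology.IsEmbedding h ∧
      h '' {p : Circle × Set.Icc (0:ℝ) 1 | (p.2 : ℝ) = 0} = C₀ ∧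
      Set.range h ∈ nhdsSet C₀ ∧
      h '' {p : Circle × Set.Icc (0:ℝ) 1 | (p.2 : ℝ) = 1} ∈ 𝒞 := by
  obtain ⟨x, -, rfl⟩ := hcomp
  obtain ⟨ψ, hψ, hψ₀⟩ := exists_collar (x₀ := x) hcirc
  obtain ⟨hmem, C, hC, hdisc, hCn, hCmem⟩ := exists_essential_circle h𝒞 hψ hψ₀ hcirc
  refine ⟨hmem, ?_⟩
  have hCc : IsCompact C := isCircle_isCompact hC
  have h0C : (0 : ℂ) ∈ Cᶜ := fun h0 => by
    have := (hCn 0 h0).1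
    rw [norm_zero] at this
    linarith
  set B := connectedComponentIn Cᶜ (0 : ℂ) with hB
  have hBo : IsOpen B := hCc.isClosed.isOpen_compl.connectedComponentIn
  have hBb : Bornology.IsBounded B := hdisc (Metric.mem_closedBall_self zero_le_one)
  have hdiscB : Metric.closedBall (0 : ℂ) 1 ⊆ B :=
    (convex_closedBall (0 : ℂ) 1).isPreconnected.subset_connectedComponentIn
      (Metric.mem_closedBall_self zero_le_one) fun z hz hzC =>
        (mem_closedBall_zero_iff.1 hz).not_gt (hCn z hzC).1
  have hBconn : IsConnected B := isConnected_connectedComponentIn_iff.2 h0C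
  have hBc : IsPreconnected Bᶜ :=
    isPreconnected_compl_component (isCircle_isConnected hC).isPreconnected 0
  obtain ⟨f, G, hf, hG, hG0, hG', hfB, hGB, hl, hr⟩ := exists_inverse_riemann_map hBo
    hBconn.isPreconnected hBb (mem_connectedComponentIn h0C)
    fun f hf h0 => hasLog_of_simplyConnected hBo hBconn hBb hBc hf h0
  obtain ⟨Q, hQ, hQi, hQ0, hQ1, hQr⟩ := exists_annulus_param hC hBb
    ⟨hf, hG, hG0, hG', hfB, hGB, hl, hr⟩ hdiscB
  have hBn : ∀ z ∈ B ∪ C, ‖z‖ < 2 := by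
    intro z hz
    have hzh : z ∈ hull C := by
      rcases hz with hz | hz
      · rw [mem_hull, ← connectedComponentIn_eq hz]
        exact hBb
      · exact subset_hull C hz
    have := norm_le_of_mem_hull (fun w hw => (hCn w hw).2) hzh
    linarith
  have hQA : ∀ p, 1 ≤ ‖Q p‖ ∧ ‖Q p‖ < 2 := fun p =>
    have h1 := hQr.subset ⟨p, rfl⟩
    ⟨h1.1, hBn _ h1.2⟩
  set q : Circle × Set.Icc (0 : ℝ) 1 → Annulus := fun p => ⟨Q p, hQA p⟩ with hq
  have hqi : ∀ s : Set (Circle × Set.Icc (0 : ℝ) 1), q '' s = Subtype.val ⁻¹' (Q '' s) := by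
    intro s
    ext z
    constructor
    · rintro ⟨p, hp, rfl⟩
      exact ⟨p, hp, rfl⟩
    · rintro ⟨p, hp, hpz⟩
      exact ⟨p, hp, Subtype.ext hpz⟩
  refine ⟨ψ ∘ q, hψ.isEmbedding.comp (Continuous.isClosedEmbedding (hQ.subtype_mk hQA)
    fun a b hab => hQi (congrArg Subtype.val hab)).isEmbedding, ?_, ?_, ?_⟩
  · rw [image_comp, hqi, hQ0]
    exact hψ₀
  · rw [← hψ₀]
    refine Filter.mem_of_superset ((hψ.isOpenMap _ (hBo.preimage continuous_subtype_val)).mem_nhdsSet.2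
      (image_mono fun z hz => hdiscB (mem_closedBall_zero_iff.2 (le_of_eq hz)))) ?_
    rintro _ ⟨z, hz, rfl⟩
    obtain ⟨p, hp⟩ := hQr.superset ⟨z.2.1, Or.inl hz⟩
    exact ⟨p, congrArg ψ (Subtype.ext hp)⟩
  · rw [image_comp, hqi, hQ1]
    exact hCmem
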